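/- arXiv:math/0703211 — 7 statements merged into one kernel-verified Lean document; each statement's English description precedes it below -/
import Mathlib

section
/- Let R be a relational structure on an infinite set E. Then the profile of R is non-decreasing: for every natural number n, φ_R(n) ≤ φ_R(n+1) (as cardinal numbers). -/
open scoped Cardinal

universe u v

variable {α : Type u} {I : Type v}

/-- A relational structure of signature `ar : I → ℕ` on the domain `α` is given by a family
`rel` of `ar i`-ary relations on `α`.  `PreservesRel ar rel A f` says that the map `f`
preserves every relation of the structure on tuples drawn from `A`. -/
def PreservesRel (ar : I → ℕ) (rel : ∀ i, Set (Fin (ar i) → α)) (A : Set α) (f : α → α) :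
    Prop :=
  ∀ (i : I) (x : Fin (ar i) → α), (∀ j, x j ∈ A) → (x ∈ rel i ↔ (f ∘ x) ∈ rel i)

/-- `f` is an isomorphism from the substructure induced on `A` onto the one induced on `B`. -/
def IsLocalIso (ar : I → ℕ) (rel : ∀ i, Set (Fin (ar i) → α)) (A B : Set α) (f : α → α) :
    Prop :=
  Set.BijOn f A B ∧ PreservesRel ar rel A f

/-- The substructures induced on `A` and on `B` are isomorphic. -/
def IsoOn (ar : I → ℕ) (rel : ∀ i, Set (Fin (ar i) → α)) (A B : Set α) : Prop :=
  ∃ f : α → α, IsLocalIso ar rel A B f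

/-- The profile of a relational structure: the number (as a cardinal) of isomorphism classes of
substructures induced on `n`-element subsets of the domain. -/
def profile (ar : I → ℕ) (rel : ∀ i, Set (Fin (ar i) → α)) (n : ℕ) : Cardinal :=
  Cardinal.mk (Quot fun A B : {s : Finset α // s.card = n} =>
    IsoOn ar rel (↑A.1 : Set α) (↑B.1 : Set α))

/-- The profile, as a natural number (meaningful when it takes finite values). -/
noncomputable def profileNat (ar : I → ℕ) (rel : ∀ i, Set (Fin (ar i) → α)) (n : ℕ) : ℕ :=
  Nat.card (Quot fun A B : {s : Finset α // s.card = n} =>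
    IsoOn ar rel (↑A.1 : Set α) (↑B.1 : Set α))


theorem inclusion_injective_aux [DecidableEq α] (n : ℕ) : ∀ (S : Set α), S.Infinite →
    ∀ f : Finset α → ℚ,
    (∀ B : Finset α, (B : Set α) ⊆ S → B.card = n + 1 → ∑ x ∈ B, f (B.erase x) = 0) →
    ∀ A : Finset α, (A : Set α) ⊆ S → A.card = n → f A = 0 := by
  induction n with
  | zero =>
    intro S hS f hf A hA hc
    obtain ⟨w, hw⟩ := hS.nonempty
    have h := hf {w} (by simpa using hw) (by simp)
    rw [Finset.card_eq_zero] at hc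
    subst hc
    simpa using h
  | succ n ih =>
    intro S hS f hf A hA hc
    have expand : ∀ x ∈ S, ∀ B : Finset α, (B : Set α) ⊆ S → x ∉ B → B.card = n + 1 →
        f B + ∑ z ∈ B, f (insert x (B.erase z)) = 0 := by
      intro x hx B hB hxB hBc
      have h := hf (insert x B) (by simpa [Set.insert_subset_iff] using ⟨hx, hB⟩)
        (by rw [Finset.card_insert_of_notMem hxB, hBc])
      rw [Finset.sum_insert hxB, Finset.erase_insert hxB] at h
      rw [← h]
      congr 1
      apply Finset.sum_congr rfl
      intro z hz
      rw [Finset.erase_insert_of_ne]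
      rintro rfl
      exact hxB hz
    have exch : ∀ x ∈ S, ∀ y ∈ S, ∀ C : Finset α, (C : Set α) ⊆ S → x ∉ C → y ∉ C →
        C.card = n → f (insert x C) = f (insert y C) := by
      intro x hx y hy C hC hxC hyC hCc
      have hS' : (S \ {x, y}).Infinite := hS.sdiff (by simp)
      have h := ih (S \ {x, y}) hS' (fun A => f (insert x A) - f (insert y A)) ?_ C ?_ hCc
      · exact sub_eq_zero.mp h
      · intro B hB hBc
        have hBS : (B : Set α) ⊆ S := fun z hz => (hB hz).1
        have hxB : x ∉ B := fun hz => (hB hz).2 (by simp)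
        have hyB : y ∉ B := fun hz => (hB hz).2 (by simp)
        have h1 := expand x hx B hBS hxB hBc
        have h2 := expand y hy B hBS hyB hBc
        rw [Finset.sum_sub_distrib]
        linarith
      · intro z hz
        refine ⟨hC hz, ?_⟩
        rintro (rfl | rfl)
        · exact hxC hz
        · exact hyC hz
    obtain ⟨w, hwS, hwA⟩ := hS.exists_notMem_finset A
    have h1 := expand w hwS A hA hwA hc
    have h2 : ∑ z ∈ A, f (insert w (A.erase z)) = ∑ z ∈ A, f A := by
      apply Finset.sum_congr rfl
      intro z hz
      rw [exch w hwS z (hA hz) (A.erase z) (fun t ht => hA (Finset.mem_of_mem_erase ht))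
        (fun h => hwA (Finset.mem_of_mem_erase h)) (by simp)
        (by rw [Finset.card_erase_of_mem hz, hc]; rfl), Finset.insert_erase hz]
    rw [h2, Finset.sum_const, hc, nsmul_eq_mul] at h1
    have h3 : ((n : ℚ) + 2) * f A = 0 := by push_cast at h1; linarith
    rcases mul_eq_zero.mp h3 with h | h
    · exact absurd h (by positivity)
    · exact h

/-- The type of isomorphism classes. -/
abbrev IsoClass (ar : I → ℕ) (rel : ∀ i, Set (Fin (ar i) → α)) (n : ℕ) : Type u :=
  Quot fun A B : {s : Finset α // s.card = n} =>
    IsoOn ar rel (↑A.1 : Set α) (↑B.1 : Set α)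

open Classical in
/-- Multiset of classes of the `n`-subsets of an `n+1`-subset. -/
noncomputable def shadowClasses (ar : I → ℕ) (rel : ∀ i, Set (Fin (ar i) → α)) (n : ℕ)
    (B : {s : Finset α // s.card = n + 1}) : Multiset (IsoClass ar rel n) :=
  B.1.attach.val.map fun x => Quot.mk _ ⟨B.1.erase x.1, by
    rw [Finset.card_erase_of_mem x.2, B.2]; rfl⟩

theorem shadowClasses_eq (ar : I → ℕ) (rel : ∀ i, Set (Fin (ar i) → α)) (n : ℕ)
    (A B : {s : Finset α // s.card = n + 1})
    (h : IsoOn ar rel (↑A.1 : Set α) (↑B.1 : Set α)) :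
    shadowClasses ar rel n A = shadowClasses ar rel n B := by
  classical
  obtain ⟨f, hf, hp⟩ := h
  unfold shadowClasses
  refine Multiset.map_eq_map_of_bij_of_nodup _ _ (Finset.nodup _) (Finset.nodup _)
    (fun x _ => ⟨f x.1, hf.mapsTo x.2⟩) ?_ ?_ ?_ ?_
  · intro x _
    exact Finset.mem_attach _ _
  · intro x _ y _ hxy
    exact Subtype.ext (hf.injOn x.2 y.2 (Subtype.ext_iff.mp hxy))
  · intro y _
    obtain ⟨x, hx, hxy⟩ := hf.surjOn y.2
    exact ⟨⟨x, hx⟩, Finset.mem_attach _ _, Subtype.ext hxy⟩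
  · intro x _
    apply Quot.sound
    refine ⟨f, ?_, ?_⟩
    · simp only [Finset.coe_erase]
      have := hf.sdiff_singleton x.2
      exact this
    · intro i y hy
      exact hp i y fun j => Finset.mem_of_mem_erase (hy j)

/-- Shadow on classes. -/
noncomputable def shadowQ (ar : I → ℕ) (rel : ∀ i, Set (Fin (ar i) → α)) (n : ℕ) :
    IsoClass ar rel (n + 1) → Multiset (IsoClass ar rel n) :=
  Quot.lift (shadowClasses ar rel n) (shadowClasses_eq ar rel n)

/-- The linear map on invariant functions. -/
noncomputable def upMap (ar : I → ℕ) (rel : ∀ i, Set (Fin (ar i) → α)) (n : ℕ) :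
    (IsoClass ar rel n → ℚ) →ₗ[ℚ] (IsoClass ar rel (n + 1) → ℚ) where
  toFun c q := ((shadowQ ar rel n q).map c).sum
  map_add' c d := by ext q; simp [Multiset.sum_map_add]
  map_smul' r c := by ext q; simp [Multiset.sum_map_mul_left]

theorem upMap_injective [Infinite α] (ar : I → ℕ) (rel : ∀ i, Set (Fin (ar i) → α)) (n : ℕ) :
    Function.Injective (upMap ar rel n) := by
  classical
  rw [injective_iff_map_eq_zero]
  intro c hc
  let F : Finset α → ℚ := fun A => if h : A.card = n then c (Quot.mk _ ⟨A, h⟩) else 0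
  have key := inclusion_injective_aux n Set.univ Set.infinite_univ F (by
    intro B _ hB
    have h := congrFun hc (Quot.mk _ ⟨B, hB⟩)
    have h2 : ∑ x ∈ B.attach, F (B.erase x.1) = 0 := by
      refine Eq.trans ?_ h
      simp only [upMap, shadowQ, shadowClasses, LinearMap.coe_mk, AddHom.coe_mk,
        Multiset.map_map, Finset.sum]
      congr 1
      apply Multiset.map_congr rfl
      intro x _
      have : (B.erase x.1).card = n := by rw [Finset.card_erase_of_mem x.2, hB]; rfl
      simp only [F, dif_pos this, Function.comp]
    rwa [Finset.sum_attach B (fun x => F (B.erase x))] at h2)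
  ext q
  obtain ⟨A, hA⟩ := q
  have := key A (Set.subset_univ _) hA
  simpa only [F, dif_pos hA, Pi.zero_apply] using this

theorem shadow_cover [Infinite α] (ar : I → ℕ) (rel : ∀ i, Set (Fin (ar i) → α)) (n : ℕ)
    (q : IsoClass ar rel n) : ∃ p, q ∈ shadowQ ar rel n p := by
  classical
  obtain ⟨A, hA⟩ := q
  obtain ⟨w, hw⟩ := Infinite.exists_notMem_finset A
  refine ⟨Quot.mk _ ⟨insert w A, by rw [Finset.card_insert_of_notMem hw, hA]⟩, ?_⟩
  simp only [shadowQ, shadowClasses, Multiset.mem_map]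
  refine ⟨⟨w, Finset.mem_insert_self _ _⟩, Finset.mem_attach _ _, ?_⟩
  congr 2
  exact Finset.erase_insert hw

/-- **Theorem (Fraïssé–Pouzet).** If `R` is a relational structure on an infinite set then its
profile is non-decreasing. -/
theorem profile_nondecreasing_of_infinite [Infinite α]
    (ar : I → ℕ) (rel : ∀ i, Set (Fin (ar i) → α)) (n : ℕ) :
    profile ar rel n ≤ profile ar rel (n + 1) := by
  classical
  change #(IsoClass ar rel n) ≤ #(IsoClass ar rel (n + 1))
  have hcov : (⋃ p, {q | q ∈ shadowQ ar rel n p}) = Set.univ := by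
    ext q
    simpa using shadow_cover ar rel n q
  have hfin : ∀ p, {q | q ∈ shadowQ ar rel n p}.Finite := fun p =>
    (shadowQ ar rel n p).toFinset.finite_toSet.subset (by intro q hq; simpa using hq)
  rcases finite_or_infinite (IsoClass ar rel (n + 1)) with hF | hI
  · have hF' : Finite (IsoClass ar rel n) := by
      rw [← Set.finite_univ_iff, ← hcov]
      exact Set.finite_iUnion hfin
    have := Fintype.ofFinite (IsoClass ar rel n)
    have := Fintype.ofFinite (IsoClass ar rel (n + 1))
    have h := LinearMap.finrank_le_finrank_of_injective (upMap_injective ar rel n)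
    rw [Module.finrank_fintype_fun_eq_card, Module.finrank_fintype_fun_eq_card] at h
    rw [Cardinal.mk_fintype, Cardinal.mk_fintype]
    exact_mod_cast h
  · rw [← Cardinal.mk_univ, ← hcov]
    refine (Cardinal.mk_iUnion_le_sum_mk).trans ?_
    refine (Cardinal.sum_le_sum _ (fun _ => ℵ₀) fun p => (hfin p).lt_aleph0.le).trans ?_
    rw [Cardinal.sum_const']
    exact (Cardinal.mul_aleph0_eq (Cardinal.aleph0_le_mk _)).le
end

section
/- Let R be a relational structure on a set E and let n, k be natural numbers. If E has at least 2n+k elements, then φ_R(n) ≤ φ_R(n+k) (as cardinal numbers). -/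
open scoped Cardinal

universe u v

variable {α : Type u} {I : Type v}

/-- Exchange-invariant functions are constant on `n`-subsets of `S`. -/
theorem kantor_const {α : Type*} [DecidableEq α] (S : Finset α) (F : Finset α → ℚ) (n : ℕ)
    (hF : ∀ x ∈ S, ∀ y ∈ S, x ≠ y → ∀ A ⊆ S, x ∉ A → y ∉ A → A.card + 1 = n →
      F (insert x A) = F (insert y A)) :
    ∀ d : ℕ, ∀ A ⊆ S, ∀ A' ⊆ S, A.card = n → A'.card = n → (A \ A').card = d → F A = F A' := by
  intro d
  induction d with
  | zero =>
    intro A _ A' _ h1 h2 h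
    have : A ⊆ A' := Finset.sdiff_eq_empty_iff_subset.1 (Finset.card_eq_zero.1 h)
    rw [Finset.eq_of_subset_of_card_le this (by omega)]
  | succ d ih =>
    intro A hA A' hA' h1 h2 h
    obtain ⟨x, hx⟩ : (A \ A').Nonempty := Finset.card_pos.1 (by omega)
    have h3 : (A' \ A).card = d + 1 := by
      rw [← h]; exact Finset.card_sdiff_comm (by omega)
    obtain ⟨y, hy⟩ : (A' \ A).Nonempty := Finset.card_pos.1 (by omega)
    rw [Finset.mem_sdiff] at hx hy
    have hxy : x ≠ y := fun e => hx.2 (e ▸ hy.1)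
    have hc := Finset.card_erase_add_one hx.1
    have hyA : y ∉ A.erase x := fun h => hy.2 (Finset.mem_of_mem_erase h)
    have e1 := hF x (hA hx.1) y (hA' hy.1) hxy (A.erase x) ((Finset.erase_subset _ _).trans hA)
      (Finset.notMem_erase _ _) hyA (by omega)
    rw [Finset.insert_erase hx.1] at e1
    rw [e1]
    apply ih _ _ _ hA' _ h2
    · have : insert y (A.erase x) \ A' = (A \ A').erase x := by
        ext z; simp only [Finset.mem_sdiff, Finset.mem_insert, Finset.mem_erase]
        constructor
        · rintro ⟨rfl | h, h'⟩
          · exact absurd hy.1 h'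
          · exact ⟨h.1, h.2, h'⟩
        · rintro ⟨h, h', h''⟩
          exact ⟨Or.inr ⟨h, h'⟩, h''⟩
      rw [this, Finset.card_erase_of_mem (Finset.mem_sdiff.2 hx)]; omega
    · exact Finset.insert_subset (hA' hy.1) ((Finset.erase_subset _ _).trans hA)
    · rw [Finset.card_insert_of_notMem hyA]; omega

/-- Sum over the `(n+1)`-subsets of `insert x B`. -/
theorem kantor_split {α : Type*} [DecidableEq α] (F : Finset α → ℚ) (n : ℕ) (B : Finset α) (x : α)
    (hx : x ∉ B) : ∑ A ∈ (insert x B).powersetCard (n + 1), F A =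
      ∑ A ∈ B.powersetCard (n + 1), F A + ∑ A ∈ B.powersetCard n, F (insert x A) := by
  rw [Finset.powersetCard_succ_insert hx, Finset.sum_union, Finset.sum_image]
  · intro A hA A' hA' h
    have h1 : x ∉ A := fun h => hx ((Finset.mem_powersetCard.1 hA).1 h)
    have h2 : x ∉ A' := fun h => hx ((Finset.mem_powersetCard.1 hA').1 h)
    rw [← Finset.erase_insert h1, ← Finset.erase_insert h2]
    exact congrArg (fun s => Finset.erase s x) h
  · rw [Finset.disjoint_left]
    intro A hA hA'
    obtain ⟨C, _, rfl⟩ := Finset.mem_image.1 hA'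
    exact hx ((Finset.mem_powersetCard.1 hA).1 (Finset.mem_insert_self _ _))

/-- Injectivity of the inclusion matrix (Gottlieb, Kantor). -/
theorem kantor {α : Type*} [DecidableEq α] (n : ℕ) : ∀ (m : ℕ) (S : Finset α) (F : Finset α → ℚ),
    n ≤ m → n + m ≤ S.card →
    (∀ B ⊆ S, B.card = m → ∑ A ∈ B.powersetCard n, F A = 0) →
    ∀ A ⊆ S, A.card = n → F A = 0 := by
  induction n with
  | zero =>
    intro m S F _ hS h A _ hA
    obtain ⟨B, hB, hm⟩ := Finset.exists_subset_card_eq (show m ≤ S.card by omega)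
    have := h B hB hm
    rw [Finset.card_eq_zero.1 hA]
    simpa using this
  | succ n ih =>
    intro m S F hnm hS h A hA hAn
    obtain ⟨m, rfl⟩ : ∃ k, m = k + 1 := ⟨m - 1, by omega⟩
    have key : ∀ x ∈ S, ∀ y ∈ S, x ≠ y → ∀ A ⊆ S, x ∉ A → y ∉ A → A.card + 1 = n + 1 →
      F (insert x A) = F (insert y A) := by
      intro x hx y hy hxy A hA hxA hyA hc
      have := ih m ((S.erase x).erase y) (fun A => F (insert x A) - F (insert y A)) (by omega)
        (by
          rw [Finset.card_erase_of_mem (Finset.mem_erase.2 ⟨hxy.symm, hy⟩),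
            Finset.card_erase_of_mem hx]; omega)
        (by
          intro B hB hm
          have hxB : x ∉ B := fun h => by simpa using hB h
          have hyB : y ∉ B := fun h => by simpa using hB h
          have hBS : B ⊆ S := hB.trans ((Finset.erase_subset _ _).trans (Finset.erase_subset _ _))
          have e1 := h (insert x B) (Finset.insert_subset hx hBS)
            (by rw [Finset.card_insert_of_notMem hxB, hm])
          have e2 := h (insert y B) (Finset.insert_subset hy hBS)
            (by rw [Finset.card_insert_of_notMem hyB, hm])
          rw [kantor_split _ _ _ _ hxB] at e1
          rw [kantor_split _ _ _ _ hyB] at e2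
          rw [Finset.sum_sub_distrib]
          linarith)
        A (by
          intro z hz
          rw [Finset.mem_erase, Finset.mem_erase]
          exact ⟨fun e => hyA (e ▸ hz), fun e => hxA (e ▸ hz), hA hz⟩) (by omega)
      linarith
    obtain ⟨B, hB, hm⟩ := Finset.exists_subset_card_eq (show m + 1 ≤ S.card by omega)
    have e := h B hB hm
    rw [Finset.sum_congr rfl (fun A' hA' => kantor_const S F (n + 1) key _ A'
      ((Finset.mem_powersetCard.1 hA').1.trans hB) A hA (Finset.mem_powersetCard.1 hA').2 hAn rfl),
      Finset.sum_const, Finset.card_powersetCard, hm, nsmul_eq_mul] at e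
    have : ((m + 1).choose (n + 1) : ℚ) ≠ 0 := by
      exact_mod_cast (Nat.choose_pos hnm).ne'
    exact (mul_eq_zero.1 e).resolve_left this

open Classical in
/-- The basis vector of the class of `A` (zero if `A` does not have `n` elements). -/
noncomputable def clsVec (ar : I → ℕ) (rel : ∀ i, Set (Fin (ar i) → α)) (n : ℕ) (A : Finset α) :
    IsoClass ar rel n →₀ ℚ :=
  if h : A.card = n then Finsupp.single (Quot.mk _ ⟨A, h⟩) 1 else 0

/-- Formal sum of the classes of `n`-subsets of `B`. -/
noncomputable def subVec (ar : I → ℕ) (rel : ∀ i, Set (Fin (ar i) → α)) (n : ℕ) (B : Finset α) :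
    IsoClass ar rel n →₀ ℚ :=
  ∑ A ∈ B.powersetCard n, clsVec ar rel n A

theorem subVec_congr (ar : I → ℕ) (rel : ∀ i, Set (Fin (ar i) → α)) (n : ℕ) (B C : Finset α)
    (h : IsoOn ar rel (B : Set α) (C : Set α)) : subVec ar rel n B = subVec ar rel n C := by
  classical
  obtain ⟨f, hf, hp⟩ := h
  have hC : C = B.image f := by
    apply Finset.coe_injective
    rw [Finset.coe_image, hf.image_eq]
  unfold subVec
  refine Finset.sum_bij (fun A _ => A.image f) ?_ ?_ ?_ ?_
  · intro A hA
    rw [Finset.mem_powersetCard] at hA ⊢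
    refine ⟨hC ▸ Finset.image_subset_image hA.1, ?_⟩
    rw [Finset.card_image_of_injOn (hf.injOn.mono (Finset.coe_subset.2 hA.1)), hA.2]
  · intro A hA A' hA' e
    rw [Finset.mem_powersetCard] at hA hA'
    apply Finset.coe_injective
    refine (hf.injOn.image_eq_image_iff (Finset.coe_subset.2 hA.1) (Finset.coe_subset.2 hA'.1)).1 ?_
    have := congrArg (fun s : Finset α => (s : Set α)) e
    simpa using this
  · intro D hD
    rw [Finset.mem_powersetCard, hC, Finset.subset_image_iff] at hD
    obtain ⟨⟨A, hA, rfl⟩, hn⟩ := hD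
    refine ⟨A, Finset.mem_powersetCard.2 ⟨hA, ?_⟩, rfl⟩
    rw [← hn, Finset.card_image_of_injOn (hf.injOn.mono (Finset.coe_subset.2 hA))]
  · intro A hA
    rw [Finset.mem_powersetCard] at hA
    have hi := hf.injOn.mono (Finset.coe_subset.2 hA.1)
    have hn : (A.image f).card = n := by rw [Finset.card_image_of_injOn hi, hA.2]
    unfold clsVec
    rw [dif_pos hA.2, dif_pos hn]
    congr 1
    apply Quot.sound
    refine ⟨f, ?_, fun i x hx => hp i x fun j => hA.1 (hx j)⟩
    simp only [Finset.coe_image]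
    exact hi.bijOn_image

/-- **Theorem.** If a relational structure `R` lives on a set `E` with at least `2n + k`
elements, then `φ_R(n) ≤ φ_R(n + k)`. -/
theorem profile_le_of_card_ge (ar : I → ℕ) (rel : ∀ i, Set (Fin (ar i) → α)) (n k : ℕ)
    (hcard : ((2 * n + k : ℕ) : Cardinal) ≤ Cardinal.mk α) :
    profile ar rel n ≤ profile ar rel (n + k) := by
  classical
  let u : IsoClass ar rel (n + k) → (IsoClass ar rel n →₀ ℚ) :=
    Quot.lift (fun B => subVec ar rel n B.1) (fun B C h => subVec_congr ar rel n _ _ h)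
  have hspan : Submodule.span ℚ (Set.range u) = ⊤ := by
    by_contra hne
    obtain ⟨g, hg, hle⟩ := Submodule.exists_le_ker_of_lt_top _ (lt_top_iff_ne_top.2 hne)
    apply hg
    apply Finsupp.lhom_ext'
    intro c
    apply LinearMap.ext_ring
    induction c using Quot.ind with
    | mk A =>
    obtain ⟨A, hA⟩ := A
    have hS : ∃ S : Finset α, A ⊆ S ∧ 2 * n + k ≤ S.card := by
      obtain ⟨T, hT⟩ : ∃ T : Finset α, T.card = 2 * n + k := by
        rcases finite_or_infinite α with hfin | hinf
        · have := Fintype.ofFinite α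
          rw [Cardinal.mk_fintype, Nat.cast_le] at hcard
          obtain ⟨T, -, hT⟩ := Finset.exists_subset_card_eq
            (show 2 * n + k ≤ (Finset.univ : Finset α).card by rwa [Finset.card_univ])
          exact ⟨T, hT⟩
        · exact Infinite.exists_subset_card_eq α _
      exact ⟨A ∪ T, Finset.subset_union_left,
        hT ▸ Finset.card_le_card Finset.subset_union_right⟩
    obtain ⟨S, hAS, hS⟩ := hS
    have := kantor n (n + k) S (fun A => g (clsVec ar rel n A)) (by omega) (by omega)
      (by
        intro B _ hB
        have h1 : u (Quot.mk _ ⟨B, hB⟩) ∈ LinearMap.ker g :=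
          hle (Submodule.subset_span (Set.mem_range_self (f := u) (Quot.mk _ ⟨B, hB⟩)))
        rw [LinearMap.mem_ker] at h1
        rw [← map_sum]
        exact h1) A hAS hA
    simpa [clsVec, hA] using this
  have h1 : Module.rank ℚ (IsoClass ar rel n →₀ ℚ) ≤ Cardinal.mk (Set.range u) := by
    rw [← rank_top ℚ (IsoClass ar rel n →₀ ℚ), ← hspan]
    exact rank_span_le _
  rw [rank_finsupp_self, Cardinal.lift_uzero] at h1
  exact h1.trans Cardinal.mk_range_le
end

section
/- Let n, k, m be natural numbers with 2n+k ≤ m, let E be an m-element set, and let M_{n,n+k} be the matrix over the field ℚ of rational numbers whose rows are indexed by the n-element subsets P of E and whose columns are indexed by the (n+k)-element subsets Q of E, with entry equal to 1 if P ⊆ Q and 0 otherwise. Then M_{n,n+k} has full row rank, i.e., its rank equals the binomial coefficient C(m,n). -/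
/-- Double counting: summing over the `j`-subsets avoiding `y`, for all `y ∈ Q`. -/
lemma sum_erase_powersetCard {α : Type*} [DecidableEq α] (Q : Finset α) (j : ℕ)
    (g : Finset α → ℚ) :
    ∑ y ∈ Q, ∑ P ∈ Finset.powersetCard j (Q.erase y), g P
      = ((Q.card - j : ℕ) : ℚ) * ∑ P ∈ Finset.powersetCard j Q, g P := by
  rw [Finset.sum_comm' (t' := Finset.powersetCard j Q) (s' := fun P => Q \ P)]
  · rw [Finset.mul_sum]
    refine Finset.sum_congr rfl fun P hP => ?_
    rw [Finset.mem_powersetCard] at hP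
    rw [Finset.sum_const, nsmul_eq_mul, Finset.card_sdiff_of_subset hP.1, hP.2]
  · intro y P
    simp only [Finset.mem_powersetCard, Finset.mem_sdiff, Finset.subset_erase]
    tauto

/-- A function on `n`-subsets of `S` whose sums over all `(n+k)`-subsets vanish is zero. -/
lemma eq_zero_of_sums {α : Type*} [DecidableEq α] (n : ℕ) :
    ∀ (k : ℕ) (S : Finset α) (f : Finset α → ℚ), 2 * n + k ≤ S.card →
      (∀ Q ⊆ S, Q.card = n + k → ∑ P ∈ Finset.powersetCard n Q, f P = 0) →
      ∀ P ⊆ S, P.card = n → f P = 0 := by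
  induction n with
  | zero =>
    intro k S f hS hf P hP hc
    obtain ⟨Q, hQ, hQc⟩ := Finset.exists_subset_card_eq (s := S) (n := k) (by omega)
    have := hf Q hQ (by omega)
    rw [Finset.card_eq_zero] at hc
    simpa [hc] using this
  | succ n ih =>
    intro k S f hS hf P hP hc
    obtain ⟨x, hx⟩ : P.Nonempty := Finset.card_pos.1 (by omega)
    have hxS := hP hx
    have key := ih (k + 1) (S.erase x) (fun R => f (insert x R))
      (by rw [Finset.card_erase_of_mem hxS]; omega) ?_ (P.erase x)
      (Finset.erase_subset_erase _ hP) (by rw [Finset.card_erase_of_mem hx]; omega)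
    · simpa [Finset.insert_erase hx] using key
    intro Q hQ hQc
    rw [Finset.subset_erase] at hQ
    have h0 := hf Q hQ.1 (by omega)
    have h1 : ∀ y ∈ Q, ∑ R ∈ Finset.powersetCard (n + 1) (Q.erase y), f R
        + ∑ R ∈ Finset.powersetCard n (Q.erase y), f (insert x R) = 0 := by
      intro y hy
      have hxy : x ∉ Q.erase y := fun h => hQ.2 (Finset.mem_of_mem_erase h)
      have h2 := hf (insert x (Q.erase y))
        (Finset.insert_subset hxS ((Finset.erase_subset _ _).trans hQ.1))
        (by rw [Finset.card_insert_of_notMem hxy, Finset.card_erase_of_mem hy]; omega)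
      rw [Finset.powersetCard_succ_insert hxy, Finset.sum_union, Finset.sum_image] at h2
      · exact h2
      · intro A hA B hB hAB
        have hA' : x ∉ A := fun h => hxy ((Finset.mem_powersetCard.1 hA).1 h)
        have hB' : x ∉ B := fun h => hxy ((Finset.mem_powersetCard.1 hB).1 h)
        rw [← Finset.erase_insert hA', ← Finset.erase_insert hB']
        exact congrArg (fun T => Finset.erase T x) hAB
      · rw [Finset.disjoint_left]
        intro A hA hA2
        obtain ⟨B, _, rfl⟩ := Finset.mem_image.1 hA2
        exact hxy ((Finset.mem_powersetCard.1 hA).1 (Finset.mem_insert_self x B))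
    have h3 := Finset.sum_eq_zero h1
    rw [Finset.sum_add_distrib, sum_erase_powersetCard,
      sum_erase_powersetCard Q n (fun R => f (insert x R)), h0, mul_zero, zero_add] at h3
    refine (mul_eq_zero.1 h3).resolve_left ?_
    rw [Nat.cast_eq_zero]
    omega

/-- **Theorem (Gottlieb, Kantor).** Let `n, k, m` be natural numbers with `2n + k ≤ m` and let
`E` be an `m`-element set.  The inclusion matrix over `ℚ`, whose rows are indexed by the
`n`-element subsets `P` of `E`, whose columns are indexed by the `(n+k)`-element subsets `Q` of
`E`, and whose `(P, Q)` entry is `1` if `P ⊆ Q` and `0` otherwise, has full row rank: its rank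
equals the binomial coefficient `C(m, n)`. -/
theorem inclusionMatrix_full_row_rank (n k m : ℕ) (h : 2 * n + k ≤ m) :
    Matrix.rank
      (Matrix.of fun (P : {P : Finset (Fin m) // P.card = n})
          (Q : {Q : Finset (Fin m) // Q.card = n + k}) =>
        if P.1 ⊆ Q.1 then (1 : ℚ) else 0) = Nat.choose m n := by
  have hli : LinearIndependent ℚ (Matrix.of fun (P : {P : Finset (Fin m) // P.card = n})
          (Q : {Q : Finset (Fin m) // Q.card = n + k}) =>
        if P.1 ⊆ Q.1 then (1 : ℚ) else 0).row := by
    rw [Fintype.linearIndependent_iff]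
    intro g hg
    have key := eq_zero_of_sums n k (Finset.univ : Finset (Fin m))
      (fun P => if hP : P.card = n then g ⟨P, hP⟩ else 0) (by simpa using h) ?_
    · intro P
      simpa [P.2] using key P.1 (Finset.subset_univ _) P.2
    intro Q _ hQ
    have h1 := congrFun hg ⟨Q, hQ⟩
    simp only [Finset.sum_apply, Pi.smul_apply, Matrix.row, Matrix.of_apply, smul_eq_mul,
      Pi.zero_apply, mul_ite, mul_one, mul_zero] at h1
    rw [← Finset.sum_filter] at h1
    rw [← h1]
    symm
    refine Finset.sum_bij (fun P _ => P.1) ?_ ?_ ?_ ?_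
    · intro P hP
      simpa [Finset.mem_powersetCard, P.2] using hP
    · intro P _ P' _ hh
      exact Subtype.ext hh
    · intro P hP
      rw [Finset.mem_powersetCard] at hP
      exact ⟨⟨P, hP.2⟩, by simpa using hP.1, rfl⟩
    · intro P _
      simp [P.2]
  rw [hli.rank_matrix]
  simp
end

section
/- Let R be an infinite relational structure admitting a monomorphic decomposition into finitely many blocks, with profile taking only finite values, and let k ≥ 1 be the least number of infinite blocks occurring in any monomorphic decomposition of R into finitely many blocks. Then there is a positive real number a such that φ_R(n)/n^{k−1} → a as n → ∞ (i.e., φ_R(n) ∼ a·n^{k−1}). -/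
open scoped Cardinal

universe u v

variable {α : Type u} {I : Type v}

/-- A monomorphic decomposition of a relational structure: a partition `Prt` of the domain such
that the substructures induced on two finite subsets `A, A'` of the same size are isomorphic
whenever `A` and `A'` meet each block of `Prt` in sets of the same size. -/
def IsMonoDecomp (ar : I → ℕ) (rel : ∀ i, Set (Fin (ar i) → α)) (Prt : Set (Set α)) : Prop :=
  Setoid.IsPartition Prt ∧
    ∀ A A' : Finset α, A.card = A'.card →
      (∀ B ∈ Prt, ((↑A : Set α) ∩ B).ncard = ((↑A' : Set α) ∩ B).ncard) →
      IsoOn ar rel (↑A : Set α) (↑A' : Set α)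

section Counting

open Filter Finset

open scoped Classical Topology

variable {ι : Type*} [Fintype ι]

/-- `d` is `D`-generic: all entries are at least `D` and pairwise at distance at least `D`. -/
def Gen (D : ℕ) (d : ι → ℕ) : Prop :=
  (∀ i, D ≤ d i) ∧ ∀ i j, i ≠ j → d i + D ≤ d j ∨ d j + D ≤ d i

lemma Gen.mono {D D' : ℕ} {d : ι → ℕ} (h : D ≤ D') (hd : Gen D' d) : Gen D d := by
  refine ⟨fun i => h.trans (hd.1 i), fun i j hij => ?_⟩
  rcases hd.2 i j hij with h1 | h1 <;> omega

lemma card_PA [Nonempty ι] (m : ℕ) : (piAntidiag (univ : Finset ι) m).card =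
    (m + (Fintype.card ι - 1)).choose (Fintype.card ι - 1) := by
  have h1 : (piAntidiag (univ : Finset ι) m).card =
      Nat.card {P : ι → ℕ // ∑ i, P i = m} := by
    rw [← Fintype.card_coe, ← Nat.card_eq_fintype_card]
    exact Nat.card_congr (Equiv.subtypeEquivRight (by simp))
  rw [h1, ← Nat.card_congr (Sym.equivNatSumOfFintype ι m), Nat.card_eq_fintype_card,
    Sym.card_sym_eq_choose]
  have : 0 < Fintype.card ι := Fintype.card_pos
  rw [← Nat.choose_symm_of_eq_add (n := Fintype.card ι + m - 1) (a := Fintype.card ι - 1) (b := m)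
    (by omega)]
  congr 1
  omega

lemma tendsto_PA [Nonempty ι] :
    Tendsto (fun m : ℕ => ((piAntidiag (univ : Finset ι) m).card : ℝ) /
      (m : ℝ) ^ (Fintype.card ι - 1)) atTop (𝓝 (1 / ((Fintype.card ι - 1).factorial : ℝ))) := by
  simp_rw [card_PA]
  generalize Fintype.card ι - 1 = k
  have h1 := (isEquivalent_choose k)
  have hf : ((k.factorial : ℕ) : ℝ) ≠ 0 := by positivity
  have h2 : Tendsto (fun n : ℕ => (n.choose k : ℝ) / ((n : ℝ) ^ k / k.factorial)) atTop (𝓝 1) := by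
    refine (Asymptotics.isEquivalent_iff_tendsto_one ?_).1 h1
    filter_upwards [eventually_gt_atTop 0] with n hn
    positivity
  have h3 := h2.comp (tendsto_add_atTop_nat k)
  have h4 : Tendsto (fun m : ℕ => (((m + k : ℕ) : ℝ) / (m : ℝ)) ^ k) atTop (𝓝 1) := by
    have : Tendsto (fun m : ℕ => 1 + (k : ℝ) / (m : ℝ)) atTop (𝓝 (1 + 0)) :=
      tendsto_const_nhds.add (tendsto_const_div_atTop_nhds_zero_nat _)
    have := this.pow k
    simp only [add_zero, one_pow] at this
    refine this.congr' ?_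
    filter_upwards [eventually_gt_atTop 0] with n hn
    have : (n : ℝ) ≠ 0 := by positivity
    push_cast
    field_simp
  have h5 := (h3.mul h4).mul_const (1 / (k.factorial : ℝ))
  simp only [one_mul] at h5
  refine h5.congr' ?_
  filter_upwards [eventually_gt_atTop 0] with n hn
  have : (n : ℝ) ≠ 0 := by positivity
  have : ((n + k : ℕ) : ℝ) ≠ 0 := by positivity
  simp only [Function.comp]
  rw [div_pow]
  field_simp

lemma card_slice (i j : ι) (hij : i ≠ j) (m : ℕ) (s : Finset (ι → ℕ))
    (hs : ∀ d ∈ s, ∑ l, d l = m)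
    (hinj : ∀ d ∈ s, ∀ d' ∈ s, d i + d j = d' i + d' j → d i = d' i) :
    s.card ≤ (m + 1) ^ (Fintype.card ι - 2) := by
  have hc : Fintype.card {l : ι // l ≠ i ∧ l ≠ j} = Fintype.card ι - 2 := by
    rw [Fintype.card_subtype]
    have : (univ.filter fun l : ι => l ≠ i ∧ l ≠ j) = (univ.erase i).erase j := by
      ext l; simp [and_comm]
    rw [this, card_erase_of_mem (by simp [hij.symm]), card_erase_of_mem (by simp), card_univ]
    omega
  have hsum : ∀ d : ι → ℕ, ∑ l, d l = d i + (d j + ∑ l ∈ (univ.erase i).erase j, d l) := by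
    intro d
    rw [← add_sum_erase univ d (mem_univ i), ← add_sum_erase (univ.erase i) d (a := j)
      (by simp [hij.symm])]
  calc s.card ≤ (Fintype.piFinset (fun _ : {l : ι // l ≠ i ∧ l ≠ j} => range (m + 1))).card := by
        refine card_le_card_of_injOn (fun d l => d l.1) ?_ ?_
        · intro d hd
          simp only [Fintype.coe_piFinset, Set.mem_pi, Set.mem_univ, forall_const]
          intro l
          have := single_le_sum (f := d) (fun _ _ => Nat.zero_le _) (mem_univ l.1)
          rw [hs d hd] at this
          simp; omega
        · intro d hd d' hd' h
          have hag : ∀ l, l ≠ i → l ≠ j → d l = d' l := fun l h1 h2 => congrFun h ⟨l, h1, h2⟩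
          have h1 := hs d hd
          have h2 := hs d' hd'
          rw [hsum] at h1 h2
          have h3 : ∑ l ∈ (univ.erase i).erase j, d l = ∑ l ∈ (univ.erase i).erase j, d' l := by
            refine sum_congr rfl fun l hl => ?_
            simp at hl
            exact hag l hl.2 hl.1
          have h4 := hinj d hd d' hd' (by omega)
          funext l
          by_cases hi : l = i
          · subst hi; exact h4
          by_cases hj : l = j
          · subst hj; omega
          exact hag l hi hj
    _ = _ := by simp [hc]

lemma tendsto_NG [Nonempty ι] (D : ℕ) :
    Tendsto (fun m : ℕ => (((piAntidiag (univ : Finset ι) m).filter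
      (fun d => ¬ Gen D d)).card : ℝ) / (m : ℝ) ^ (Fintype.card ι - 1)) atTop (𝓝 0) := by
  by_cases hk : Fintype.card ι = 1
  · refine tendsto_const_nhds.congr' ?_
    filter_upwards [eventually_ge_atTop D] with m hm
    have : ((piAntidiag (univ : Finset ι) m).filter (fun d => ¬ Gen D d)) = ∅ := by
      rw [filter_eq_empty_iff]
      intro d hd
      simp only [mem_piAntidiag, mem_univ, implies_true, and_true] at hd
      obtain ⟨i0, hi0⟩ := Fintype.card_eq_one_iff.1 hk
      push Not
      refine ⟨fun i => ?_, fun i j hij => absurd ((hi0 i).trans (hi0 j).symm) hij⟩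
      rw [← hd.trans rfl] at hm
      have : (univ : Finset ι) = {i} := by
        ext l; simp [hi0 l, hi0 i]
      rw [this] at hm
      simpa using hm
    simp [this]
  have hk2 : 2 ≤ Fintype.card ι := by
    have : 0 < Fintype.card ι := Fintype.card_pos
    omega
  have : Nontrivial ι := Fintype.one_lt_card_iff_nontrivial.1 hk2
  set K := Fintype.card ι with hK
  -- the covering
  have hbound : ∀ m : ℕ, ((piAntidiag (univ : Finset ι) m).filter (fun d => ¬ Gen D d)).card ≤
      (K * D + K * K * D) * (m + 1) ^ (K - 2) := by
    intro m
    set P := piAntidiag (univ : Finset ι) m with hP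
    let U1 := ((univ : Finset ι) ×ˢ range D).biUnion (fun q => P.filter (fun d => d q.1 = q.2))
    let U2 := (((univ : Finset ι) ×ˢ (univ : Finset ι)) ×ˢ range D).biUnion
      (fun q => P.filter (fun d => q.1.1 ≠ q.1.2 ∧ d q.1.1 = d q.1.2 + q.2))
    have hsub : P.filter (fun d => ¬ Gen D d) ⊆ U1 ∪ U2 := by
      intro d hd
      rw [mem_filter] at hd
      obtain ⟨hdP, hd⟩ := hd
      rw [mem_union]
      by_contra hcon
      push Not at hcon
      apply hd
      constructor
      · intro i
        by_contra hlt
        apply hcon.1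
        simp only [U1, mem_biUnion, mem_product, mem_univ, true_and, mem_filter, mem_range,
          Prod.exists]
        exact ⟨i, d i, by omega, hdP, rfl⟩
      · intro i j hij
        by_contra hlt
        push Not at hlt
        apply hcon.2
        simp only [U2, mem_biUnion, mem_product, mem_univ, true_and, mem_filter, mem_range,
          Prod.exists]
        rcases le_total (d i) (d j) with h | h
        · exact ⟨j, i, d j - d i, by omega, hdP, hij.symm, by omega⟩
        · exact ⟨i, j, d i - d j, by omega, hdP, hij, by omega⟩
    have hPs : ∀ d ∈ P, ∑ l, d l = m := by
      intro d hd
      simpa [hP] using hd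
    have h1 : U1.card ≤ (K * D) * (m + 1) ^ (K - 2) := by
      refine (card_biUnion_le_card_mul _ _ ((m + 1) ^ (K - 2)) ?_).trans ?_
      · rintro ⟨i, v⟩ -
        obtain ⟨j, hj⟩ := exists_ne i
        refine card_slice i j hj.symm m _ (fun d hd => hPs d (mem_filter.1 hd).1) ?_
        intro d hd d' hd' _
        rw [(mem_filter.1 hd).2, (mem_filter.1 hd').2]
      · simp [hK]
    have h2 : U2.card ≤ (K * K * D) * (m + 1) ^ (K - 2) := by
      refine (card_biUnion_le_card_mul _ _ ((m + 1) ^ (K - 2)) ?_).trans ?_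
      · rintro ⟨⟨i, j⟩, v⟩ -
        by_cases hij : i = j
        · simp [hij]
        refine card_slice i j hij m _ (fun d hd => hPs d (mem_filter.1 hd).1) ?_
        intro d hd d' hd' h
        have h1 := (mem_filter.1 hd).2.2
        have h2 := (mem_filter.1 hd').2.2
        simp only at h1 h2
        omega
      · simp [hK]
    calc _ ≤ (U1 ∪ U2).card := card_le_card hsub
      _ ≤ U1.card + U2.card := card_union_le _ _
      _ ≤ _ := by rw [add_mul]; exact add_le_add h1 h2
  -- conclusion
  obtain ⟨r, hr⟩ : ∃ r, K = r + 2 := ⟨K - 2, by omega⟩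
  rw [hr] at hbound
  have e1 : r + 2 - 2 = r := by omega
  have e2 : K - 1 = r + 1 := by omega
  rw [e1] at hbound
  rw [e2]
  set C := ((r + 2) * D + (r + 2) * (r + 2) * D)
  have hlim : Tendsto (fun m : ℕ => (C * 2 ^ r : ℝ) / (m : ℝ)) atTop (𝓝 0) :=
    tendsto_const_div_atTop_nhds_zero_nat _
  refine squeeze_zero' (Eventually.of_forall fun m => by positivity) ?_ hlim
  filter_upwards [eventually_gt_atTop 0] with m hm
  have hm' : (0 : ℝ) < m := by positivity
  rw [div_le_div_iff₀ (by positivity) hm']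
  have h1 : (((piAntidiag (univ : Finset ι) m).filter (fun d => ¬ Gen D d)).card : ℝ) ≤
      C * ((m : ℝ) + 1) ^ r := by exact_mod_cast hbound m
  have h2 : ((m : ℝ) + 1) ^ r ≤ (2 * m) ^ r := by
    have : (1 : ℝ) ≤ m := by exact_mod_cast hm
    gcongr
    linarith
  calc _ ≤ (C * (2 * m : ℝ) ^ r) * m := by
        refine mul_le_mul_of_nonneg_right (h1.trans ?_) hm'.le
        gcongr
    _ = _ := by rw [mul_pow, pow_succ]; ring

lemma tendsto_avg [Nonempty ι] (w : (ι → ℕ) → ℝ) (hw0 : ∀ d, 0 ≤ w d) (hw1 : ∀ d, w d ≤ 1)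
    (w0 : ℝ) (hgen : ∀ ε > 0, ∃ D, ∀ d, Gen D d → |w d - w0| ≤ ε) (s : ℕ) :
    Tendsto (fun n : ℕ => (∑ d ∈ piAntidiag (univ : Finset ι) (n - s), w d) /
      (n : ℝ) ^ (Fintype.card ι - 1)) atTop
      (𝓝 (w0 / ((Fintype.card ι - 1).factorial : ℝ))) := by
  have key : Tendsto (fun m : ℕ => (∑ d ∈ piAntidiag (univ : Finset ι) m, (w d - w0)) /
      (m : ℝ) ^ (Fintype.card ι - 1)) atTop (𝓝 0) := by
    rw [Metric.tendsto_atTop']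
    intro ε hε
    obtain ⟨D, hD⟩ := hgen (ε / 8) (by positivity)
    set M := 1 + |w0| with hM
    have hMpos : 0 < M := by positivity
    have hPA := (tendsto_PA (ι := ι)).eventually_lt_const (u := 2) (by
      have : (1 : ℝ) ≤ ((Fintype.card ι - 1).factorial : ℝ) := by
        exact_mod_cast Nat.succ_le_of_lt (Nat.factorial_pos _)
      have : 1 / ((Fintype.card ι - 1).factorial : ℝ) ≤ 1 := by
        rw [div_le_one (by positivity)]; exact this
      linarith)
    have hNG := (tendsto_NG (ι := ι) D).eventually_lt_const (u := ε / (2 * M)) (by positivity)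
    obtain ⟨N, hN⟩ := eventually_atTop.1 (hPA.and (hNG.and (eventually_gt_atTop 0)))
    refine ⟨N, fun m hm => ?_⟩
    obtain ⟨h1, h2, h3⟩ := hN m hm.le
    have hpos : (0 : ℝ) < (m : ℝ) ^ (Fintype.card ι - 1) := by positivity
    rw [Real.dist_eq, sub_zero, abs_div, abs_of_pos hpos, div_lt_iff₀ hpos]
    rw [div_lt_iff₀ hpos] at h1 h2
    set P := piAntidiag (univ : Finset ι) m
    calc |∑ d ∈ P, (w d - w0)| ≤ ∑ d ∈ P, |w d - w0| := abs_sum_le_sum_abs _ _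
      _ ≤ ∑ d ∈ P, (ε / 8 + if ¬ Gen D d then M else 0) := by
          refine sum_le_sum fun d _ => ?_
          by_cases hg : Gen D d
          · simpa [hg] using hD d hg
          · simp only [hg, not_false_eq_true, if_true]
            have : |w d - w0| ≤ M := by
              calc |w d - w0| ≤ |w d| + |w0| := abs_sub _ _
                _ ≤ M := by rw [abs_of_nonneg (hw0 d)]; linarith [hw1 d]
            linarith
      _ = P.card * (ε / 8) + (P.filter (fun d => ¬ Gen D d)).card * M := by
          rw [sum_add_distrib, ← sum_filter]; simp
      _ < _ := by
          have e1 : (P.card : ℝ) * (ε / 8) ≤ 2 * (m : ℝ) ^ (Fintype.card ι - 1) * (ε / 8) := by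
            gcongr
          have e2 : ((P.filter (fun d => ¬ Gen D d)).card : ℝ) * M ≤
              ε / (2 * M) * (m : ℝ) ^ (Fintype.card ι - 1) * M := by gcongr
          have e3 : ε / (2 * M) * (m : ℝ) ^ (Fintype.card ι - 1) * M =
              ε / 2 * (m : ℝ) ^ (Fintype.card ι - 1) := by field_simp
          nlinarith [mul_pos hε hpos]
  have key2 : Tendsto (fun m : ℕ => (∑ d ∈ piAntidiag (univ : Finset ι) m, w d) /
      (m : ℝ) ^ (Fintype.card ι - 1)) atTop
      (𝓝 (w0 / ((Fintype.card ι - 1).factorial : ℝ))) := by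
    have := key.add ((tendsto_PA (ι := ι)).mul_const w0)
    rw [zero_add, one_div_mul_eq_div] at this
    refine this.congr fun m => ?_
    rw [sum_sub_distrib]
    simp only [sum_const, nsmul_eq_mul]
    ring
  have h3 := key2.comp (tendsto_sub_atTop_nat s)
  have h4 : Tendsto (fun n : ℕ => (((n - s : ℕ) : ℝ) / (n : ℝ)) ^ (Fintype.card ι - 1)) atTop
      (𝓝 1) := by
    have : Tendsto (fun m : ℕ => 1 - (s : ℝ) / (m : ℝ)) atTop (𝓝 (1 - 0)) :=
      tendsto_const_nhds.sub (tendsto_const_div_atTop_nhds_zero_nat _)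
    have := this.pow (Fintype.card ι - 1)
    simp only [sub_zero, one_pow] at this
    refine this.congr' ?_
    filter_upwards [eventually_gt_atTop 0, eventually_ge_atTop s] with n hn hs
    have : (n : ℝ) ≠ 0 := by positivity
    rw [Nat.cast_sub hs]
    field_simp
  have h5 := h3.mul h4
  rw [mul_one] at h5
  refine h5.congr' ?_
  filter_upwards [eventually_gt_atTop s] with n hn
  have : ((n - s : ℕ) : ℝ) ≠ 0 := by
    have : 0 < n - s := by omega
    positivity
  simp only [Function.comp]
  rw [div_pow]
  field_simp

lemma card_eq_sum_inv {τ Q : Type*} (T : Finset τ) (g : τ → Q) (hg : ∀ q, ∃ t ∈ T, g t = q) :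
    (Nat.card Q : ℝ) = ∑ t ∈ T, 1 / ((T.filter (fun t' => g t' = g t)).card : ℝ) := by
  have h1 : (Set.univ : Set Q) = ↑(T.image g) := by
    ext q; simpa using hg q
  have h2 : Nat.card Q = (T.image g).card := by
    rw [← Nat.card_univ, h1]
    simp
  rw [h2, card_eq_sum_ones, Nat.cast_sum, sum_image']
  intro t ht
  have : ∀ j ∈ T.filter (fun t' => g t' = g t),
      1 / ((T.filter (fun t' => g t' = g j)).card : ℝ) =
      1 / ((T.filter (fun t' => g t' = g t)).card : ℝ) := by
    intro j hj
    rw [(mem_filter.1 hj).2]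
  rw [sum_congr rfl this, sum_const, nsmul_eq_mul]
  have : 0 < (T.filter (fun t' => g t' = g t)).card := card_pos.2 ⟨t, by simp [ht]⟩
  have : ((T.filter (fun t' => g t' = g t)).card : ℝ) ≠ 0 := by positivity
  push_cast
  field_simp

end Counting

section Abstract

open Filter Finset

open scoped Classical Topology

/-- The abstract properties of isomorphism of induced substructures that are used. -/
structure IsoRel {α : Type*} (Iso : Finset α → Finset α → Prop) : Prop where
  refl : ∀ A, Iso A A
  symm : ∀ {A B}, Iso A B → Iso B A
  trans : ∀ {A B C}, Iso A B → Iso B C → Iso A C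
  map : ∀ {A B}, Iso A B → ∃ f : α → α, Set.InjOn f (A : Set α) ∧ A.image f = B ∧
    ∀ C ⊆ A, Iso C (C.image f)

/-- `x` and `y` are interchangeable inside `D`. -/
def Eqv {α : Type*} (Iso : Finset α → Finset α → Prop) (D : Set α) (x y : α) : Prop :=
  ∀ W : Finset α, (W : Set α) ⊆ D → x ∉ W → y ∉ W → Iso (insert x W) (insert y W)

variable {α : Type*} {ι : Type*} [Fintype ι]

/-- The number of elements of `A` in the `i`-th infinite block. -/
noncomputable def cnt (F : Finset α) (c : α → ι) (A : Finset α) (i : ι) : ℕ :=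
  (A.filter (fun x => x ∉ F ∧ c x = i)).card

/-- The standing assumptions. -/
structure Setting (Iso : Finset α → Finset α → Prop) (F : Finset α) (c : α → ι) : Prop where
  iso : IsoRel Iso
  inf : ∀ i, {x | x ∉ F ∧ c x = i}.Infinite
  mono : ∀ A B, A ∩ F = B ∩ F → (∀ i, cnt F c A i = cnt F c B i) → Iso A B
  sep : ∀ x y, x ∉ F → y ∉ F → c x ≠ c y → ¬ Eqv Iso Set.univ x y

variable {Iso : Finset α → Finset α → Prop} {F : Finset α} {c : α → ι}

lemma IsoRel.card (h : IsoRel Iso) {A B : Finset α} (hAB : Iso A B) : A.card = B.card := by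
  obtain ⟨f, hf, rfl, -⟩ := h.map hAB
  exact (card_image_of_injOn hf).symm

lemma card_type (A : Finset α) : A.card = (A ∩ F).card + ∑ i, cnt F c A i := by
  have h1 : A.card = (A ∩ F).card + (A.filter (fun x => x ∉ F)).card := by
    rw [← filter_mem_eq_inter, card_filter_add_card_filter_not]
  rw [h1]
  congr 1
  rw [card_eq_sum_card_fiberwise (f := c) (t := univ) (by intro x _; simp)]
  refine sum_congr rfl fun i _ => ?_
  rw [cnt, filter_filter]

lemma cnt_insert {A : Finset α} {x : α} (hx : x ∉ A) (hF : x ∉ F) :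
    cnt F c (insert x A) = fun i => cnt F c A i + if c x = i then 1 else 0 := by
  funext i
  unfold cnt
  rw [filter_insert]
  by_cases h : c x = i
  · rw [if_pos ⟨hF, h⟩, card_insert_of_notMem (by simp [hx]), if_pos h]
  · rw [if_neg (by simp [h]), if_neg h, add_zero]

lemma insert_inter_F {A : Finset α} {x : α} (hF : x ∉ F) : insert x A ∩ F = A ∩ F :=
  insert_inter_of_notMem hF

lemma build (S : Finset α) (hS : S ⊆ F) (T : ι → Finset α)
    (hT : ∀ i, ∀ x ∈ T i, x ∉ F ∧ c x = i) :
    (S ∪ univ.biUnion T) ∩ F = S ∧ ∀ i, cnt F c (S ∪ univ.biUnion T) i = (T i).card := by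
  constructor
  · ext x
    simp only [mem_inter, mem_union, mem_biUnion, mem_univ, true_and]
    constructor
    · rintro ⟨h | ⟨i, h⟩, hF⟩
      · exact h
      · exact absurd hF (hT i x h).1
    · exact fun h => ⟨Or.inl h, hS h⟩
  · intro i
    unfold cnt
    congr 1
    ext x
    simp only [mem_filter, mem_union, mem_biUnion, mem_univ, true_and]
    constructor
    · rintro ⟨h | ⟨j, h⟩, hF, hc⟩
      · exact absurd (hS h) hF
      · rw [← hc, (hT j x h).2]; exact h
    · exact fun h => ⟨Or.inr ⟨i, h⟩, hT i x h⟩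

lemma remove (A : Finset α) (T : ι → Finset α)
    (hT : ∀ i, ∀ x ∈ T i, x ∉ F ∧ c x = i) (hTA : ∀ i, T i ⊆ A) :
    (A \ univ.biUnion T) ∩ F = A ∩ F ∧
      ∀ i, cnt F c (A \ univ.biUnion T) i = cnt F c A i - (T i).card := by
  constructor
  · ext x
    simp only [mem_inter, Finset.mem_sdiff, mem_biUnion, mem_univ, true_and]
    constructor
    · rintro ⟨⟨h, -⟩, hF⟩
      exact ⟨h, hF⟩
    · rintro ⟨h, hF⟩
      exact ⟨⟨h, fun ⟨i, hi⟩ => (hT i x hi).1 hF⟩, hF⟩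
  · intro i
    unfold cnt
    rw [← card_sdiff_of_subset (fun x hx => mem_filter.2 ⟨hTA i hx, hT i x hx⟩)]
    congr 1
    ext x
    simp only [mem_filter, Finset.mem_sdiff, mem_biUnion, mem_univ, true_and]
    constructor
    · rintro ⟨⟨h, hn⟩, hF, hc⟩
      exact ⟨⟨h, hF, hc⟩, fun hx => hn ⟨i, hx⟩⟩
    · rintro ⟨⟨h, hF, hc⟩, hn⟩
      refine ⟨⟨h, ?_⟩, hF, hc⟩
      rintro ⟨j, hj⟩
      apply hn
      rw [← hc, (hT j x hj).2]
      exact hj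

lemma Setting.exists_real (H : Setting Iso F c) (S : Finset α) (hS : S ⊆ F) (d : ι → ℕ)
    (Z : Finset α) : ∃ A : Finset α, A ∩ F = S ∧ cnt F c A = d ∧ ∀ z ∈ Z, z ∉ F → z ∉ A := by
  have h : ∀ i, ∃ t : Finset α, (t : Set α) ⊆ {x | x ∉ F ∧ c x = i} \ Z ∧ t.card = d i :=
    fun i => ((H.inf i).diff Z.finite_toSet).exists_subset_card_eq (d i)
  choose T hT hc using h
  obtain ⟨h1, h2⟩ := build (c := c) S hS T (fun i x hx => (hT i hx).1)
  refine ⟨_, h1, funext fun i => (h2 i).trans (hc i), ?_⟩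
  intro z hz hF hzA
  simp only [mem_union, mem_biUnion, mem_univ, true_and] at hzA
  rcases hzA with h | ⟨i, hi⟩
  · exact hF (hS h)
  · exact (hT i hi).2 hz

/-- The chosen realization of a type. -/
noncomputable def real (F : Finset α) (c : α → ι) (S : Finset α) (d : ι → ℕ) : Finset α :=
  if h : ∃ A : Finset α, A ∩ F = S ∧ cnt F c A = d then h.choose else ∅

lemma Setting.real_spec (H : Setting Iso F c) {S : Finset α} (hS : S ⊆ F) (d : ι → ℕ) :
    real F c S d ∩ F = S ∧ cnt F c (real F c S d) = d := by
  have h : ∃ A : Finset α, A ∩ F = S ∧ cnt F c A = d := by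
    obtain ⟨A, h1, h2, -⟩ := H.exists_real S hS d ∅
    exact ⟨A, h1, h2⟩
  rw [real, dif_pos h]
  exact h.choose_spec

lemma Setting.iso_real (H : Setting Iso F c) (A : Finset α) {S : Finset α} {d : ι → ℕ}
    (hA : A ∩ F = S) (hd : cnt F c A = d) : Iso A (real F c S d) := by
  have hS : S ⊆ F := hA ▸ inter_subset_right
  obtain ⟨h1, h2⟩ := H.real_spec hS d
  exact H.mono _ _ (hA.trans h1.symm) (fun i => by rw [hd, h2])

/-- points in the same block are interchangeable -/
lemma Setting.eqv_of_block (H : Setting Iso F c) (D : Set α) {x y : α} (hx : x ∉ F) (hy : y ∉ F)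
    (hxy : c x = c y) : Eqv Iso D x y := by
  intro W _ hxW hyW
  refine H.mono _ _ ?_ ?_
  · rw [insert_inter_F hx, insert_inter_F hy]
  · intro i
    rw [cnt_insert hxW hx, cnt_insert hyW hy, hxy]

lemma Eqv.pullback (h : IsoRel Iso) {A : Finset α} {f : α → α} (hf : Set.InjOn f (A : Set α))
    (hC : ∀ C ⊆ A, Iso C (C.image f)) {x y : α} (hx : x ∈ A) (hy : y ∈ A)
    (hxy : Eqv Iso ((A.image f : Finset α) : Set α) (f x) (f y)) : Eqv Iso (A : Set α) x y := by
  intro W hW hxW hyW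
  have hW' : W ⊆ A := by exact_mod_cast hW
  have hnot : ∀ z ∈ A, z ∉ W → f z ∉ W.image f := by
    intro z hz hzW hm
    obtain ⟨w, hw, hwz⟩ := mem_image.1 hm
    exact hzW (hf (hW' hw) hz hwz ▸ hw)
  have h1 := hC (insert x W) (insert_subset hx hW')
  have h2 := hC (insert y W) (insert_subset hy hW')
  rw [image_insert] at h1 h2
  have h3 := hxy (W.image f) (by exact_mod_cast image_subset_image hW') (hnot x hx hxW)
    (hnot y hy hyW)
  exact h.trans h1 (h.trans h3 (h.symm h2))

/-- `S` is good if the infinite blocks are not merged over `S`. -/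
def Good (Iso : Finset α → Finset α → Prop) (F : Finset α) (c : α → ι) (S : Finset α) : Prop :=
  ∀ x y, x ∉ F → y ∉ F → c x ≠ c y → ¬ Eqv Iso {z | z ∈ F → z ∈ S} x y

lemma Setting.good_F (H : Setting Iso F c) : Good Iso F c F := by
  intro x y hx hy hxy h
  refine H.sep x y hx hy hxy ?_
  have : {z | z ∈ F → z ∈ F} = Set.univ := by ext; simp
  rwa [this] at h

lemma Setting.good_sep_pair (H : Setting Iso F c) {S : Finset α} (hS : Good Iso F c S)
    (i j : ι) (hij : i ≠ j) :
    ∃ N, ∀ A : Finset α, A ∩ F = S → (∀ l, N ≤ cnt F c A l) → ∀ x ∈ A, ∀ y ∈ A, x ∉ F → y ∉ F →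
      c x = i → c y = j → ¬ Eqv Iso (A : Set α) x y := by
  obtain ⟨x, hx, hxi⟩ := (H.inf i).nonempty
  obtain ⟨y, hy, hyj⟩ := (H.inf j).nonempty
  have h := hS x y hx hy (by rw [hxi, hyj]; exact hij)
  unfold Eqv at h
  push Not at h
  obtain ⟨W, hW, hxW, hyW, hn⟩ := h
  refine ⟨W.card + 2, fun A hA hN x' hx'A y' hy'A hx' hy' hx'i hy'j hE => hn ?_⟩
  have hT : ∀ l, ∃ t ⊆ (A.filter (fun z => z ∉ F ∧ c z = l)) \ {x', y'}, t.card = cnt F c W l := by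
    intro l
    refine exists_subset_card_eq ?_
    have h1 := le_card_sdiff ({x', y'} : Finset α) (A.filter (fun z => z ∉ F ∧ c z = l))
    have h2 : ({x', y'} : Finset α).card ≤ 2 := card_le_two
    have h3 := hN l
    unfold cnt at h3 ⊢
    have h4 : (W.filter (fun z => z ∉ F ∧ c z = l)).card ≤ W.card := card_filter_le _ _
    omega
  choose T hT hTc using hT
  have hT' : ∀ l, ∀ z ∈ T l, (z ∈ A ∧ z ∉ F ∧ c z = l) ∧ z ≠ x' ∧ z ≠ y' := by
    intro l z hz
    have := hT l hz
    simpa using this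
  obtain ⟨h1, h2⟩ := build (F := F) (c := c) (W ∩ F) inter_subset_right T
    (fun l z hz => (hT' l z hz).1.2)
  set W' := (W ∩ F) ∪ univ.biUnion T with hW'
  have hmem : ∀ z ∈ W', z ∈ A ∧ z ≠ x' ∧ z ≠ y' := by
    intro z hz
    simp only [hW', mem_union, mem_inter, mem_biUnion, mem_univ, true_and] at hz
    rcases hz with ⟨hzW, hzF⟩ | ⟨l, hl⟩
    · have hzS : z ∈ S := hW hzW hzF
      refine ⟨?_, ?_, ?_⟩
      · rw [← hA] at hzS
        exact (mem_inter.1 hzS).1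
      · rintro rfl; exact hx' hzF
      · rintro rfl; exact hy' hzF
    · exact ⟨(hT' l z hl).1.1, (hT' l z hl).2⟩
  have hx'W : x' ∉ W' := fun h => (hmem _ h).2.1 rfl
  have hy'W : y' ∉ W' := fun h => (hmem _ h).2.2 rfl
  have e := hE W' (fun z hz => (hmem z hz).1) hx'W hy'W
  have ex : Iso (insert x W) (insert x' W') := by
    refine H.mono _ _ ?_ ?_
    · rw [insert_inter_F hx, insert_inter_F hx', h1]
    · intro l
      rw [cnt_insert hxW hx, cnt_insert hx'W hx', hxi, hx'i]
      simp only [h2, hTc]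
  have ey : Iso (insert y W) (insert y' W') := by
    refine H.mono _ _ ?_ ?_
    · rw [insert_inter_F hy, insert_inter_F hy', h1]
    · intro l
      rw [cnt_insert hyW hy, cnt_insert hy'W hy', hyj, hy'j]
      simp only [h2, hTc]
  exact H.iso.trans ex (H.iso.trans e (H.iso.symm ey))

lemma Setting.good_sep (H : Setting Iso F c) {S : Finset α} (hS : Good Iso F c S) :
    ∃ N, ∀ A : Finset α, A ∩ F = S → (∀ l, N ≤ cnt F c A l) → ∀ x ∈ A, ∀ y ∈ A, x ∉ F → y ∉ F →
      Eqv Iso (A : Set α) x y → c x = c y := by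
  have h : ∀ p : ι × ι, ∃ N, p.1 ≠ p.2 → ∀ A : Finset α, A ∩ F = S → (∀ l, N ≤ cnt F c A l) →
      ∀ x ∈ A, ∀ y ∈ A, x ∉ F → y ∉ F →
      c x = p.1 → c y = p.2 → ¬ Eqv Iso (A : Set α) x y := by
    intro p
    by_cases hp : p.1 = p.2
    · exact ⟨0, fun h => absurd hp h⟩
    · obtain ⟨N, hN⟩ := H.good_sep_pair hS p.1 p.2 hp
      exact ⟨N, fun _ => hN⟩
  choose N hN using h
  refine ⟨univ.sup N, fun A hA hd x hx y hy hxF hyF hE => ?_⟩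
  by_contra hne
  exact hN (c x, c y) hne A hA (fun l => (le_sup (mem_univ _)).trans (hd l)) x hx y hy hxF hyF
    rfl rfl hE

/-- Every isomorphism from a large set of good type permutes the infinite blocks, up to `F`. -/
lemma Setting.exists_perm (H : Setting Iso F c) {S : Finset α} (hS : Good Iso F c S) :
    ∃ N, F.card < N ∧ ∀ A : Finset α, A ∩ F = S → (∀ l, N ≤ cnt F c A l) → ∀ f : α → α,
      Set.InjOn f (A : Set α) → (∀ C ⊆ A, Iso C (C.image f)) →
      ∃ σ : Equiv.Perm ι, ∀ x ∈ A, x ∉ F → f x ∉ F → c (f x) = σ (c x) := by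
  obtain ⟨N, hN⟩ := H.good_sep hS
  refine ⟨max N (F.card + 1), by omega, fun A hA hd f hf hC => ?_⟩
  have hsep := hN A hA (fun l => (le_max_left _ _).trans (hd l))
  have hex : ∀ i, ∃ x ∈ A, x ∉ F ∧ c x = i ∧ f x ∉ F := by
    intro i
    by_contra hcon
    push Not at hcon
    have h1 : (A.filter (fun x => x ∉ F ∧ c x = i)).image f ⊆ F := by
      intro y hy
      obtain ⟨x, hx, rfl⟩ := mem_image.1 hy
      rw [mem_filter] at hx
      exact hcon x hx.1 hx.2.1 hx.2.2
    have h2 := card_le_card h1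
    rw [card_image_of_injOn (hf.mono (by intro x hx; exact (mem_filter.1 hx).1))] at h2
    have h3 := (le_max_right _ _).trans (hd i)
    unfold cnt at h3
    omega
  choose g hgA hgF hgc hgf using hex
  have hpull : ∀ x ∈ A, ∀ y ∈ A, x ∉ F → y ∉ F → f x ∉ F → f y ∉ F → c (f x) = c (f y) →
      c x = c y := by
    intro x hx y hy hxF hyF hfx hfy hxy
    exact hsep x hx y hy hxF hyF
      (Eqv.pullback H.iso hf hC hx hy (H.eqv_of_block _ hfx hfy hxy))
  have hinj : Function.Injective (fun i => c (f (g i))) := by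
    intro i j hij
    have := hpull _ (hgA i) _ (hgA j) (hgF i) (hgF j) (hgf i) (hgf j) hij
    rwa [hgc, hgc] at this
  have hbij := Finite.injective_iff_bijective.1 hinj
  refine ⟨Equiv.ofBijective _ hbij, fun x hx hxF hfx => ?_⟩
  obtain ⟨i, hi⟩ := hbij.2 (c (f x))
  have := hpull _ (hgA i) _ hx (hgF i) hxF (hgf i) hfx hi
  rw [hgc] at this
  rw [Equiv.ofBijective_apply, ← this]
  exact hi.symm

/-- Counting consequence. -/
lemma cnt_close {A : Finset α} {f : α → α} (hf : Set.InjOn f (A : Set α)) {σ : Equiv.Perm ι}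
    (hσ : ∀ x ∈ A, x ∉ F → f x ∉ F → c (f x) = σ (c x)) (i : ι) :
    cnt F c A i ≤ cnt F c (A.image f) (σ i) + F.card ∧
    cnt F c (A.image f) (σ i) ≤ cnt F c A i + F.card := by
  constructor
  · have h1 : (A.filter (fun x => x ∉ F ∧ c x = i)).image f ⊆
        ((A.image f).filter (fun x => x ∉ F ∧ c x = σ i)) ∪ F := by
      intro y hy
      obtain ⟨x, hx, rfl⟩ := mem_image.1 hy
      rw [mem_filter] at hx
      by_cases hF : f x ∈ F
      · simp [hF]
      · refine mem_union_left _ (mem_filter.2 ⟨mem_image_of_mem _ hx.1, hF, ?_⟩)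
        rw [hσ x hx.1 hx.2.1 hF, hx.2.2]
    have h2 := (card_le_card h1).trans (card_union_le _ _)
    rw [card_image_of_injOn (hf.mono (by intro x hx; exact (mem_filter.1 hx).1))] at h2
    exact h2
  · have h1 : (A.image f).filter (fun x => x ∉ F ∧ c x = σ i) ⊆
        ((A.filter (fun x => x ∉ F ∧ c x = i)) ∪ F).image f := by
      intro y hy
      obtain ⟨hy1, hyF, hyc⟩ := mem_filter.1 hy
      obtain ⟨x, hx, rfl⟩ := mem_image.1 hy1
      refine mem_image_of_mem _ ?_
      by_cases hF : x ∈ F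
      · simp [hF]
      · refine mem_union_left _ (mem_filter.2 ⟨hx, hF, ?_⟩)
        rw [hσ x hx hF hyF] at hyc
        exact σ.injective hyc
    exact (card_le_card h1).trans (card_image_le.trans (card_union_le _ _))

/-- The target type of the data `σ, δ`. -/
def tgt (F : Finset α) (σ : Equiv.Perm ι) (δ : ι → Fin (2 * F.card + 1)) (d : ι → ℕ) : ι → ℕ :=
  fun j => d (σ.symm j) + (δ (σ.symm j) : ℕ) - F.card

lemma tgt_inj {d : ι → ℕ} (hd : Gen (2 * F.card + 1) d) {σ τ : Equiv.Perm ι}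
    {δ ε : ι → Fin (2 * F.card + 1)} (h : tgt F σ δ d = tgt F τ ε d) : σ = τ ∧ δ = ε := by
  have h1 : σ = τ := by
    rw [← Equiv.symm_bijective.injective.eq_iff]
    ext j
    by_contra hne
    have hj := congrFun h j
    unfold tgt at hj
    have a1 := hd.1 (σ.symm j)
    have a2 := hd.1 (τ.symm j)
    have a3 := (δ (σ.symm j)).2
    have a4 := (ε (τ.symm j)).2
    rcases hd.2 _ _ hne with h | h <;> omega
  subst h1
  refine ⟨rfl, funext fun i => Fin.ext ?_⟩
  have hj := congrFun h (σ i)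
  simp only [tgt, Equiv.symm_apply_apply] at hj
  have a1 := hd.1 i
  omega

/-- the class of a type -/
def cls (Iso : Finset α → Finset α → Prop) (F : Finset α) (c : α → ι) (S : Finset α) (d : ι → ℕ) :
    Set (Finset α × (ι → ℕ)) :=
  {t | t.1 ⊆ F ∧ Iso (real F c S d) (real F c t.1 t.2)}

lemma Setting.cls_finite (H : Setting Iso F c) {S : Finset α} (hS : S ⊆ F) (d : ι → ℕ) :
    (cls Iso F c S d).Finite := by
  refine Set.Finite.subset (F.powerset ×ˢ (Fintype.piFinset
    (fun _ : ι => range ((real F c S d).card + 1)))).finite_toSet ?_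
  rintro ⟨S', d'⟩ ⟨hS', hI⟩
  simp only [coe_product, Set.mem_prod, mem_coe, mem_powerset, Fintype.mem_piFinset, mem_range]
  refine ⟨hS', fun i => ?_⟩
  have h1 := H.iso.card hI
  rw [card_type (F := F) (c := c) (real F c S' d'), (H.real_spec hS' d').2] at h1
  have := single_le_sum (f := d') (fun _ _ => Nat.zero_le _) (mem_univ i)
  omega

lemma Setting.good_weight (H : Setting Iso F c) {S : Finset α} (hSF : S ⊆ F)
    (hS : Good Iso F c S) :
    ∃ m : ℕ, 0 < m ∧ ∃ D, ∀ d, Gen D d → (cls Iso F c S d).ncard = m := by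
  obtain ⟨N, hNF, hN⟩ := H.exists_perm hS
  -- the finite parameter set
  let X := {S' // S' ∈ F.powerset} × Equiv.Perm ι × (ι → Fin (2 * F.card + 1))
  let P : X → (ι → ℕ) → Prop := fun p d =>
    Iso (real F c S d) (real F c p.1.1 (tgt F p.2.1 p.2.2 d))
  -- structure of isomorphisms
  have hstr : ∀ d, (∀ l, N ≤ d l) → ∀ S' ⊆ F, ∀ d', Iso (real F c S d) (real F c S' d') →
      ∃ f : α → α, Set.InjOn f (real F c S d : Set α) ∧
        (real F c S d).image f = real F c S' d' ∧
        (∀ C ⊆ real F c S d, Iso C (C.image f)) ∧ ∃ σ : Equiv.Perm ι,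
        (∀ x ∈ real F c S d, x ∉ F → f x ∉ F → c (f x) = σ (c x)) ∧
        ∃ δ : ι → Fin (2 * F.card + 1), d' = tgt F σ δ d := by
    intro d hd S' hS' d' hI
    obtain ⟨f, hf, him, hC⟩ := H.iso.map hI
    obtain ⟨σ, hσ⟩ := hN (real F c S d) (H.real_spec hSF d).1
      (by rw [(H.real_spec hSF d).2]; exact hd) f hf hC
    refine ⟨f, hf, him, hC, σ, hσ, ?_⟩
    have hcl : ∀ i, d i ≤ d' (σ i) + F.card ∧ d' (σ i) ≤ d i + F.card := by
      intro i
      have := cnt_close hf hσ i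
      rwa [him, (H.real_spec hSF d).2, (H.real_spec hS' d').2] at this
    refine ⟨fun i => ⟨d' (σ i) + F.card - d i, ?_⟩, ?_⟩
    · have := hcl i; omega
    · funext j
      have := hcl (σ.symm j)
      rw [Equiv.apply_symm_apply] at this
      simp only [tgt, Equiv.apply_symm_apply]
      omega
  -- monotonicity
  have hmono : ∀ p d e, Gen (2 * F.card + 1 + N) d → (∀ i, F.card ≤ e i) → (∀ i, e i ≤ d i) →
      P p d → P p e := by
    rintro ⟨⟨S', hS'⟩, σ, δ⟩ d e hd he hed hI
    rw [mem_powerset] at hS'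
    have hI' : Iso (real F c S d) (real F c S' (tgt F σ δ d)) := hI
    obtain ⟨f, hf, him, hC, τ, hτ, ε, hε⟩ := hstr d (fun l => by have := hd.1 l; omega) S' hS' _ hI'
    obtain ⟨rfl, rfl⟩ := tgt_inj (hd.mono (by omega)) hε
    obtain ⟨hr1, hr2⟩ := H.real_spec hSF d
    obtain ⟨hr1', hr2'⟩ := H.real_spec hS' (tgt F σ δ d)
    set A := real F c S d with hA
    have hT : ∀ i, ∃ t ⊆ A.filter (fun x => (x ∉ F ∧ c x = i) ∧ f x ∉ F), t.card = d i - e i := by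
      intro i
      refine exists_subset_card_eq ?_
      have h1 : (A.filter (fun x => x ∉ F ∧ c x = i)).card = d i := congrFun hr2 i
      rw [← filter_filter]
      have h2 := card_filter_add_card_filter_not (s := A.filter (fun x => x ∉ F ∧ c x = i))
        (fun x => f x ∈ F)
      have h3 : ((A.filter (fun x => x ∉ F ∧ c x = i)).filter (fun x => f x ∈ F)).card ≤
          F.card := by
        refine card_le_card_of_injOn f (fun x hx => (mem_filter.1 hx).2) (hf.mono ?_)
        intro x hx
        exact (mem_filter.1 (mem_filter.1 hx).1).1
      have := he i
      omega
    choose T hT hTc using hT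
    have hT' : ∀ i, ∀ x ∈ T i, x ∈ A ∧ (x ∉ F ∧ c x = i) ∧ f x ∉ F :=
      fun i x hx => mem_filter.1 (hT i hx)
    have hU : univ.biUnion T ⊆ A := by
      intro x hx
      obtain ⟨i, -, hx⟩ := mem_biUnion.1 hx
      exact (hT' i x hx).1
    obtain ⟨q1, q2⟩ := remove (c := c) A T (fun i x hx => (hT' i x hx).2.1)
      (fun i x hx => (hT' i x hx).1)
    let T2 : ι → Finset α := fun j => (T (σ.symm j)).image f
    have hT2 : univ.biUnion T2 = (univ.biUnion T).image f := by
      ext y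
      simp only [T2, mem_biUnion, mem_univ, true_and, mem_image]
      constructor
      · rintro ⟨j, x, hx, rfl⟩
        exact ⟨x, ⟨_, hx⟩, rfl⟩
      · rintro ⟨x, ⟨i, hx⟩, rfl⟩
        exact ⟨σ i, x, by simpa using hx, rfl⟩
    obtain ⟨q3, q4⟩ := remove (F := F) (c := c) (A.image f) T2 (by
        intro j y hy
        obtain ⟨x, hx, rfl⟩ := mem_image.1 hy
        obtain ⟨hxA, ⟨hxF, hxc⟩, hfx⟩ := hT' _ x hx
        refine ⟨hfx, ?_⟩
        rw [hτ x hxA hxF hfx, hxc, Equiv.apply_symm_apply])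
      (fun j => image_subset_image (fun x hx => (hT' _ x hx).1))
    rw [hT2, ← image_sdiff_of_injOn hf hU] at q3 q4
    have hI2 := hC (A \ univ.biUnion T) sdiff_subset
    have r1 : Iso (A \ univ.biUnion T) (real F c S e) := by
      refine H.iso_real _ (q1.trans hr1) (funext fun i => ?_)
      rw [q2, hr2, hTc]
      have := hed i
      omega
    have r2 : Iso ((A \ univ.biUnion T).image f) (real F c S' (tgt F σ δ e)) := by
      refine H.iso_real _ ?_ (funext fun j => ?_)
      · rw [q3, him, hr1']
      · rw [q4, him, hr2']
        simp only [T2]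
        rw [card_image_of_injOn (hf.mono (fun x hx => (hT' _ x hx).1)), hTc]
        simp only [tgt]
        have := hed (σ.symm j)
        have := he (σ.symm j)
        omega
    exact H.iso.trans (H.iso.symm r1) (H.iso.trans hI2 r2)
  -- eventual constancy
  let b : X → Prop := fun p => ∀ e, (∀ i, F.card ≤ e i) → P p e
  have hconst : ∀ p, ∃ D, ∀ d, Gen D d → (P p d ↔ b p) := by
    intro p
    by_cases hb : b p
    · exact ⟨F.card, fun d hd => ⟨fun _ => hb, fun h => h d hd.1⟩⟩
    · have hb' := hb
      simp only [b] at hb'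
      push Not at hb'
      obtain ⟨e, he, hne⟩ := hb'
      refine ⟨2 * F.card + 1 + N + univ.sup e, fun d hd => ⟨fun h => ?_, fun h => absurd h hb⟩⟩
      exact absurd (hmono p d e (hd.mono (by omega)) he (fun i => by
        have h1 := hd.1 i
        have h2 : e i ≤ univ.sup e := le_sup (mem_univ i)
        omega) h) hne
  choose D0 hD0 using hconst
  refine ⟨(univ.filter b).card, ?_, 2 * F.card + 1 + N + univ.sup D0, fun d hd => ?_⟩
  · refine card_pos.2 ⟨(⟨S, mem_powerset.2 hSF⟩, 1, fun _ => ⟨F.card, by omega⟩), ?_⟩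
    rw [mem_filter]
    refine ⟨mem_univ _, fun e _ => ?_⟩
    simp only [P]
    have : tgt F 1 (fun _ : ι => (⟨F.card, by omega⟩ : Fin (2 * F.card + 1))) e = e := by
      funext j
      exact Nat.add_sub_cancel (n := e j) (m := F.card)
    rw [this]
    exact H.iso.refl _
  · have hPb : ∀ p, P p d ↔ b p := fun p => hD0 p d (hd.mono (by
      have h2 : D0 p ≤ univ.sup D0 := le_sup (mem_univ p)
      omega))
    have hcls : cls Iso F c S d =
        (fun p : X => ((p.1.1, tgt F p.2.1 p.2.2 d) : Finset α × (ι → ℕ))) ''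
          ((univ.filter b : Finset X) : Set X) := by
      ext ⟨S', d'⟩
      constructor
      · rintro ⟨hS', hI⟩
        obtain ⟨f, -, -, -, σ, -, δ, rfl⟩ :=
          hstr d (fun l => by have := hd.1 l; omega) S' hS' _ hI
        refine ⟨(⟨S', mem_powerset.2 hS'⟩, σ, δ), ?_, rfl⟩
        rw [mem_coe, mem_filter]
        exact ⟨mem_univ _, (hPb _).1 hI⟩
      · rintro ⟨p, hp, he⟩
        rw [mem_coe, mem_filter] at hp
        rw [← he]
        exact ⟨mem_powerset.1 p.1.2, (hPb p).2 hp.2⟩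
    rw [hcls, Set.ncard_image_of_injective, Set.ncard_coe_finset]
    rintro ⟨⟨S1, h1⟩, σ, δ⟩ ⟨⟨S2, h2⟩, τ, ε⟩ h
    simp only [Prod.mk.injEq] at h
    obtain ⟨rfl, h⟩ := h
    obtain ⟨rfl, rfl⟩ := tgt_inj (hd.mono (by omega)) h
    rfl

lemma Setting.bad_weight (H : Setting Iso F c) {S : Finset α} (hSF : S ⊆ F)
    (hS : ¬ Good Iso F c S) (D : ℕ) (d : ι → ℕ) (hd : ∀ i, D ≤ d i) :
    D ≤ (cls Iso F c S d).ncard := by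
  unfold Good at hS
  push Not at hS
  obtain ⟨x, y, hx, hy, hxy, hE⟩ := hS
  -- one step
  have hstep : ∀ e : ι → ℕ, Iso (real F c S (fun l => e l + if c x = l then 1 else 0))
      (real F c S (fun l => e l + if c y = l then 1 else 0)) := by
    intro e
    obtain ⟨W, hW1, hW2, hW3⟩ := H.exists_real S hSF e {x, y}
    have hxW := hW3 x (by simp) hx
    have hyW := hW3 y (by simp) hy
    have h := hE W (by
      intro z hz hzF
      rw [← hW1]
      exact mem_inter.2 ⟨hz, hzF⟩) hxW hyW
    have r1 := H.iso_real (insert x W) ((insert_inter_F hx).trans hW1) (cnt_insert hxW hx)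
    have r2 := H.iso_real (insert y W) ((insert_inter_F hy).trans hW1) (cnt_insert hyW hy)
    rw [hW2] at r1 r2
    exact H.iso.trans (H.iso.symm r1) (H.iso.trans h r2)
  let g : ℕ → (ι → ℕ) := fun t l => if l = c x then d l - t else if l = c y then d l + t else d l
  have hg : ∀ t, t ≤ D → Iso (real F c S d) (real F c S (g t)) := by
    intro t
    induction t with
    | zero =>
      intro _
      have : g 0 = d := by funext l; simp [g]
      rw [this]
      exact H.iso.refl _
    | succ t ih =>
      intro ht
      refine H.iso.trans (ih (by omega)) ?_
      have h := hstep (fun l => if l = c x then d l - t - 1 else if l = c y then d l + t else d l)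
      convert h using 2
      · funext l
        have := hd l
        by_cases h1 : l = c x
        · subst h1; simp [g]; omega
        · simp [g, h1, Ne.symm h1]
      · funext l
        have := hd l
        by_cases h1 : l = c x
        · subst h1; simp [g, Ne.symm hxy]; omega
        · by_cases h2 : l = c y
          · subst h2; simp [g, h1]; omega
          · simp [g, h1, h2, Ne.symm h2]
  have hsub : ((range D).image (fun t => ((S, g t) : Finset α × (ι → ℕ))) : Set _) ⊆
      cls Iso F c S d := by
    intro p hp
    simp only [coe_image, Set.mem_image, mem_coe, mem_range] at hp
    obtain ⟨t, ht, rfl⟩ := hp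
    exact ⟨hSF, hg t (by omega)⟩
  have h1 := Set.ncard_le_ncard hsub (H.cls_finite hSF d)
  rw [Set.ncard_coe_finset, card_image_of_injective] at h1
  · simpa using h1
  · intro s t hst
    simp only [Prod.mk.injEq, true_and] at hst
    have := congrFun hst (c y)
    simpa [g, Ne.symm hxy] using this

lemma Setting.weight (H : Setting Iso F c) {S : Finset α} (hSF : S ⊆ F) :
    ∃ w0 : ℝ, 0 ≤ w0 ∧ (S = F → 0 < w0) ∧
      ∀ ε > 0, ∃ D, ∀ d, Gen D d → |1 / ((cls Iso F c S d).ncard : ℝ) - w0| ≤ ε := by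
  by_cases hS : Good Iso F c S
  · obtain ⟨m, hm, D, hD⟩ := H.good_weight hSF hS
    refine ⟨1 / m, by positivity, fun _ => by positivity, fun ε hε => ⟨D, fun d hd => ?_⟩⟩
    rw [hD d hd, sub_self, abs_zero]
    exact hε.le
  · refine ⟨0, le_rfl, fun h => absurd (h ▸ H.good_F) hS, fun ε hε => ?_⟩
    obtain ⟨n, hn⟩ := exists_nat_one_div_lt hε
    refine ⟨n + 1, fun d hd => ?_⟩
    have h1 := H.bad_weight hSF hS (n + 1) d hd.1
    have h2 : ((n : ℝ) + 1) ≤ ((cls Iso F c S d).ncard : ℝ) := by exact_mod_cast h1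
    rw [sub_zero, abs_of_nonneg (by positivity)]
    refine le_trans ?_ hn.le
    exact one_div_le_one_div_of_le (by positivity) h2

theorem Setting.main [Nonempty ι] (H : Setting Iso F c) :
    ∃ a : ℝ, 0 < a ∧ Tendsto (fun n : ℕ =>
      (Nat.card (Quot fun A B : {s : Finset α // s.card = n} => Iso A.1 B.1) : ℝ) /
        (n : ℝ) ^ (Fintype.card ι - 1)) atTop (𝓝 a) := by
  have hw : ∀ S : Finset α, ∃ w0 : ℝ, S ⊆ F → 0 ≤ w0 ∧ (S = F → 0 < w0) ∧
      ∀ ε > 0, ∃ D, ∀ d, Gen D d → |1 / ((cls Iso F c S d).ncard : ℝ) - w0| ≤ ε := by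
    intro S
    by_cases h : S ⊆ F
    · obtain ⟨w0, hw0⟩ := H.weight h
      exact ⟨w0, fun _ => hw0⟩
    · exact ⟨0, fun h' => absurd h' h⟩
  choose w hw using hw
  refine ⟨∑ S ∈ F.powerset, w S / ((Fintype.card ι - 1).factorial : ℝ), ?_, ?_⟩
  · refine sum_pos' (fun S hS => ?_) ⟨F, by simp, ?_⟩
    · have := (hw S (mem_powerset.1 hS)).1
      positivity
    · have := (hw F Subset.rfl).2.1 rfl
      positivity
  have hlim := tendsto_finset_sum F.powerset (fun S hS =>
    tendsto_avg (ι := ι) (fun d => 1 / ((cls Iso F c S d).ncard : ℝ)) (fun d => by positivity)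
      (fun d => by
        rcases Nat.eq_zero_or_pos (cls Iso F c S d).ncard with h | h
        · simp [h]
        · rw [div_le_one (by positivity)]; exact_mod_cast h)
      (w S) (hw S (mem_powerset.1 hS)).2.2 S.card)
  refine hlim.congr' ?_
  filter_upwards [eventually_ge_atTop F.card] with n hn
  rw [← sum_div]
  congr 1
  set Q := Quot fun A B : {s : Finset α // s.card = n} => Iso A.1 B.1 with hQ
  have heq : Equivalence (fun A B : {s : Finset α // s.card = n} => Iso A.1 B.1) :=
    ⟨fun A => H.iso.refl _, fun h => H.iso.symm h, fun h h' => H.iso.trans h h'⟩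
  let T : Finset (Finset α × (ι → ℕ)) :=
    F.powerset.biUnion (fun S => (piAntidiag (univ : Finset ι) (n - S.card)).image (fun d => (S, d)))
  have hTmem : ∀ S d, (S, d) ∈ T ↔ S ⊆ F ∧ S.card + ∑ i, d i = n := by
    intro S d
    simp only [T, mem_biUnion, mem_powerset, mem_image, mem_piAntidiag, mem_univ, implies_true,
      and_true, Prod.mk.injEq]
    constructor
    · rintro ⟨S', hS', d', hd', rfl, rfl⟩
      refine ⟨hS', ?_⟩
      have := card_le_card hS'
      have hd2 : ∑ i, d' i = n - S'.card := hd'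
      omega
    · rintro ⟨hS, h⟩
      exact ⟨S, hS, d, (show ∑ i, d i = n - S.card by omega), rfl, rfl⟩
  have hrc : ∀ S d, S ⊆ F → (real F c S d).card = S.card + ∑ i, d i := by
    intro S d hS
    rw [card_type (F := F) (c := c), (H.real_spec hS d).1, (H.real_spec hS d).2]
  let g : {t // t ∈ T} → Q := fun t => Quot.mk _ ⟨real F c t.1.1 t.1.2, by
    obtain ⟨⟨S, d⟩, ht⟩ := t
    rw [hTmem] at ht
    rw [hrc _ _ ht.1, ht.2]⟩
  have hg : ∀ t t', g t = g t' ↔ Iso (real F c t.1.1 t.1.2) (real F c t'.1.1 t'.1.2) :=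
    fun t t' => heq.quot_mk_eq_iff _ _
  have hsurj : ∀ q, ∃ t ∈ T.attach, g t = q := by
    intro q
    induction q using Quot.ind with
    | mk A =>
      obtain ⟨A, hA⟩ := A
      have hmem : (A ∩ F, cnt F c A) ∈ T := by
        rw [hTmem]
        exact ⟨inter_subset_right, by rw [← card_type, hA]⟩
      refine ⟨⟨_, hmem⟩, mem_attach _ _, ?_⟩
      exact Quot.sound (H.iso.symm (H.iso_real A rfl rfl))
  rw [card_eq_sum_inv T.attach g hsurj]
  have hterm : ∀ t ∈ T.attach, 1 / ((T.attach.filter (fun t' => g t' = g t)).card : ℝ) =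
      (fun t : Finset α × (ι → ℕ) => 1 / ((cls Iso F c t.1 t.2).ncard : ℝ)) t.1 := by
    rintro ⟨⟨S, d⟩, ht⟩ -
    have hcl : cls Iso F c S d = ((T.attach.filter (fun t' => g t' = g ⟨(S, d), ht⟩)).image
        (fun t => t.1) : Finset _) := by
      ext ⟨S', d'⟩
      simp only [coe_image, Set.mem_image, mem_coe, mem_filter, mem_attach, true_and, hg,
        Subtype.exists, exists_and_right, exists_eq_right]
      constructor
      · rintro ⟨hS', hI⟩
        refine ⟨?_, H.iso.symm hI⟩
        rw [hTmem]
        refine ⟨hS', ?_⟩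
        rw [← hrc _ _ hS', ← H.iso.card hI, hrc _ _ ((hTmem _ _).1 ht).1]
        exact ((hTmem _ _).1 ht).2
      · rintro ⟨h1, h2⟩
        exact ⟨((hTmem _ _).1 h1).1, H.iso.symm h2⟩
    simp only
    rw [hcl, Set.ncard_coe_finset, card_image_of_injective _ Subtype.val_injective]
  rw [sum_congr rfl hterm, sum_attach T
    (fun t : Finset α × (ι → ℕ) => 1 / ((cls Iso F c t.1 t.2).ncard : ℝ))]
  rw [sum_biUnion]
  · refine sum_congr rfl fun S _ => ?_
    rw [sum_image]
    intro d _ d' _ h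
    exact (Prod.mk.inj h).2
  · intro S _ S' _ hne
    rw [Function.onFun, disjoint_left]
    intro t ht ht'
    obtain ⟨d, -, rfl⟩ := mem_image.1 ht
    obtain ⟨d', -, h⟩ := mem_image.1 ht'
    exact hne (Prod.mk.inj h).1.symm

end Abstract

section Concrete

open Filter Finset

open scoped Classical Topology

lemma isoRel_isoOn {α : Type u} {I : Type v} [Nonempty α] (ar : I → ℕ)
    (rel : ∀ i, Set (Fin (ar i) → α)) :
    IsoRel (fun A B : Finset α => IsoOn ar rel (A : Set α) (B : Set α)) where
  refl A := ⟨id, Set.bijOn_id _, fun i x _ => Iff.rfl⟩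
  symm := by
    rintro A B ⟨f, hf, hp⟩
    have hinv := hf.invOn_invFunOn
    have hbij : Set.BijOn (Function.invFunOn f (A : Set α)) (B : Set α) (A : Set α) :=
      hinv.symm.bijOn hf.surjOn.mapsTo_invFunOn hf.mapsTo
    refine ⟨Function.invFunOn f (A : Set α), hbij, fun i x hx => ?_⟩
    have h := hp i (Function.invFunOn f (A : Set α) ∘ x) (fun j => hbij.mapsTo (hx j))
    have h2 : f ∘ (Function.invFunOn f (A : Set α) ∘ x) = x := by
      funext j
      exact hinv.2 (hx j)
    rw [h2] at h
    exact h.symm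
  trans := by
    rintro A B C ⟨f, hf, hp⟩ ⟨g, hg, hq⟩
    refine ⟨g ∘ f, hg.comp hf, fun i x hx => ?_⟩
    rw [hp i x hx, hq i (f ∘ x) (fun j => hf.mapsTo (hx j))]
    rfl
  map := by
    rintro A B ⟨f, hf, hp⟩
    refine ⟨f, hf.injOn, ?_, ?_⟩
    · apply Finset.coe_injective
      rw [Finset.coe_image]
      exact hf.image_eq
    · intro C hC
      have hC' : (C : Set α) ⊆ A := by exact_mod_cast hC
      refine ⟨f, ?_, fun i x hx => hp i x (fun j => hC' (hx j))⟩
      rw [Finset.coe_image]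
      exact (hf.injOn.mono hC').bijOn_image

variable {α : Type*} {Iso : Finset α → Finset α → Prop}

lemma eqv_equivalence (h : IsoRel Iso) : Equivalence (Eqv Iso Set.univ) where
  refl x := fun W _ _ _ => h.refl _
  symm := fun hxy W hW hx hy => h.symm (hxy W hW hy hx)
  trans := by
    intro x y z hxy hyz W _ hx hz
    by_cases hy : y ∈ W
    · by_cases hxz : x = z
      · subst hxz; exact h.refl _
      have hyx : y ≠ x := by rintro rfl; exact hx hy
      have hyz' : y ≠ z := by rintro rfl; exact hz hy
      obtain ⟨G, hyG, rfl⟩ : ∃ G, y ∉ G ∧ insert y G = W :=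
        ⟨W.erase y, by simp, insert_erase hy⟩
      simp only [mem_insert, not_or] at hx hz
      have h1 := hyz (insert x G) (Set.subset_univ _) (by simp [hyx, hyG])
        (by simp [Ne.symm hxz, hz.2])
      have h2 := hxy (insert z G) (Set.subset_univ _) (by simp [hxz, hx.2])
        (by simp [hyz', hyG])
      rw [Finset.insert_comm y x, Finset.insert_comm z x] at h1
      rw [Finset.insert_comm y z] at h2
      exact h.trans h1 h2
    · exact h.trans (hxy W (Set.subset_univ _) hx hy) (hyz W (Set.subset_univ _) hy hz)

lemma iso_of_col (h : IsoRel Iso) {κ : Type*} (col : α → κ)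
    (hcol : ∀ x y, col x = col y → Eqv Iso Set.univ x y) (B : Finset α) :
    ∀ (m : ℕ) (A : Finset α), (A \ B).card = m →
      (∀ q, (A.filter (fun x => col x = q)).card = (B.filter (fun x => col x = q)).card) →
      Iso A B := by
  intro m
  induction m with
  | zero =>
    intro A hm hq
    have hAB : A ⊆ B := by
      rw [card_eq_zero] at hm
      exact sdiff_eq_empty_iff_subset.1 hm
    have : A = B := by
      refine hAB.antisymm fun y hy => ?_
      have h1 := eq_of_subset_of_card_le (filter_subset_filter (fun x => col x = col y) hAB)
        (hq (col y)).ge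
      have h2 : y ∈ B.filter (fun x => col x = col y) := mem_filter.2 ⟨hy, rfl⟩
      rw [← h1] at h2
      exact (mem_filter.1 h2).1
    rw [this]
    exact h.refl _
  | succ m ih =>
    intro A hm hq
    obtain ⟨x, hx⟩ : (A \ B).Nonempty := card_pos.1 (by omega)
    rw [Finset.mem_sdiff] at hx
    obtain ⟨y, hyB, hyA, hxy⟩ : ∃ y ∈ B, y ∉ A ∧ col x = col y := by
      have h1 := card_sdiff_comm (hq (col x))
      have h2 : 0 < ((A.filter (fun z => col z = col x)) \
          (B.filter (fun z => col z = col x))).card :=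
        card_pos.2 ⟨x, by simp [hx.1, hx.2]⟩
      rw [h1] at h2
      obtain ⟨y, hy⟩ := card_pos.1 h2
      simp only [Finset.mem_sdiff, mem_filter, not_and] at hy
      exact ⟨y, hy.1.1, fun hA => hy.2 hA hy.1.2, hy.1.2.symm⟩
    obtain ⟨W, hxW, rfl⟩ : ∃ W, x ∉ W ∧ insert x W = A :=
      ⟨A.erase x, by simp, insert_erase hx.1⟩
    simp only [mem_insert, not_or] at hyA
    refine h.trans (hcol x y hxy W (Set.subset_univ _) hxW hyA.2) (ih _ ?_ ?_)
    · rw [insert_sdiff_of_mem _ hyB]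
      rw [insert_sdiff_of_notMem _ hx.2, card_insert_of_notMem (by simp [hxW])] at hm
      omega
    · intro q
      rw [← hq q, filter_insert, filter_insert, hxy]
      by_cases hqy : col y = q
      · rw [if_pos hqy, if_pos hqy, card_insert_of_notMem (by simp [hyA.2]),
          card_insert_of_notMem (by simp [hxW])]
      · rw [if_neg hqy, if_neg hqy]

end Concrete

/-- **Lemma (Pouzet–Thiéry).** If `R` is an infinite relational structure admitting a
monomorphic decomposition into finitely many blocks, whose profile takes only finite values, and
`k ≥ 1` is the least number of infinite blocks occurring in such a decomposition, then
`φ_R(n) ∼ a·n^(k-1)` for some positive real `a`. -/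
theorem profile_equivalent_monomial_of_least_infinite_blocks [Infinite α]
    (ar : I → ℕ) (rel : ∀ i, Set (Fin (ar i) → α))
    (hval : ∀ n, profile ar rel n < Cardinal.aleph0) (k : ℕ) (hk1 : 1 ≤ k)
    (hleast : IsLeast {j : ℕ | ∃ Prt : Set (Set α),
      IsMonoDecomp ar rel Prt ∧ Prt.Finite ∧ {B ∈ Prt | B.Infinite}.ncard = j} k) :
    ∃ a : ℝ, 0 < a ∧
      Filter.Tendsto (fun n : ℕ => (profileNat ar rel n : ℝ) / (n : ℝ) ^ (k - 1))
        Filter.atTop (nhds a) := by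
  classical
  have hI := isoRel_isoOn ar rel
  let E : Setoid α := ⟨_, eqv_equivalence hI⟩
  let Q := Quotient E
  let mk : α → Q := Quotient.mk E
  have hmk : ∀ x y, mk x = mk y ↔ Eqv (fun A B : Finset α => IsoOn ar rel (A : Set α) (B : Set α))
      Set.univ x y := fun x y => Quotient.eq (r := E)
  obtain ⟨⟨Prt, ⟨hpart, hmono⟩, hfin, hcard⟩, hmin⟩ := hleast
  -- points of one block are equivalent
  have hblock : ∀ B ∈ Prt, ∀ x ∈ B, ∀ y ∈ B, mk x = mk y := by
    intro B hB x hx y hy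
    rw [hmk]
    intro W _ hxW hyW
    refine hmono _ _ ?_ ?_
    · rw [Finset.card_insert_of_notMem hxW, Finset.card_insert_of_notMem hyW]
    · intro B' hB'
      rw [Finset.coe_insert, Finset.coe_insert]
      by_cases hBB : B' = B
      · subst hBB
        rw [Set.insert_inter_of_mem hx, Set.insert_inter_of_mem hy,
          Set.ncard_insert_of_notMem (fun h => hxW h.1) (W.finite_toSet.inter_of_left _),
          Set.ncard_insert_of_notMem (fun h => hyW h.1) (W.finite_toSet.inter_of_left _)]
      · have hnot : ∀ z ∈ B, z ∉ B' := fun z hz hz' =>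
          hBB ((hpart.2 z).unique ⟨hB', hz'⟩ ⟨hB, hz⟩)
        rw [Set.insert_inter_of_notMem (hnot x hx), Set.insert_inter_of_notMem (hnot y hy)]
  have hne : ∀ B ∈ Prt, B.Nonempty := fun B hB => by
    rw [Set.nonempty_iff_ne_empty]
    rintro rfl
    exact hpart.1 hB
  have hcov : ∀ x, ∃ B ∈ Prt, x ∈ B := fun x => by
    obtain ⟨B, hB, -⟩ := hpart.2 x
    exact ⟨B, hB.1, hB.2⟩
  have : Finite Prt := hfin
  have hQfin : Finite Q := by
    refine Finite.of_surjective (fun B : Prt => mk (hne B.1 B.2).some) ?_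
    intro q
    induction q using Quotient.inductionOn with
    | h x =>
      obtain ⟨B, hB, hx⟩ := hcov x
      exact ⟨⟨B, hB⟩, hblock B hB _ (hne B hB).some_mem x hx⟩
  let fib : Q → Set α := fun q => {x | mk x = q}
  let ι := {q : Q // (fib q).Infinite}
  have hιfin : Finite ι := inferInstance
  let _ : Fintype ι := Fintype.ofFinite ι
  -- at most `k` infinite classes
  have hle : Fintype.card ι ≤ k := by
    have hex : ∀ q : ι, ∃ B ∈ Prt, B.Infinite ∧ B ⊆ fib q.1 := by
      intro q
      by_contra hcon
      push Not at hcon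
      apply q.2
      have hsub : fib q.1 ⊆ ⋃ B ∈ {B ∈ Prt | B.Finite}, B := by
        intro x hx
        obtain ⟨B, hB, hxB⟩ := hcov x
        simp only [Set.mem_iUnion]
        refine ⟨B, ⟨hB, ?_⟩, hxB⟩
        by_contra hBi
        refine hcon B hB hBi fun y hy => ?_
        exact (hblock B hB y hy x hxB).trans hx
      refine Set.Finite.subset (Set.Finite.biUnion (hfin.subset fun B hB => hB.1) ?_) hsub
      exact fun B hB => hB.2
    choose b hbP hbI hbs using hex
    have : Finite {B ∈ Prt | B.Infinite} := (hfin.subset fun B hB => hB.1)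
    have hinj : Function.Injective
        (fun q : ι => (⟨b q, hbP q, hbI q⟩ : {B ∈ Prt | B.Infinite})) := by
      intro q q' h
      have h' : b q = b q' := congrArg Subtype.val h
      obtain ⟨x, hx⟩ := (hbI q).nonempty
      have h1 : mk x = q.1 := hbs q hx
      have h2 : mk x = q'.1 := hbs q' (h' ▸ hx)
      exact Subtype.ext (h1.symm.trans h2)
    have := Nat.card_le_card_of_injective _ hinj
    rw [Nat.card_eq_fintype_card] at this
    rw [← hcard]
    exact this
  -- isomorphism is decided by the classes
  have hiso : ∀ A B : Finset α, (∀ q, (A.filter (fun x => mk x = q)).card =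
      (B.filter (fun x => mk x = q)).card) → IsoOn ar rel (A : Set α) (B : Set α) := by
    intro A B h
    exact iso_of_col hI mk (fun x y hxy => (hmk x y).1 hxy) B _ A rfl (by convert h)
  have hge : k ≤ Fintype.card ι := by
    have hcls : E.classes ⊆ Set.range fib := by
      rintro B ⟨y, rfl⟩
      refine ⟨mk y, ?_⟩
      ext x
      exact Quotient.eq (r := E)
    have hclsf : E.classes.Finite := (Set.finite_range fib).subset hcls
    have hm : IsMonoDecomp ar rel E.classes := by
      refine ⟨Setoid.isPartition_classes E, fun A A' _ h => hiso A A' fun q => ?_⟩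
      induction q using Quotient.inductionOn with
      | h y =>
        have h1 := h _ (Setoid.mem_classes E y)
        have h2 : ∀ A : Finset α, (A.filter (fun x => mk x = Quotient.mk E y)).card =
            ((A : Set α) ∩ {x | E x y}).ncard := by
          intro A
          rw [← Set.ncard_coe_finset]
          congr 1
          ext x
          simp only [Finset.coe_filter, Set.mem_setOf_eq, Set.mem_inter_iff, Finset.mem_coe]
          exact and_congr_right fun _ => Quotient.eq (r := E)
        rw [h2, h2]
        exact h1
    refine (hmin ⟨E.classes, hm, hclsf, rfl⟩).trans ?_
    have hsub : {B ∈ E.classes | B.Infinite} ⊆ (fun q : ι => fib q.1) '' Set.univ := by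
      rintro B ⟨hB, hBi⟩
      obtain ⟨q, rfl⟩ := hcls hB
      exact ⟨⟨q, hBi⟩, trivial, rfl⟩
    refine (Set.ncard_le_ncard hsub (Set.toFinite _)).trans
      ((Set.ncard_image_le Set.finite_univ).trans ?_)
    rw [Set.ncard_univ, Nat.card_eq_fintype_card]
  have hk : Fintype.card ι = k := le_antisymm hle hge
  have hιne : Nonempty ι := Fintype.card_pos_iff.1 (by omega)
  -- the finite part
  have hFfin : {x | ¬ (fib (mk x)).Infinite}.Finite := by
    have : {x | ¬ (fib (mk x)).Infinite} ⊆ ⋃ q ∈ {q : Q | (fib q).Finite}, fib q := by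
      intro x hx
      simp only [Set.mem_iUnion]
      exact ⟨mk x, Set.not_infinite.1 hx, rfl⟩
    exact Set.Finite.subset (Set.Finite.biUnion (Set.toFinite _) (fun q hq => hq)) this
  let F : Finset α := hFfin.toFinset
  have hF : ∀ x, x ∉ F ↔ (fib (mk x)).Infinite := fun x => by simp [F]
  let c : α → ι := fun x => if h : (fib (mk x)).Infinite then ⟨mk x, h⟩ else hιne.some
  have hc : ∀ x, x ∉ F → (c x).1 = mk x := by
    intro x hx
    simp only [c]
    rw [dif_pos ((hF x).1 hx)]
  have hblk : ∀ x (q : ι), (x ∉ F ∧ c x = q) ↔ mk x = q.1 := by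
    intro x q
    constructor
    · rintro ⟨hx, rfl⟩
      exact (hc x hx).symm
    · intro h
      have hx : x ∉ F := by rw [hF, h]; exact q.2
      exact ⟨hx, Subtype.ext ((hc x hx).trans h)⟩
  have HS : Setting (fun A B : Finset α => IsoOn ar rel (A : Set α) (B : Set α)) F c := by
    refine ⟨hI, fun q => ?_, fun A B hAB hcnt => hiso A B fun q => ?_, fun x y hx hy hxy hE => ?_⟩
    · have : {x | x ∉ F ∧ c x = q} = fib q.1 := by
        ext x
        exact hblk x q
      rw [this]
      exact q.2
    · by_cases hq : (fib q).Infinite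
      · have h := hcnt ⟨q, hq⟩
        unfold cnt at h
        simp only [hblk] at h
        convert h
      · have h2 : ∀ A : Finset α, A.filter (fun x => mk x = q) =
            (A ∩ F).filter (fun x => mk x = q) := by
          intro A
          ext x
          simp only [Finset.mem_filter, Finset.mem_inter]
          constructor
          · rintro ⟨hA, rfl⟩
            refine ⟨⟨hA, ?_⟩, rfl⟩
            by_contra hx
            exact hq ((hF x).1 hx)
          · rintro ⟨⟨hA, -⟩, h⟩
            exact ⟨hA, h⟩
        rw [h2 A, h2 B]
        congr 2
    · apply hxy
      apply Subtype.ext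
      rw [hc x hx, hc y hy]
      exact (hmk x y).2 hE
  obtain ⟨a, ha, hlim⟩ := HS.main
  rw [hk] at hlim
  exact ⟨a, ha, hlim⟩
end

section
/- Let R be a relational structure on a set E. (1) For every x ∈ E, the union R(x) of all the monomorphic parts of R containing x is itself a monomorphic part of R, and it is the largest monomorphic part of R containing x. (2) The sets R(x), for x ∈ E, form a partition of E which is a monomorphic decomposition of R, and every monomorphic decomposition of R is a refinement of it: every block of any monomorphic decomposition of R is contained in some R(x). -/
open scoped Cardinal

universe u v

variable {α : Type u} {I : Type v}

/-- A monomorphic part of a relational structure: a subset `B` of the domain such that the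
substructures induced on two finite subsets `A, A'` of the same size are isomorphic whenever
`A ∖ B = A' ∖ B`. -/
def IsMonoPart (ar : I → ℕ) (rel : ∀ i, Set (Fin (ar i) → α)) (B : Set α) : Prop :=
  ∀ A A' : Finset α, A.card = A'.card → (↑A : Set α) \ B = (↑A' : Set α) \ B →
    IsoOn ar rel (↑A : Set α) (↑A' : Set α)

/-- The union of all the monomorphic parts of the structure containing `x`. -/
def monoComp (ar : I → ℕ) (rel : ∀ i, Set (Fin (ar i) → α)) (x : α) : Set α :=
  ⋃₀ {B : Set α | IsMonoPart ar rel B ∧ x ∈ B}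

theorem isoOn_refl (ar : I → ℕ) (rel : ∀ i, Set (Fin (ar i) → α)) (A : Set α) :
    IsoOn ar rel A A :=
  ⟨id, Set.bijOn_id A, fun _ _ _ => Iff.rfl⟩

theorem isoOn_trans {ar : I → ℕ} {rel : ∀ i, Set (Fin (ar i) → α)} {A B C : Set α}
    (h : IsoOn ar rel A B) (h' : IsoOn ar rel B C) : IsoOn ar rel A C := by
  obtain ⟨f, hf, hf'⟩ := h
  obtain ⟨g, hg, hg'⟩ := h'
  refine ⟨g ∘ f, hg.comp hf, fun i x hx => ?_⟩
  rw [hf' i x hx, hg' i (f ∘ x) (fun j => hf.mapsTo (hx j))]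
  rfl

theorem IsMonoPart.subset {ar : I → ℕ} {rel : ∀ i, Set (Fin (ar i) → α)} {B C : Set α}
    (h : IsMonoPart ar rel B) (hC : C ⊆ B) : IsMonoPart ar rel C := by
  intro A A' hc hd
  refine h A A' hc ?_
  ext y
  have := Set.ext_iff.1 hd y
  have := @hC y
  simp only [Set.mem_sdiff] at *
  tauto

open Classical in
theorem isMonoPart_pair_iff {ar : I → ℕ} {rel : ∀ i, Set (Fin (ar i) → α)} {a b : α} :
    IsMonoPart ar rel {a, b} ↔ ∀ F : Finset α, a ∉ F → b ∉ F →
      IsoOn ar rel (↑(insert a F) : Set α) (↑(insert b F) : Set α) ∧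
      IsoOn ar rel (↑(insert b F) : Set α) (↑(insert a F) : Set α) := by
  constructor
  · intro h F ha hb
    constructor <;>
    · apply h
      · simp [ha, hb]
      · ext y
        simp only [Finset.coe_insert, Set.mem_sdiff, Set.mem_insert_iff, Set.mem_singleton_iff]
        tauto
  · intro h A A' hc hd
    have hd' : ∀ y, y ≠ a → y ≠ b → (y ∈ A ↔ y ∈ A') := by
      intro y h1 h2
      have := Set.ext_iff.1 hd y
      simpa [h1, h2] using this
    by_cases hAA : A = A'
    · subst hAA
      exact isoOn_refl _ _ _
    have key : (a ∈ A ∧ b ∉ A ∧ a ∉ A' ∧ b ∈ A') ∨ (a ∉ A ∧ b ∈ A ∧ a ∈ A' ∧ b ∉ A') := by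
      by_contra hcon
      apply hAA
      have : A ⊆ A' ∨ A' ⊆ A := by
        by_contra hh
        rw [not_or] at hh
        obtain ⟨⟨y, hy, hy'⟩, ⟨z, hz, hz'⟩⟩ :=
          And.intro (Finset.not_subset.1 hh.1) (Finset.not_subset.1 hh.2)
        have hya : y = a ∨ y = b := by
          by_contra hne
          rw [not_or] at hne
          exact hy' ((hd' y hne.1 hne.2).1 hy)
        have hza : z = a ∨ z = b := by
          by_contra hne
          rw [not_or] at hne
          exact hz' ((hd' z hne.1 hne.2).2 hz)
        rcases hya with rfl | rfl <;> rcases hza with rfl | rfl <;> tauto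
      rcases this with h1 | h1
      · exact Finset.eq_of_subset_of_card_le h1 hc.ge
      · exact (Finset.eq_of_subset_of_card_le h1 hc.le).symm
    rcases key with ⟨h1, h2, h3, h4⟩ | ⟨h1, h2, h3, h4⟩
    · have := (h (A.erase a) (by simp) (by simp [h2])).1
      rw [Finset.insert_erase h1] at this
      have e : insert b (A.erase a) = A' := by
        ext y
        have := hd' y
        grind
      rwa [e] at this
    · have := (h (A.erase b) (by simp [h1]) (by simp)).2
      rw [Finset.insert_erase h2] at this
      have e : insert a (A.erase b) = A' := by
        ext y
        have := hd' y
        grind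
      rwa [e] at this

open Classical in
theorem pair_trans {ar : I → ℕ} {rel : ∀ i, Set (Fin (ar i) → α)} {a b c : α}
    (h : IsMonoPart ar rel {a, b}) (h' : IsMonoPart ar rel {b, c}) :
    IsMonoPart ar rel {a, c} := by
  by_cases hab : a = b
  · subst hab; exact h'
  by_cases hbc : b = c
  · subst hbc; exact h
  by_cases hac : a = c
  · subst hac
    exact h.subset (by simp)
  rw [isMonoPart_pair_iff] at *
  intro F ha hc
  by_cases hb : b ∈ F
  · have e : F = insert b (F.erase b) := (Finset.insert_erase hb).symm
    have h1 := h (insert c (F.erase b)) (by simp [ha, hac]) (by simp [hbc])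
    have h2 := h' (insert a (F.erase b)) (by simp [Ne.symm hab]) (by simp [hc, Ne.symm hac])
    rw [Finset.insert_comm b a, Finset.insert_comm c a, ← e] at h2
    rw [Finset.insert_comm b c, ← e] at h1
    exact ⟨isoOn_trans h2.1 h1.1, isoOn_trans h1.2 h2.2⟩
  · exact ⟨isoOn_trans (h F ha hb).1 (h' F hb hc).1, isoOn_trans (h' F hb hc).2 (h F ha hb).2⟩

/-- The equivalence relation: the pair `{a, b}` is a monomorphic part. -/
def pairSetoid (ar : I → ℕ) (rel : ∀ i, Set (Fin (ar i) → α)) : Setoid α where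
  r a b := IsMonoPart ar rel {a, b}
  iseqv :=
    { refl := fun a => by
        rw [isMonoPart_pair_iff]
        intro F _ _
        exact ⟨isoOn_refl _ _ _, isoOn_refl _ _ _⟩
      symm := fun {a b} h => by rwa [Set.pair_comm]
      trans := fun h h' => pair_trans h h' }

open Classical in
theorem exchange (ar : I → ℕ) (rel : ∀ i, Set (Fin (ar i) → α)) (A' : Finset α) (n : ℕ) :
    ∀ A : Finset α, (A \ A').card = n → A.card = A'.card →
      (∀ x, (A.filter (fun y => pairSetoid ar rel y x)).card =
        (A'.filter (fun y => pairSetoid ar rel y x)).card) →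
      IsoOn ar rel (↑A : Set α) (↑A' : Set α) := by
  induction n with
  | zero =>
    intro A h0 hc _
    have : A = A' := Finset.eq_of_subset_of_card_le
      (Finset.sdiff_eq_empty_iff_subset.1 (Finset.card_eq_zero.1 h0)) hc.ge
    subst this
    exact isoOn_refl _ _ _
  | succ n ih =>
    intro A hn hc hf
    obtain ⟨a, ha⟩ : (A \ A').Nonempty := Finset.card_pos.1 (by omega)
    obtain ⟨haA, haA'⟩ := Finset.mem_sdiff.1 ha
    obtain ⟨b, hbA', hbA, hba⟩ : ∃ b ∈ A', b ∉ A ∧ pairSetoid ar rel b a := by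
      by_contra hcon
      push Not at hcon
      have hs : A'.filter (fun y => pairSetoid ar rel y a) ⊆
          A.filter (fun y => pairSetoid ar rel y a) := by
        intro y hy
        rw [Finset.mem_filter] at *
        exact ⟨by_contra fun h => hcon y hy.1 h hy.2, hy.2⟩
      have he := Finset.eq_of_subset_of_card_le hs (hf a).le
      have : a ∈ A.filter (fun y => pairSetoid ar rel y a) :=
        Finset.mem_filter.2 ⟨haA, (pairSetoid ar rel).refl a⟩
      rw [← he] at this
      exact haA' (Finset.mem_filter.1 this).1
    have hb' : b ∉ A.erase a := fun h => hbA (Finset.mem_of_mem_erase h)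
    have hcard : (insert b (A.erase a)).card = A.card := by
      rw [Finset.card_insert_of_notMem hb', Finset.card_erase_add_one haA]
    have h1 := (isMonoPart_pair_iff.1 (show IsMonoPart ar rel {b, a} from hba)
      (A.erase a) hb' (by simp)).2
    rw [Finset.insert_erase haA] at h1
    refine isoOn_trans h1 (ih _ ?_ (hcard.trans hc) ?_)
    · have : insert b (A.erase a) \ A' = (A \ A').erase a := by
        ext y
        by_cases hyb : y = b
        · subst hyb
          simp [hbA', hbA]
        · simp [hyb, and_assoc]
      rw [this, Finset.card_erase_of_mem ha, hn]
      rfl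
    · intro x
      rw [← hf x, Finset.filter_insert, Finset.filter_erase]
      have hiff : pairSetoid ar rel b x ↔ pairSetoid ar rel a x :=
        ⟨fun h => (pairSetoid ar rel).trans ((pairSetoid ar rel).symm hba) h,
          fun h => (pairSetoid ar rel).trans hba h⟩
      split_ifs with hx
      · have hm : a ∈ A.filter (fun y => pairSetoid ar rel y x) :=
          Finset.mem_filter.2 ⟨haA, hiff.1 hx⟩
        rw [Finset.card_insert_of_notMem, Finset.card_erase_add_one hm]
        simp [hbA]
      · rw [Finset.erase_eq_of_notMem]
        intro h
        exact hx (hiff.2 (Finset.mem_filter.1 h).2)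

open Classical in
theorem isMonoDecomp_classes (ar : I → ℕ) (rel : ∀ i, Set (Fin (ar i) → α)) :
    IsMonoDecomp ar rel (pairSetoid ar rel).classes := by
  refine ⟨Setoid.isPartition_classes _, fun A A' hc h => exchange ar rel A' _ A rfl hc ?_⟩
  intro x
  have := h _ ((pairSetoid ar rel).mem_classes x)
  rw [← Set.ncard_coe_finset, ← Set.ncard_coe_finset, Finset.coe_filter, Finset.coe_filter]
  exact this

theorem IsMonoDecomp.isMonoPart {ar : I → ℕ} {rel : ∀ i, Set (Fin (ar i) → α)}
    {Prt : Set (Set α)} (h : IsMonoDecomp ar rel Prt) {B : Set α} (hB : B ∈ Prt) :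
    IsMonoPart ar rel B := by
  intro A A' hc hd
  refine h.2 A A' hc fun C hC => ?_
  by_cases hCB : C = B
  · subst hCB
    have h1 := Set.ncard_inter_add_ncard_diff_eq_ncard (↑A : Set α) C A.finite_toSet
    have h2 := Set.ncard_inter_add_ncard_diff_eq_ncard (↑A' : Set α) C A'.finite_toSet
    rw [Set.ncard_coe_finset] at h1 h2
    rw [hd] at h1
    omega
  · have hdis : Disjoint C B := h.1.pairwiseDisjoint hC hB hCB
    congr 1
    ext y
    have h1 := Set.ext_iff.1 hd y
    have h2 : y ∈ C → y ∉ B := fun h => Set.disjoint_left.1 hdis h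
    simp only [Set.mem_sdiff, Set.mem_inter_iff] at *
    tauto

theorem monoComp_eq (ar : I → ℕ) (rel : ∀ i, Set (Fin (ar i) → α)) (x : α) :
    monoComp ar rel x = {y | pairSetoid ar rel y x} := by
  ext y
  constructor
  · rintro ⟨B, ⟨hB, hx⟩, hy⟩
    exact hB.subset (by rintro z (rfl | rfl) <;> assumption)
  · intro h
    exact ⟨{y, x}, ⟨h, by simp⟩, by simp⟩

theorem range_monoComp (ar : I → ℕ) (rel : ∀ i, Set (Fin (ar i) → α)) :
    Set.range (monoComp ar rel) = (pairSetoid ar rel).classes := by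
  ext C
  simp only [Set.mem_range, monoComp_eq, Setoid.classes, Set.mem_setOf_eq, eq_comm]

/-- **Proposition (Pouzet–Thiéry).** (1) For every `x`, the union `R(x)` of all monomorphic
parts containing `x` is a monomorphic part, the largest one containing `x`.  (2) The sets `R(x)`
form a partition which is a monomorphic decomposition of `R`, of which every monomorphic
decomposition is a refinement. -/
theorem monoComp_largest_and_canonical_decomposition
    (ar : I → ℕ) (rel : ∀ i, Set (Fin (ar i) → α)) :
    (∀ x : α, IsMonoPart ar rel (monoComp ar rel x) ∧ x ∈ monoComp ar rel x ∧
        ∀ B : Set α, IsMonoPart ar rel B → x ∈ B → B ⊆ monoComp ar rel x) ∧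
      IsMonoDecomp ar rel (Set.range (monoComp ar rel)) ∧
        ∀ Prt : Set (Set α), IsMonoDecomp ar rel Prt →
          ∀ B ∈ Prt, ∃ x : α, B ⊆ monoComp ar rel x := by
  have hsub : ∀ (x : α) (B : Set α), IsMonoPart ar rel B → x ∈ B → B ⊆ monoComp ar rel x :=
    fun x B hB hx => Set.subset_sUnion_of_mem ⟨hB, hx⟩
  have hdec : IsMonoDecomp ar rel (Set.range (monoComp ar rel)) := by
    rw [range_monoComp]
    exact isMonoDecomp_classes ar rel
  refine ⟨fun x => ⟨hdec.isMonoPart ⟨x, rfl⟩, ?_, hsub x⟩, hdec, ?_⟩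
  · rw [monoComp_eq]
    exact (pairSetoid ar rel).refl x
  · intro Prt h B hB
    obtain ⟨x, hx⟩ := Setoid.nonempty_of_mem_partition h.1 hB
    exact ⟨x, hsub x B (h.isMonoPart hB) hx⟩
end

section
/- An infinite relational structure R on a set E is monomorphic if and only if it is chainable: φ_R(n) = 1 for every natural number n if and only if there exists a linear order ≤ on E such that every local isomorphism of the chain (E,≤) is a local isomorphism of R. -/
open scoped Cardinal

universe u v

variable {α : Type u} {I : Type v}

/-- A relational structure is chainable if there is a linear order on its domain such that every
local isomorphism of the resulting chain (i.e. every order isomorphism between two subsets) is a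
local isomorphism of the structure. -/
def Chainable (ar : I → ℕ) (rel : ∀ i, Set (Fin (ar i) → α)) : Prop :=
  ∃ le : α → α → Prop, IsLinearOrder α le ∧
    ∀ (A B : Set α) (f : α → α), Set.BijOn f A B →
      (∀ a ∈ A, ∀ b ∈ A, (le a b ↔ le (f a) (f b))) →
      PreservesRel ar rel A f

/-- Iterated ultrafilter quantifier. -/
def ultraHolds (U : Ultrafilter α) (P : List α → Prop) : ℕ → List α → Prop
  | 0, l => P l
  | k + 1, l => ∀ᶠ x in (U : Filter α), ultraHolds U P k (x :: l)

theorem exists_indisc [Infinite α] {K : Type v} [Finite K] (k : K → ℕ)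
    (P : K → List α → Prop) (n : ℕ) :
    ∃ l : List α, l.Nodup ∧ l.length = n ∧ ∀ c, ∀ s t : List α, s.Sublist l → t.Sublist l →
      s.length = k c → t.length = k c → (P c s ↔ P c t) := by
  classical
  let U : Ultrafilter α := Filter.hyperfilter α
  suffices h : ∃ l : List α, l.Nodup ∧ l.length = n ∧ ∀ c, ∀ s : List α, s.Sublist l →
      ∀ d, s.length + d = k c → (ultraHolds U (P c) d s ↔ ultraHolds U (P c) (k c) []) by
    obtain ⟨l, h1, h2, h3⟩ := h
    refine ⟨l, h1, h2, fun c s t hs ht hsl htl => ?_⟩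
    have a := h3 c s hs 0 (by omega)
    have b := h3 c t ht 0 (by omega)
    simp only [ultraHolds] at a b
    rw [a, b]
  induction n with
  | zero =>
    refine ⟨[], by simp, by simp, ?_⟩
    intro c s hs d hd
    obtain rfl : s = [] := by simpa using hs
    simp at hd
    rw [hd]
  | succ n ih =>
    obtain ⟨l, h1, h2, h3⟩ := ih
    have key : ∀ c, ∀ s ∈ l.sublists.toFinset, ∀ d ∈ Finset.range (k c), ∀ᶠ x in (U : Filter α),
        (ultraHolds U (P c) (d + 1) s ↔ ultraHolds U (P c) d (x :: s)) := by
      intro c s _ d _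
      by_cases h : ultraHolds U (P c) (d + 1) s
      · have h' : ∀ᶠ x in (U : Filter α), ultraHolds U (P c) d (x :: s) := h
        filter_upwards [h'] with x hx
        exact ⟨fun _ => hx, fun _ => h⟩
      · have h' : ∀ᶠ x in (U : Filter α), ¬ ultraHolds U (P c) d (x :: s) :=
          Ultrafilter.eventually_not.2 h
        filter_upwards [h'] with x hx
        exact ⟨fun h0 => absurd h0 h, fun h0 => absurd h0 hx⟩
    have key2 : ∀ᶠ x in (U : Filter α), ∀ c, ∀ s ∈ l.sublists.toFinset,
        ∀ d ∈ Finset.range (k c),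
        (ultraHolds U (P c) (d + 1) s ↔ ultraHolds U (P c) d (x :: s)) := by
      rw [Filter.eventually_all]
      intro c
      rw [Filter.eventually_all_finset]
      intro s hs
      rw [Filter.eventually_all_finset]
      intro d hd
      exact key c s hs d hd
    have key3 : ∀ᶠ x in (U : Filter α), x ∉ l := by
      have : {x | x ∈ l}ᶜ ∈ Filter.hyperfilter α :=
        (List.finite_toSet l).compl_mem_hyperfilter
      exact this
    obtain ⟨a, ha, hal⟩ := (key2.and key3).exists
    refine ⟨a :: l, List.nodup_cons.2 ⟨hal, h1⟩, by simp [h2], ?_⟩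
    intro c s hs d hd
    rcases List.sublist_cons_iff.1 hs with hs | ⟨r, rfl, hr⟩
    · exact h3 c s hs d hd
    · simp at hd
      rw [← ha c r (by simpa using hr) d (by simp; omega)]
      exact h3 c r hr (d + 1) (by omega)

theorem isoOn_equivalence (ar : I → ℕ) (rel : ∀ i, Set (Fin (ar i) → α)) (n : ℕ) :
    Equivalence (fun A B : {s : Finset α // s.card = n} =>
      IsoOn ar rel (↑A.1 : Set α) (↑B.1 : Set α)) := by
  classical
  refine ⟨?_, ?_, ?_⟩
  · intro A
    exact ⟨id, Set.bijOn_id _, fun i x hx => Iff.rfl⟩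
  · rintro A B ⟨f, hf, hp⟩
    rcases isEmpty_or_nonempty α with he | hne
    · exact ⟨id, ⟨fun x => he.elim x, fun x => he.elim x, fun x => he.elim x⟩,
        fun i x hx => Iff.rfl⟩
    have hinv := hf.invOn_invFunOn
    refine ⟨Function.invFunOn f A.1, (Set.bijOn_comm hinv).2 hf, ?_⟩
    intro i x hx
    have hm := ((Set.bijOn_comm hinv).2 hf).mapsTo
    have := hp i (Function.invFunOn f A.1 ∘ x) (fun j => hm (hx j))
    rw [this]
    have e : f ∘ (Function.invFunOn f A.1 ∘ x) = x := by
      funext j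
      exact hinv.2 (hx j)
    rw [e]
  · rintro A B C ⟨f, hf, hp⟩ ⟨g, hg, hq⟩
    refine ⟨g ∘ f, hg.comp hf, fun i x hx => ?_⟩
    rw [hp i x hx, hq i (f ∘ x) (fun j => hf.mapsTo (hx j))]
    rfl

theorem profile_eq_one_iff [Infinite α] (ar : I → ℕ) (rel : ∀ i, Set (Fin (ar i) → α)) (n : ℕ) :
    profile ar rel n = 1 ↔ ∀ A B : Finset α, A.card = n → B.card = n →
      IsoOn ar rel (↑A : Set α) (↑B : Set α) := by
  unfold profile
  rw [Cardinal.eq_one_iff_unique]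
  constructor
  · rintro ⟨h, _⟩ A B hA hB
    have := Quot.eqvGen_exact (h.elim (Quot.mk _ ⟨A, hA⟩) (Quot.mk _ ⟨B, hB⟩))
    exact (isoOn_equivalence ar rel n).eqvGen_iff.1 this
  · intro h
    refine ⟨⟨?_⟩, ?_⟩
    · rintro ⟨A⟩ ⟨B⟩
      exact Quot.sound (h A.1 B.1 A.2 B.2)
    · obtain ⟨A, hA⟩ := Infinite.exists_subset_card_eq α n
      exact ⟨Quot.mk _ ⟨A, hA⟩⟩

/-- sublists are indiscernible for relations in J -/
def Indisc (ar : I → ℕ) (rel : ∀ i, Set (Fin (ar i) → α)) (J : Finset I) (l : List α) : Prop :=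
  ∀ i ∈ J, ∀ s t : List α, s.Sublist l → t.Sublist l → s.length = t.length →
    ∀ (σ : Fin (ar i) → ℕ) (hs : ∀ j, σ j < s.length) (ht : ∀ j, σ j < t.length),
      ((fun j => s[σ j]'(hs j)) ∈ rel i ↔ (fun j => t[σ j]'(ht j)) ∈ rel i)

theorem exists_Indisc [Infinite α] (ar : I → ℕ) (rel : ∀ i, Set (Fin (ar i) → α))
    (J : Finset I) (n : ℕ) :
    ∃ l : List α, l.Nodup ∧ l.length = n ∧ Indisc ar rel J l := by
  classical
  obtain ⟨l, h1, h2, h3⟩ := exists_indisc (α := α)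
    (K := Σ i : J, (Fin (ar i.1) → Fin n) × Fin (n + 1)) (fun c => c.2.2.1)
    (fun c l => ∃ h : ∀ j, (c.2.1 j).1 < l.length, (fun j => l[(c.2.1 j).1]'(h j)) ∈ rel c.1.1) n
  refine ⟨l, h1, h2, ?_⟩
  intro i hi s t hs ht hst σ hσ hσ'
  have hn := hs.length_le
  have := h3 ⟨⟨i, hi⟩, fun j => ⟨σ j, by have := hσ j; omega⟩, ⟨s.length, by omega⟩⟩ s t hs ht rfl
    hst.symm
  simp only [hσ, hσ', implies_true, exists_true_left] at this
  exact this

theorem exists_Indisc_on [Infinite α] (ar : I → ℕ) (rel : ∀ i, Set (Fin (ar i) → α))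
    (h : ∀ n, profile ar rel n = 1) (J : Finset I) (A : Finset α) :
    ∃ l : List α, l.Nodup ∧ (∀ a, a ∈ l ↔ a ∈ A) ∧ Indisc ar rel J l := by
  classical
  obtain ⟨l, h1, h2, h3⟩ := exists_Indisc ar rel J A.card
  obtain ⟨g, hg, hp⟩ := (profile_eq_one_iff ar rel A.card).1 (h _) l.toFinset A
    (by rw [List.toFinset_card_of_nodup h1, h2]) rfl
  refine ⟨l.map g, ?_, ?_, ?_⟩
  · refine List.Nodup.map_on ?_ h1
    intro x hx y hy hxy
    exact hg.injOn (by simpa using hx) (by simpa using hy) hxy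
  · intro a
    have := hg.image_eq
    rw [List.mem_map, ← Finset.mem_coe, ← this]
    simp
  · intro i hi s t hs ht hst σ hσ hσ'
    obtain ⟨s, hs0, rfl⟩ := List.sublist_map_iff.1 hs
    obtain ⟨t, ht0, rfl⟩ := List.sublist_map_iff.1 ht
    simp only [List.length_map] at hst hσ hσ'
    have a := h3 i hi s t hs0 ht0 hst σ hσ hσ'
    have b := hp i (fun j => s[σ j]'(hσ j)) (fun j => by simpa using hs0.subset (List.getElem_mem (hσ j)))
    have c := hp i (fun j => t[σ j]'(hσ' j)) (fun j => by simpa using ht0.subset (List.getElem_mem (hσ' j)))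
    rw [b, c] at a
    simpa [Function.comp_def] using a

open Classical in
theorem Indisc.apply {ar : I → ℕ} {rel : ∀ i, Set (Fin (ar i) → α)} {J : Finset I} {l : List α}
    (hl : l.Nodup) (h : Indisc ar rel J l) (i : I) (hi : i ∈ J) (x : Fin (ar i) → α) (f : α → α)
    (hx : ∀ j, x j ∈ l) (hfx : ∀ j, f (x j) ∈ l)
    (hlt : ∀ j j', l.idxOf (x j) < l.idxOf (x j') → l.idxOf (f (x j)) < l.idxOf (f (x j'))) :
    x ∈ rel i ↔ f ∘ x ∈ rel i := by
  have hsorted : l.Pairwise (fun a b => l.idxOf a < l.idxOf b) := by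
    rw [List.pairwise_iff_getElem]
    intro a b ha hb hab
    rw [hl.idxOf_getElem, hl.idxOf_getElem]
    exact hab
  set s := l.filter (fun a => ∃ j, x j = a) with hs
  have hsl : s.Sublist l := List.filter_sublist
  have hxs : ∀ j, x j ∈ s := fun j => by simp [hs, hx]
  have hsr : ∀ a ∈ s, ∃ j, x j = a := fun a ha => by simpa using (List.mem_filter.1 ha).2
  have hts : (s.map f).Pairwise (fun a b => l.idxOf a < l.idxOf b) := by
    rw [List.pairwise_map]
    refine (hsorted.sublist hsl).imp_of_mem ?_
    intro a b ha hb hab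
    obtain ⟨j, rfl⟩ := hsr a ha
    obtain ⟨j', rfl⟩ := hsr b hb
    exact hlt j j' hab
  have htn : (s.map f).Nodup := hts.imp (fun hab he => by rw [he] at hab; exact lt_irrefl _ hab)
  have htl : (s.map f).Sublist l := by
    have e : s.map f = l.filter (fun a => a ∈ s.map f) := by
      refine List.Perm.eq_of_pairwise (le := fun a b => l.idxOf a < l.idxOf b) ?_ hts
        (hsorted.sublist List.filter_sublist) ?_
      · intro a b _ _ h1 h2
        exact absurd h1 (not_lt_of_gt h2)
      · refine (List.perm_ext_iff_of_nodup htn (hl.filter _)).2 ?_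
        intro a
        simp only [List.mem_filter, decide_eq_true_eq]
        refine ⟨fun ha => ⟨?_, ha⟩, fun ha => ha.2⟩
        obtain ⟨b, hb, rfl⟩ := List.mem_map.1 ha
        obtain ⟨j, rfl⟩ := hsr b hb
        exact hfx j
    rw [e]
    exact List.filter_sublist
  have hσ : ∀ j, s.idxOf (x j) < s.length := fun j => List.idxOf_lt_length_iff.2 (hxs j)
  have := h i hi s (s.map f) hsl htl (by simp) (fun j => s.idxOf (x j)) hσ (by simpa using hσ)
  simpa [Function.comp_def] using this

open Classical in
theorem chainable_of_monomorphic [Infinite α]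
    (ar : I → ℕ) (rel : ∀ i, Set (Fin (ar i) → α)) (h : ∀ n : ℕ, profile ar rel n = 1) :
    Chainable ar rel := by
  choose L hL1 hL2 hL3 using fun p : Finset α × Finset I => exists_Indisc_on ar rel h p.2 p.1
  let U : Ultrafilter (Finset α × Finset I) := Ultrafilter.of Filter.atTop
  have hU : (U : Filter (Finset α × Finset I)) ≤ Filter.atTop := Ultrafilter.of_le _
  have hge : ∀ q, ∀ᶠ p in (U : Filter (Finset α × Finset I)), q ≤ p := fun q => hU (Filter.eventually_ge_atTop q)
  have hmem : ∀ a : α, ∀ᶠ p in (U : Filter (Finset α × Finset I)), a ∈ L p := by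
    intro a
    filter_upwards [hge ({a}, ∅)] with p hp
    exact (hL2 p a).2 (hp.1 (by simp))
  let le : α → α → Prop := fun a b =>
    ∀ᶠ p in (U : Filter (Finset α × Finset I)), (L p).idxOf a ≤ (L p).idxOf b
  have hiff : ∀ a b, ∀ᶠ p in (U : Filter (Finset α × Finset I)), (le a b ↔ (L p).idxOf a ≤ (L p).idxOf b) := by
    intro a b
    by_cases hab : le a b
    · have h' : ∀ᶠ p in (U : Filter (Finset α × Finset I)), (L p).idxOf a ≤ (L p).idxOf b := hab
      filter_upwards [h'] with p hp
      exact ⟨fun _ => hp, fun _ => hab⟩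
    · have h' : ∀ᶠ p in (U : Filter (Finset α × Finset I)), ¬ (L p).idxOf a ≤ (L p).idxOf b :=
        Ultrafilter.eventually_not.2 hab
      filter_upwards [h'] with p hp
      exact ⟨fun h0 => absurd h0 hab, fun h0 => absurd h0 hp⟩
  refine ⟨le, ?_, ?_⟩
  · refine { refl := ?_, trans := ?_, antisymm := ?_, total := ?_ }
    · intro a
      exact Filter.Eventually.of_forall fun p => le_rfl
    · intro a b c hab hbc
      have hab' : ∀ᶠ p in (U : Filter (Finset α × Finset I)), (L p).idxOf a ≤ (L p).idxOf b := hab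
      have hbc' : ∀ᶠ p in (U : Filter (Finset α × Finset I)), (L p).idxOf b ≤ (L p).idxOf c := hbc
      exact (hab'.and hbc').mono fun p hp => hp.1.trans hp.2
    · intro a b hab hba
      have hab' : ∀ᶠ p in (U : Filter (Finset α × Finset I)), (L p).idxOf a ≤ (L p).idxOf b := hab
      have hba' : ∀ᶠ p in (U : Filter (Finset α × Finset I)), (L p).idxOf b ≤ (L p).idxOf a := hba
      obtain ⟨p, hp1, hp2, hp3⟩ := (hab'.and (hba'.and (hmem a))).exists
      exact (List.idxOf_inj hp3).1 (le_antisymm hp1 hp2)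
    · intro a b
      exact Ultrafilter.eventually_or.1 (Filter.Eventually.of_forall fun p => le_total _ _)
  · intro A B f hf hle i x hx
    have e1 : ∀ᶠ p in (U : Filter (Finset α × Finset I)), ∀ j, x j ∈ L p :=
      Filter.eventually_all.2 fun j => hmem _
    have e2 : ∀ᶠ p in (U : Filter (Finset α × Finset I)), ∀ j, f (x j) ∈ L p :=
      Filter.eventually_all.2 fun j => hmem _
    have e3 : ∀ᶠ p in (U : Filter (Finset α × Finset I)), ∀ j j',
        (le (x j) (x j') ↔ (L p).idxOf (x j) ≤ (L p).idxOf (x j')) :=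
      Filter.eventually_all.2 fun j => Filter.eventually_all.2 fun j' => hiff _ _
    have e4 : ∀ᶠ p in (U : Filter (Finset α × Finset I)), ∀ j j',
        (le (f (x j)) (f (x j')) ↔ (L p).idxOf (f (x j)) ≤ (L p).idxOf (f (x j'))) :=
      Filter.eventually_all.2 fun j => Filter.eventually_all.2 fun j' => hiff _ _
    obtain ⟨p, p1, p2, p3, p4, p5⟩ :=
      (e1.and (e2.and (e3.and (e4.and (hge (∅, {i})))))).exists
    refine (hL3 p).apply (hL1 p) i (p5.2 (by simp)) x f p1 p2 ?_
    intro j j' hjj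
    rw [← not_le, ← p4, ← hle _ (hx _) _ (hx _), p3]
    exact not_le.2 hjj

theorem monomorphic_of_chainable [Infinite α]
    (ar : I → ℕ) (rel : ∀ i, Set (Fin (ar i) → α)) (h : Chainable ar rel) (n : ℕ) :
    profile ar rel n = 1 := by
  classical
  obtain ⟨le, hle, h⟩ := h
  rw [profile_eq_one_iff]
  intro A B hA hB
  letI : LinearOrder α :=
    { le := le
      le_refl := hle.refl
      le_trans := hle.trans
      le_antisymm := hle.antisymm
      le_total := hle.total
      toDecidableLE := Classical.decRel _ }
  let e : A ≃o B := (A.orderIsoOfFin hA).symm.trans (B.orderIsoOfFin hB)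
  let f : α → α := fun x => if hx : x ∈ A then e ⟨x, hx⟩ else x
  have hfe : ∀ x (hx : x ∈ A), f x = e ⟨x, hx⟩ := fun x hx => by simp [f, hx]
  have hbij : Set.BijOn f A B := by
    refine ⟨?_, ?_, ?_⟩
    · intro x hx
      rw [hfe x hx]
      exact (e ⟨x, hx⟩).2
    · intro x hx y hy hxy
      rw [hfe x hx, hfe y hy] at hxy
      simpa using e.injective (Subtype.ext hxy)
    · intro y hy
      refine ⟨e.symm ⟨y, hy⟩, (e.symm ⟨y, hy⟩).2, ?_⟩
      rw [hfe _ (e.symm ⟨y, hy⟩).2]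
      simp
  refine ⟨f, hbij, h _ _ f hbij ?_⟩
  intro a ha b hb
  rw [hfe a ha, hfe b hb]
  exact (e.le_iff_le (x := ⟨a, ha⟩) (y := ⟨b, hb⟩)).symm

/-- **Theorem (Fraïssé).** An infinite relational structure is monomorphic (its profile is
constantly `1`) if and only if it is chainable. -/
theorem monomorphic_iff_chainable [Infinite α]
    (ar : I → ℕ) (rel : ∀ i, Set (Fin (ar i) → α)) :
    (∀ n : ℕ, profile ar rel n = 1) ↔ Chainable ar rel :=
  ⟨chainable_of_monomorphic ar rel, fun h n => monomorphic_of_chainable ar rel h n⟩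
end

section
/- For an infinite relational structure R on a set E, the following properties are equivalent: (i) the profile φ_R is bounded above by some integer; (ii) R has a monomorphic decomposition into finitely many blocks, at most one of which is infinite; (iii) R is almost chainable; (iv) R is almost monomorphic. -/
open scoped Cardinal

universe u v

variable {α : Type u} {I : Type v}

/-- `R` is `F`-monomorphic: any two finite subsets of `E ∖ F` of the same size carry isomorphic
substructures, via an isomorphism whose extension by the identity on `F` is an isomorphism of
the substructures induced on `A ∪ F` and `A' ∪ F`. -/
def FMonomorphic (ar : I → ℕ) (rel : ∀ i, Set (Fin (ar i) → α)) (F : Finset α) : Prop :=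
  ∀ A B : Finset α, Disjoint (↑A : Set α) (↑F : Set α) → Disjoint (↑B : Set α) (↑F : Set α) →
    A.card = B.card →
    ∃ f : α → α, (∀ y ∈ F, f y = y) ∧ IsLocalIso ar rel (↑A : Set α) (↑B : Set α) f ∧
      IsLocalIso ar rel ((↑A : Set α) ∪ ↑F) ((↑B : Set α) ∪ ↑F) f

/-- `R` is `F`-chainable: there is a linear order on `E ∖ F` such that every local isomorphism
of the chain `(E ∖ F, ≤)`, extended by the identity on `F`, is a local isomorphism of `R`. -/
def FChainable (ar : I → ℕ) (rel : ∀ i, Set (Fin (ar i) → α)) (F : Finset α) : Prop :=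
  ∃ le : α → α → Prop, IsLinearOrder α le ∧
    ∀ (A B : Set α) (f : α → α), A ⊆ (↑F : Set α)ᶜ → B ⊆ (↑F : Set α)ᶜ →
      Set.BijOn f A B → (∀ a ∈ A, ∀ b ∈ A, (le a b ↔ le (f a) (f b))) →
      (∀ y ∈ F, f y = y) →
      IsLocalIso ar rel (A ∪ ↑F) (B ∪ ↑F) f


namespace BP

section
open Classical

/-- `f` embeds the substructure on `D` in the whole structure. -/
def Emb (ar : I → ℕ) (rel : ∀ i, Set (Fin (ar i) → α)) (D : Finset α) (f : α → α) : Prop :=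
  Set.InjOn f (↑D : Set α) ∧ PreservesRel ar rel (↑D : Set α) f

/-- embedding of `A ∪ K` that is the identity on `K`. -/
def KEmb (ar : I → ℕ) (rel : ∀ i, Set (Fin (ar i) → α)) (K A : Finset α) (f : α → α) : Prop :=
  Emb ar rel (A ∪ K) f ∧ ∀ x ∈ K, f x = x

variable {ar : I → ℕ} {rel : ∀ i, Set (Fin (ar i) → α)}

theorem Emb.id (D : Finset α) : Emb ar rel D (fun x => x) :=
  ⟨fun _ _ _ _ h => h, fun _ _ _ => Iff.rfl⟩

theorem Emb.mono {D D' : Finset α} {f : α → α} (h : Emb ar rel D f) (hs : D' ⊆ D) :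
    Emb ar rel D' f :=
  ⟨h.1.mono (by exact_mod_cast hs), fun i x hx => h.2 i x (fun j => hs (hx j))⟩

theorem Emb.comp {D D' : Finset α} {f g : α → α} (h : Emb ar rel D f) (h' : Emb ar rel D' g)
    (hs : ∀ x ∈ D, f x ∈ D') : Emb ar rel D (fun x => g (f x)) := by
  refine ⟨fun x hx y hy e => h.1 hx hy (h'.1 (hs x hx) (hs y hy) e), fun i x hx => ?_⟩
  rw [h.2 i x hx, h'.2 i (f ∘ x) (fun j => hs _ (hx j))]
  rfl

theorem Emb.congr {D : Finset α} {f g : α → α} (h : Emb ar rel D f)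
    (hs : ∀ x ∈ D, f x = g x) : Emb ar rel D g := by
  refine ⟨fun x hx y hy e => h.1 hx hy (by rw [hs x hx, hs y hy, e]), fun i x hx => ?_⟩
  rw [h.2 i x hx]
  have : f ∘ x = g ∘ x := funext fun j => hs _ (hx j)
  rw [this]

theorem Emb.inv {D : Finset α} {f : α → α} (h : Emb ar rel D f) :
    ∃ g, Emb ar rel (D.image f) g ∧ ∀ x ∈ D, g (f x) = x := by
  by_cases hD : D.Nonempty
  · have : Nonempty α := ⟨hD.choose⟩
    have hl : ∀ x ∈ D, Function.invFunOn f (↑D : Set α) (f x) = x :=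
      fun x hx => h.1.leftInvOn_invFunOn hx
    refine ⟨Function.invFunOn f (↑D : Set α), ⟨?_, ?_⟩, hl⟩
    · intro x hx y hy e
      simp only [Finset.coe_image, Set.mem_image] at hx hy
      obtain ⟨x, hx, rfl⟩ := hx
      obtain ⟨y, hy, rfl⟩ := hy
      rw [hl x hx, hl y hy] at e
      rw [e]
    · intro i x hx
      simp only [Finset.coe_image, Set.mem_image] at hx
      choose y hy hy' using hx
      have hxy : x = f ∘ y := funext fun j => (hy' j).symm
      subst hxy
      rw [← h.2 i y hy]
      have : (Function.invFunOn f (↑D : Set α)) ∘ (f ∘ y) = y := funext fun j => hl _ (hy j)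
      rw [this]
  · rw [Finset.not_nonempty_iff_eq_empty] at hD
    subst hD
    exact ⟨fun x => x, Emb.id _, by simp⟩

theorem Emb.isoOn {A B : Finset α} {f : α → α} (h : Emb ar rel A f) (e : A.image f = B) :
    IsLocalIso ar rel (↑A : Set α) (↑B : Set α) f := by
  subst e
  refine ⟨?_, h.2⟩
  rw [Finset.coe_image]
  exact h.1.bijOn_image

theorem emb_of_iso {A B : Finset α} {f : α → α}
    (h : IsLocalIso ar rel (↑A : Set α) (↑B : Set α) f) :
    Emb ar rel A f ∧ A.image f = B := by
  refine ⟨⟨h.1.injOn, h.2⟩, ?_⟩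
  apply Finset.coe_injective
  rw [Finset.coe_image, h.1.image_eq]

theorem KEmb.comp {K A B : Finset α} {f g : α → α} (h : KEmb ar rel K A f)
    (h' : KEmb ar rel K B g) (hs : ∀ x ∈ A, f x ∈ B ∪ K) :
    KEmb ar rel K A (fun x => g (f x)) := by
  refine ⟨h.1.comp h'.1 ?_, fun x hx => by simp only [h.2 x hx, h'.2 x hx]⟩
  intro x hx
  rcases Finset.mem_union.1 hx with hx | hx
  · exact hs x hx
  · rw [h.2 x hx]; exact Finset.mem_union_right _ hx

theorem KEmb.mono {K A B : Finset α} {f : α → α} (h : KEmb ar rel K A f) (hs : B ⊆ A) :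
    KEmb ar rel K B f := ⟨h.1.mono (Finset.union_subset_union_left hs), h.2⟩

theorem KEmb.inv {K A : Finset α} {f : α → α} (h : KEmb ar rel K A f) :
    ∃ g, KEmb ar rel K (A.image f) g ∧ ∀ x ∈ A, g (f x) = x := by
  obtain ⟨g, hg, hl⟩ := h.1.inv
  have hK : K.image f = K := by
    ext y
    simp only [Finset.mem_image]
    constructor
    · rintro ⟨x, hx, rfl⟩; rwa [h.2 x hx]
    · intro hy; exact ⟨y, hy, h.2 y hy⟩
  refine ⟨g, ⟨?_, ?_⟩, fun x hx => hl x (Finset.mem_union_left _ hx)⟩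
  · rwa [Finset.image_union, hK] at hg
  · intro x hx
    have := hl x (Finset.mem_union_right _ hx)
    rwa [h.2 x hx] at this

theorem KEmb.notMem {K A : Finset α} {f : α → α} (h : KEmb ar rel K A f) {x : α} (hx : x ∈ A)
    (hxK : x ∉ K) : f x ∉ K := by
  intro hf
  apply hxK
  have := h.1.1 (Finset.mem_coe.2 (Finset.mem_union_left _ hx))
    (Finset.mem_coe.2 (Finset.mem_union_right _ hf)) (h.2 _ hf).symm
  rwa [this]

/-- pigeonhole principle for the profile. -/
theorem pigeon {m n : ℕ} (hm : profile ar rel n ≤ (m : Cardinal)) (D : ℕ → Finset α)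
    (hD : ∀ i ≤ m, (D i).card = n) :
    ∃ i j, i < j ∧ j ≤ m ∧ ∃ f, Emb ar rel (D j) f ∧ (D j).image f = D i := by
  have heq : Equivalence (fun A B : {s : Finset α // s.card = n} =>
      IsoOn ar rel (↑A.1 : Set α) (↑B.1 : Set α)) := by
    refine ⟨fun A => ⟨_, (Emb.id A.1).isoOn (by simp)⟩, ?_, ?_⟩
    · rintro ⟨A, hA⟩ ⟨B, hB⟩ ⟨f, hf⟩
      obtain ⟨h1, h2⟩ := emb_of_iso hf
      obtain ⟨g, hg, hl⟩ := h1.inv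
      dsimp only at *
      subst h2
      refine ⟨g, hg.isoOn ?_⟩
      ext y
      simp only [Finset.mem_image]
      constructor
      · rintro ⟨_, ⟨x, hx, rfl⟩, rfl⟩
        rwa [hl x hx]
      · intro hy
        exact ⟨f y, ⟨y, hy, rfl⟩, hl y hy⟩
    · rintro ⟨A, hA⟩ ⟨B, hB⟩ ⟨C, hC⟩ ⟨f, hf⟩ ⟨g, hg⟩
      obtain ⟨h1, h2⟩ := emb_of_iso hf
      obtain ⟨h3, h4⟩ := emb_of_iso hg
      dsimp only at *
      refine ⟨_, (h1.comp h3 fun x hx => by rw [← h2]; exact Finset.mem_image_of_mem _ hx).isoOn ?_⟩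
      rw [← h4, ← h2, Finset.image_image]; rfl
  by_contra hcon
  push Not at hcon
  have hinj : Function.Injective (fun i : ULift.{u} (Fin (m+1)) =>
      (Quot.mk _ ⟨D i.down.1, hD _ (by omega)⟩ : Quot fun A B : {s : Finset α // s.card = n} =>
      IsoOn ar rel (↑A.1 : Set α) (↑B.1 : Set α))) := by
    have key : ∀ i j : Fin (m+1), i < j → ¬ IsoOn ar rel (↑(D j.1) : Set α) (↑(D i.1) : Set α) := by
      rintro i j hij ⟨f, hf⟩
      obtain ⟨h1, h2⟩ := emb_of_iso hf
      exact hcon i.1 j.1 hij (by omega) f h1 h2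
    rintro ⟨i⟩ ⟨j⟩ hij
    have h := (heq.quot_mk_eq_iff _ _).1 hij
    have h' := heq.symm h
    dsimp only at h h'
    rcases lt_trichotomy i j with hl | hl | hl
    · exact absurd h' (key i j hl)
    · rw [hl]
    · exact absurd h (key j i hl)
  have h1 := Cardinal.mk_le_of_injective hinj
  have h2 := h1.trans hm
  simp only [Cardinal.mk_uLift, Cardinal.mk_fin, Cardinal.lift_natCast, Nat.cast_le] at h2
  omega

/-- The kernel. -/
def Ker (ar : I → ℕ) (rel : ∀ i, Set (Fin (ar i) → α)) : Set α :=
  {x | ∃ A : Finset α, ∀ f, Emb ar rel A f → x ∈ A.image f}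

theorem ker_finite [Infinite α] {m : ℕ} (hm : ∀ n, profile ar rel n ≤ (m : Cardinal)) :
    (Ker ar rel).Finite := by
  by_contra hinf
  have hinf : (Ker ar rel).Infinite := hinf
  have h1 : ∀ B : Finset α, ∃ x ∈ Ker ar rel, x ∉ B := fun B => hinf.exists_notMem_finset B
  choose nx hnx hnx' using h1
  have h2 : ∀ B : Finset α, ∃ A : Finset α, ∀ f, Emb ar rel A f → nx B ∈ A.image f :=
    fun B => hnx B
  choose W hW using h2
  let B : ℕ → Finset α := fun k => Nat.rec (motive := fun _ => Finset α) ∅ (fun _ B => B ∪ W B) k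
  have hB : ∀ k, B (k+1) = B k ∪ W (B k) := fun k => rfl
  have hmono : Monotone B := monotone_nat_of_le_succ fun k => by
    rw [hB]; exact Finset.subset_union_left
  have h3 : ∀ i, ∃ D : Finset α, i ≤ m → B i ⊆ D ∧ nx (B i) ∉ D ∧ D.card = (B m).card := by
    intro i
    by_cases hi : i ≤ m
    · have hc : ({nx (B i)}ᶜ : Set α).Infinite := (Set.finite_singleton _).infinite_compl
      have hsub : (↑(B i) : Set α) ⊆ {nx (B i)}ᶜ := by
        intro x hx h
        rw [Set.mem_singleton_iff] at h
        rw [h] at hx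
        exact hnx' (B i) (Finset.mem_coe.1 hx)
      obtain ⟨D, hD1, hD2, hD3⟩ := hc.exists_superset_ncard_eq (s := (↑(B i) : Set α))
        hsub (Finset.finite_toSet _) (k := (B m).card)
        (by rw [Set.ncard_coe_finset]; exact Finset.card_le_card (hmono hi))
      by_cases hfin : D.Finite
      · lift D to Finset α using hfin
        refine ⟨D, fun _ => ⟨by exact_mod_cast hD1, ?_, by rwa [Set.ncard_coe_finset] at hD3⟩⟩
        intro h
        exact hD2 h rfl
      · have hz := Set.Infinite.ncard hfin
        rw [hz] at hD3
        have h0 : B m = ∅ := Finset.card_eq_zero.1 hD3.symm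
        refine ⟨∅, fun _ => ⟨?_, by simp, by simp [h0]⟩⟩
        rw [← h0]; exact hmono hi
    · exact ⟨∅, fun h => absurd h hi⟩
  choose D hD using h3
  obtain ⟨i, j, hij, hj, f, hf, hfi⟩ := pigeon (hm _) D (fun i hi => (hD i hi).2.2)
  apply (hD i (by omega)).2.1
  have hsub : W (B i) ⊆ D j := by
    refine Finset.Subset.trans ?_ (hD j hj).1
    refine Finset.Subset.trans ?_ (hmono (show i + 1 ≤ j from hij))
    rw [hB]; exact Finset.subset_union_right
  have := hW (B i) f (hf.mono hsub)
  rw [← hfi]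
  exact Finset.image_subset_image hsub this


theorem setwise {K : Finset α} (hK : ∀ x, x ∈ K ↔ x ∈ Ker ar rel) :
    ∃ W : Finset α, K ⊆ W ∧ ∀ f, Emb ar rel W f → K.image f = K := by
  have h1 : ∀ x, ∃ A : Finset α, x ∈ K → ∀ f, Emb ar rel A f → x ∈ A.image f := by
    intro x
    by_cases hx : x ∈ K
    · obtain ⟨A, hA⟩ := (hK x).1 hx
      exact ⟨A, fun _ => hA⟩
    · exact ⟨∅, fun h => absurd h hx⟩
  choose A hA using h1
  let W : Finset α := K ∪ K.biUnion A
  have hW : ∀ f, Emb ar rel W f → K ⊆ W.image f := by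
    intro f hf x hx
    have hs : A x ⊆ W := (Finset.subset_biUnion_of_mem A hx).trans Finset.subset_union_right
    exact Finset.image_subset_image hs (hA x hx f (hf.mono hs))
  have h2 : ∀ l, ∃ g, l ∉ K → Emb ar rel W g ∧ l ∉ W.image g := by
    intro l
    by_cases hl : l ∈ K
    · exact ⟨fun x => x, fun h => absurd hl h⟩
    · have : ¬ l ∈ Ker ar rel := fun h => hl ((hK l).2 h)
      simp only [Ker, Set.mem_ofPred_eq, not_exists, not_forall] at this
      obtain ⟨g, hg, hg'⟩ := this W
      exact ⟨g, fun _ => ⟨hg, hg'⟩⟩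
  choose g hg using h2
  refine ⟨W ∪ W.biUnion (fun l => W.image (g l)),
    Finset.subset_union_left.trans Finset.subset_union_left, fun f hf => ?_⟩
  have hfW := hf.mono Finset.subset_union_left
  have hsub : K ⊆ K.image f := by
    intro y hy
    obtain ⟨l, hl, rfl⟩ := Finset.mem_image.1 (hW f hfW hy)
    by_cases hlK : l ∈ K
    · exact Finset.mem_image_of_mem _ hlK
    · exfalso
      obtain ⟨hg1, hg2⟩ := hg l hlK
      have hsub : ∀ x ∈ W, g l x ∈ W ∪ W.biUnion (fun l => W.image (g l)) := fun x hx =>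
        Finset.mem_union_right _ (Finset.mem_biUnion.2 ⟨l, hl, Finset.mem_image_of_mem _ hx⟩)
      obtain ⟨z, hz, hz'⟩ := Finset.mem_image.1 (hW _ (hg1.comp hf hsub) hy)
      have := hf.1 (hsub z hz) (Finset.mem_coe.2 (Finset.mem_union_left _ hl)) hz'
      exact hg2 (Finset.mem_image.2 ⟨z, hz, this⟩)
  exact (Finset.eq_of_subset_of_card_le hsub Finset.card_image_le).symm

theorem keyLemma {K : Finset α} (hK : ∀ x, x ∈ K ↔ x ∈ Ker ar rel) (D : Finset α) :
    ∃ D' : Finset α, D ⊆ D' ∧ K ⊆ D' ∧ ∀ h, Emb ar rel D' h → K.image h = K ∧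
      ∃ f, Emb ar rel D f ∧ (∀ x ∈ D, f x ∈ D') ∧ ∀ x ∈ K, h (f x) = x := by
  obtain ⟨W, hKW, hW⟩ := setwise hK
  let P : Finset α → Set (Equiv.Perm K) := fun D =>
    {π | ∃ f, Emb ar rel D f ∧ ∀ x : K, f x = π x}
  have hPanti : ∀ D D' : Finset α, D ⊆ D' → P D' ⊆ P D := by
    rintro D D' hs π ⟨f, hf, hf'⟩
    exact ⟨f, hf.mono hs, hf'⟩
  obtain ⟨D0, hD0⟩ : ∃ D0, ∀ D, (P D0).ncard ≤ (P D).ncard := by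
    obtain ⟨D0, -, h⟩ := exists_minimalFor_of_wellFoundedLT (fun _ : Finset α => True)
      (fun D => (P D).ncard) ⟨∅, trivial⟩
    exact ⟨D0, fun D => (le_total _ _).elim (fun h' => h') (fun h' => h trivial h')⟩
  have hP0 : ∀ D, P D0 ⊆ P D := by
    intro D
    have h1 : P (D ∪ D0) = P D0 :=
      Set.eq_of_subset_of_ncard_le (hPanti _ _ Finset.subset_union_right) (hD0 _)
    rw [← h1]
    exact hPanti _ _ Finset.subset_union_left
  have hmul : ∀ π ∈ P D0, ∀ ρ ∈ P D0, π * ρ ∈ P D0 := by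
    rintro π hπ ρ ⟨f, hf, hf'⟩
    obtain ⟨h, hh, hh'⟩ := hP0 (D0.image f) hπ
    refine ⟨_, hf.comp hh (fun x hx => Finset.mem_image_of_mem _ hx), fun x => ?_⟩
    rw [hf', hh']
    rfl
  have hone : 1 ∈ P D0 := ⟨_, Emb.id _, fun x => rfl⟩
  have hpow : ∀ π ∈ P D0, ∀ n : ℕ, π ^ n ∈ P D0 := by
    intro π hπ n
    induction n with
    | zero => simpa using hone
    | succ k ih => rw [pow_succ]; exact hmul _ ih _ hπ
  have hinv : ∀ π ∈ P D0, π⁻¹ ∈ P D0 := by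
    intro π hπ
    have h1 : π ^ (orderOf π - 1) * π = 1 := by
      rw [← pow_succ, Nat.sub_add_cancel (orderOf_pos π), pow_orderOf_eq_one]
    have h2 : π⁻¹ = π ^ (orderOf π - 1) := inv_eq_of_mul_eq_one_left h1
    rw [h2]
    exact hpow π hπ _
  have h1 : ∀ π : Equiv.Perm K, ∃ f, π ∈ P D0 → Emb ar rel D f ∧ ∀ x : K, f x = (π⁻¹ x : K) := by
    intro π
    by_cases hπ : π ∈ P D0
    · obtain ⟨f, hf⟩ := hP0 D (hinv π hπ)
      exact ⟨f, fun _ => hf⟩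
    · exact ⟨fun x => x, fun h => absurd h hπ⟩
  choose F hF using h1
  refine ⟨(D ∪ D0 ∪ W) ∪ Finset.univ.biUnion (fun π => D.image (F π)), ?_, ?_, ?_⟩
  · exact Finset.subset_union_left.trans (Finset.subset_union_left.trans Finset.subset_union_left)
  · exact hKW.trans (Finset.subset_union_right.trans Finset.subset_union_left)
  intro h hh
  have hKim := hW h (hh.mono (Finset.subset_union_right.trans Finset.subset_union_left))
  refine ⟨hKim, ?_⟩
  have hmem : ∀ x ∈ K, h x ∈ K := fun x hx => by
    have := Finset.mem_image_of_mem h hx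
    rwa [hKim] at this
  have hKD : K ⊆ (D ∪ D0 ∪ W) ∪ Finset.univ.biUnion (fun π => D.image (F π)) :=
    hKW.trans (Finset.subset_union_right.trans Finset.subset_union_left)
  let q : K → K := fun x => ⟨h x, hmem x x.2⟩
  have hq : Function.Injective q := by
    intro x y hxy
    have : h x = h y := congrArg Subtype.val hxy
    exact Subtype.ext (hh.1 (hKD x.2) (hKD y.2) this)
  let π : Equiv.Perm K := Equiv.ofBijective q (Finite.injective_iff_bijective.1 hq)
  have hπ : π ∈ P D0 :=
    ⟨h, hh.mono ((Finset.subset_union_right.trans Finset.subset_union_left).trans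
      Finset.subset_union_left), fun x => rfl⟩
  refine ⟨F π, (hF π hπ).1, fun x hx => Finset.mem_union_right _ (Finset.mem_biUnion.2
    ⟨π, Finset.mem_univ _, Finset.mem_image_of_mem _ hx⟩), fun x hx => ?_⟩
  rw [(hF π hπ).2 ⟨x, hx⟩]
  have : h ((π⁻¹ ⟨x, hx⟩ : K) : α) = (π (π⁻¹ ⟨x, hx⟩) : K) := rfl
  rw [this, ← Equiv.Perm.mul_apply, mul_inv_cancel]
  rfl

theorem tree {K A : Finset α} {τ : ℕ}
    (H : ∀ G : Finset α, Disjoint G K → G.card < τ →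
      ∃ f, KEmb ar rel K A f ∧ ∀ x ∈ A, f x ∉ G) (t : ℕ) :
    ∀ G : Finset α, Disjoint G K → G.card + t < τ →
      ∃ B : Finset α, ∀ T : Finset α, T.card ≤ t → Disjoint T K →
        ∃ f, KEmb ar rel K A f ∧ ∀ x ∈ A, f x ∈ B ∧ f x ∉ G ∧ f x ∉ T := by
  induction t with
  | zero =>
    intro G hG hc
    obtain ⟨f, hf, hf'⟩ := H G hG hc
    refine ⟨A.image f, fun T hT _ => ⟨f, hf, fun x hx => ⟨Finset.mem_image_of_mem _ hx, hf' x hx, ?_⟩⟩⟩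
    have : T = ∅ := by simpa using hT
    simp [this]
  | succ t ih =>
    intro G hG hc
    obtain ⟨f, hf, hf'⟩ := H G hG (by omega)
    have h1 : ∀ a, ∃ B : Finset α, a ∉ K → ∀ T : Finset α, T.card ≤ t → Disjoint T K →
        ∃ f, KEmb ar rel K A f ∧ ∀ x ∈ A, f x ∈ B ∧ f x ∉ insert a G ∧ f x ∉ T := by
      intro a
      by_cases ha : a ∈ K
      · exact ⟨∅, fun h => absurd ha h⟩
      · obtain ⟨B, hB⟩ := ih (insert a G) (Finset.disjoint_insert_left.2 ⟨ha, hG⟩)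
          (by have := Finset.card_insert_le a G; omega)
        exact ⟨B, fun _ => hB⟩
    choose B hB using h1
    refine ⟨A.image f ∪ (A.image f).biUnion B, fun T hT hTK => ?_⟩
    by_cases hd : ∃ x ∈ A, f x ∈ T
    · obtain ⟨x, hx, hxT⟩ := hd
      obtain ⟨g, hg, hg'⟩ := hB (f x) (Finset.disjoint_left.1 hTK hxT) (T.erase (f x))
        (by rw [Finset.card_erase_of_mem hxT]; omega)
        (Finset.disjoint_of_subset_left (Finset.erase_subset _ _) hTK)
      refine ⟨g, hg, fun y hy => ⟨?_, ?_, ?_⟩⟩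
      · exact Finset.mem_union_right _ (Finset.mem_biUnion.2
          ⟨f x, Finset.mem_image_of_mem _ hx, (hg' y hy).1⟩)
      · exact fun h => (hg' y hy).2.1 (Finset.mem_insert_of_mem h)
      · intro h
        refine (hg' y hy).2.2 (Finset.mem_erase.2 ⟨?_, h⟩)
        intro e
        exact (hg' y hy).2.1 (by rw [e]; exact Finset.mem_insert_self _ _)
    · push Not at hd
      exact ⟨f, hf, fun x hx => ⟨Finset.mem_union_left _ (Finset.mem_image_of_mem _ hx),
        hf' x hx, hd x hx⟩⟩

theorem avoid {K : Finset α} (hK : ∀ x, x ∈ K ↔ x ∈ Ker ar rel) (A : Finset α) (τ : ℕ) :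
    ∀ G : Finset α, G.card = τ → Disjoint G K →
      ∃ f, KEmb ar rel K A f ∧ ∀ x ∈ A, f x ∉ G := by
  induction τ using Nat.strong_induction_on with
  | _ τ ih =>
  intro G hGc hG
  by_contra hbad
  have hne : G.Nonempty := by
    by_contra h
    rw [Finset.not_nonempty_iff_eq_empty] at h
    exact hbad ⟨_, ⟨Emb.id _, fun _ _ => rfl⟩, by simp [h]⟩
  have hpos : 0 < τ := hGc ▸ hne.card_pos
  obtain ⟨B, hB⟩ := tree (ar := ar) (rel := rel) (K := K) (A := A) (τ := τ)
    (fun G hG hc => ih G.card hc G rfl hG) (τ - 1) ∅ (by simp) (by simp; omega)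
  obtain ⟨D', hD, hKD, hD'⟩ := keyLemma hK (B ∪ K)
  obtain ⟨g, hg⟩ := hne
  refine Finset.disjoint_left.1 hG hg ((hK g).2 ⟨D', fun h hh => ?_⟩)
  by_contra hgn
  obtain ⟨-, f, hf, hfD, hfK⟩ := hD' h hh
  have hkemb : KEmb ar rel K B (fun x => h (f x)) := ⟨hf.comp hh hfD, hfK⟩
  let T := (B \ K).filter (fun b => h (f b) ∈ G)
  have hTc : T.card ≤ τ - 1 := by
    have h1 : T.card ≤ (G.erase g).card := by
      apply Finset.card_le_card_of_injOn (fun x => h (f x))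
      · intro x hx
        have hx := Finset.mem_filter.1 (Finset.mem_coe.1 hx)
        refine Finset.mem_coe.2 (Finset.mem_erase.2 ⟨?_, hx.2⟩)
        rintro rfl
        exact hgn (Finset.mem_image_of_mem _ (hfD x
          (Finset.mem_union_left _ (Finset.mem_sdiff.1 hx.1).1)))
      · refine hkemb.1.1.mono ?_
        intro x hx
        have hx := Finset.mem_filter.1 (Finset.mem_coe.1 hx)
        exact Finset.mem_coe.2 (Finset.mem_union_left _ (Finset.mem_sdiff.1 hx.1).1)
    rwa [Finset.card_erase_of_mem hg, hGc] at h1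
  have hTK : Disjoint T K := Finset.disjoint_left.2 fun x hx =>
    (Finset.mem_sdiff.1 (Finset.mem_filter.1 hx).1).2
  obtain ⟨e, he, he'⟩ := hB T hTc hTK
  refine hbad ⟨_, he.comp hkemb (fun x hx => Finset.mem_union_left _ (he' x hx).1), fun x hx hxG => ?_⟩
  by_cases hxK : e x ∈ K
  · rw [hfK _ hxK] at hxG
    exact Finset.disjoint_left.1 hG hxG hxK
  · exact (he' x hx).2.2 (Finset.mem_filter.2 ⟨Finset.mem_sdiff.2 ⟨(he' x hx).1, hxK⟩, hxG⟩)


/-- iterated ultrafilter limit of a property of lists. -/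
def lim [Infinite α] (χ : List α → Prop) : ℕ → List α → Prop
  | 0, l => χ l
  | j + 1, l => ∀ᶠ x in (Filter.hyperfilter α : Filter α), lim χ j (x :: l)

theorem lim_ev [Infinite α] (χ : List α → Prop) (j : ℕ) (l : List α) :
    ∀ᶠ x in (Filter.hyperfilter α : Filter α), (lim χ j (x :: l) ↔ lim χ (j + 1) l) := by
  by_cases h : lim χ (j + 1) l
  · have h' : ∀ᶠ x in (Filter.hyperfilter α : Filter α), lim χ j (x :: l) := h
    filter_upwards [h'] with x hx
    simp only [hx, h]
  · have h' : ¬ ∀ᶠ x in (Filter.hyperfilter α : Filter α), lim χ j (x :: l) := h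
    rw [← Ultrafilter.eventually_not] at h'
    filter_upwards [h'] with x hx
    simp only [hx, h]

theorem ramsey [Infinite α] {ι : Type*} (K : Finset α) (s : Finset ι) (χ : ι → List α → Prop)
    (N M : ℕ) : ∃ L : List α, L.Nodup ∧ L.length = M ∧ (∀ x ∈ L, x ∉ K) ∧
      ∀ l, l.Sublist L → ∀ i ∈ s, ∀ j ≤ N, (lim (χ i) j l ↔ lim (χ i) (j + l.length) []) := by
  suffices H : ∀ M, ∀ N, ∃ L : List α, L.Nodup ∧ L.length = M ∧ (∀ x ∈ L, x ∉ K) ∧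
      ∀ l, l.Sublist L → ∀ i ∈ s, ∀ j, j + l.length ≤ N →
        (lim (χ i) j l ↔ lim (χ i) (j + l.length) []) by
    obtain ⟨L, h1, h2, h3, h4⟩ := H M (N + M)
    exact ⟨L, h1, h2, h3, fun l hl i hi j hj => h4 l hl i hi j (by
      have := hl.length_le; omega)⟩
  intro M
  induction M with
  | zero =>
    intro N
    refine ⟨[], List.nodup_nil, rfl, by simp, ?_⟩
    intro l hl i hi j hj
    have : l = [] := List.sublist_nil.1 hl
    subst this
    simp
  | succ M ih =>
    intro N
    obtain ⟨L, h1, h2, h3, h4⟩ := ih N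
    have e1 : ∀ᶠ x in (Filter.hyperfilter α : Filter α), x ∉ K ∪ L.toFinset :=
      Filter.hyperfilter_le_cofinite (Finset.eventually_cofinite_notMem _)
    have e2 : ∀ᶠ x in (Filter.hyperfilter α : Filter α), ∀ l ∈ L.sublists.toFinset,
        ∀ i ∈ s, ∀ j ∈ Finset.range N, (lim (χ i) j (x :: l) ↔ lim (χ i) (j + 1) l) := by
      rw [Filter.eventually_all_finset]
      intro l _
      rw [Filter.eventually_all_finset]
      intro i _
      rw [Filter.eventually_all_finset]
      intro j _
      exact lim_ev _ _ _
    obtain ⟨x, hx1, hx2⟩ := (e1.and e2).exists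
    simp only [Finset.mem_union, List.mem_toFinset, not_or] at hx1
    refine ⟨x :: L, List.nodup_cons.2 ⟨hx1.2, h1⟩, by simp [h2], ?_, ?_⟩
    · intro y hy
      rcases List.mem_cons.1 hy with rfl | hy
      · exact hx1.1
      · exact h3 y hy
    · intro l hl i hi j hj
      rcases List.sublist_cons_iff.1 hl with hl | ⟨r, rfl, hr⟩
      · exact h4 l hl i hi j hj
      · simp only [List.length_cons] at hj ⊢
        rw [hx2 r (by simpa using hr) i hi j (Finset.mem_range.2 (by omega)),
          h4 r hr i hi (j + 1) (by omega)]
        have : j + 1 + r.length = j + (r.length + 1) := by omega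
        rw [this]

theorem pack [Infinite α] {m : ℕ} (hm : ∀ n, profile ar rel n ≤ (m : Cardinal))
    {K : Finset α} (hK : ∀ x, x ∈ K ↔ x ∈ Ker ar rel) (S : Finset α) (hSK : Disjoint S K)
    (hX : ∀ N, ∃ X : Finset α, X.card = N ∧ Disjoint X K ∧
      ∀ f, KEmb ar rel K S f → ¬ ∀ x ∈ S, f x ∈ X) : False := by
  obtain ⟨D, hSD, hKD, hD⟩ := keyLemma hK (S ∪ K)
  have hSD' : S ⊆ D := Finset.subset_union_left.trans hSD
  let q := (D \ K).card
  let J : ℕ → ℕ := fun i => Nat.rec (motive := fun _ => ℕ) 0 (fun _ j => q * j + j + 1) i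
  have hJ : ∀ i, J (i + 1) = q * J i + J i + 1 := fun i => rfl
  have hJm : Monotone J := monotone_nat_of_le_succ fun i => by rw [hJ]; omega
  obtain ⟨X, hXc, hXK, hXS⟩ := hX (q * J m)
  have h1 : ∀ G : Finset α, ∃ f, KEmb ar rel K D f ∧ ∀ x ∈ D, f x ∉ G \ K := fun G =>
    avoid hK D (G \ K).card (G \ K) rfl Finset.sdiff_disjoint
  choose F hF hF' using h1
  let B : ℕ → Finset α := fun t => Nat.rec (motive := fun _ => Finset α) X (fun _ B => B ∪ (D \ K).image (F B)) t
  have hB : ∀ t, B (t + 1) = B t ∪ (D \ K).image (F (B t)) := fun t => rfl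
  have hBm : Monotone B := monotone_nat_of_le_succ fun t => by
    rw [hB]; exact Finset.subset_union_left
  let C : ℕ → Finset α := fun t => (D \ K).image (F (B t))
  have hCB : ∀ t, C t ⊆ B (t + 1) := fun t => by rw [hB]; exact Finset.subset_union_right
  have hCK : ∀ t, ∀ x ∈ C t, x ∉ K := by
    intro t x hx
    obtain ⟨y, hy, rfl⟩ := Finset.mem_image.1 hx
    obtain ⟨hy, hyK⟩ := Finset.mem_sdiff.1 hy
    exact (hF (B t)).notMem hy hyK
  have hCd : ∀ t, Disjoint (C t) (B t) := by
    intro t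
    refine Finset.disjoint_left.2 fun x hx hxB => ?_
    have hxK := hCK t x hx
    obtain ⟨y, hy, rfl⟩ := Finset.mem_image.1 hx
    exact hF' (B t) y (Finset.mem_sdiff.1 hy).1 (Finset.mem_sdiff.2 ⟨hxB, hxK⟩)
  have hCc : ∀ t, (C t).card = q := by
    intro t
    apply Finset.card_image_of_injOn
    refine (hF (B t)).1.1.mono ?_
    intro x hx
    exact Finset.mem_coe.2 (Finset.mem_union_left _ (Finset.mem_sdiff.1 (Finset.mem_coe.1 hx)).1)
  have hCX : ∀ t, Disjoint (C t) X := fun t =>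
    Finset.disjoint_of_subset_right (hBm (Nat.zero_le t)) (hCd t)
  have hClt : ∀ t t', t < t' → Disjoint (C t) (C t') := fun t t' h =>
    (Finset.disjoint_of_subset_right ((hCB t).trans (hBm h)) (hCd t')).symm
  have hCC : ∀ t t', t ≠ t' → Disjoint (C t) (C t') := fun t t' h =>
    (lt_or_gt_of_ne h).elim (hClt t t') (fun h => (hClt t' t h).symm)
  let U : ℕ → Finset α := fun j => (Finset.range j).biUnion C
  have hUc : ∀ j, (U j).card = j * q := by
    intro j
    rw [Finset.card_biUnion (fun x _ y _ h => hCC x y h)]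
    simp [hCc]
  have h2 : ∀ j, ∃ Y : Finset α, Y ⊆ X ∧ (j ≤ J m → Y.card = q * J m - j * q) := by
    intro j
    obtain ⟨Y, hY, hYc⟩ := Finset.exists_subset_card_eq (s := X) (n := q * J m - j * q)
      (by rw [hXc]; omega)
    exact ⟨Y, hY, fun _ => hYc⟩
  choose Y hYX hYc using h2
  have hUK : ∀ j, Disjoint (U j) K := fun j => by
    rw [Finset.disjoint_biUnion_left]
    exact fun t _ => Finset.disjoint_left.2 (hCK t)
  have hUX : ∀ j, Disjoint (U j) X := fun j => by
    rw [Finset.disjoint_biUnion_left]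
    exact fun t _ => hCX t
  obtain ⟨i, i', hii, hi', h, hh, him⟩ := pigeon (hm (K.card + q * J m))
    (fun i => K ∪ (U (J i) ∪ Y (J i))) (by
      intro i hi
      have hle := hJm hi
      rw [Finset.card_union_of_disjoint, Finset.card_union_of_disjoint, hUc, hYc _ hle]
      · have : J i * q ≤ q * J m := by rw [mul_comm q]; exact Nat.mul_le_mul_right _ hle
        omega
      · exact Finset.disjoint_of_subset_right (hYX _) (hUX _)
      · rw [Finset.disjoint_union_right]
        exact ⟨(hUK _).symm, (Finset.disjoint_of_subset_left (hYX _) hXK).symm⟩)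
  have hJlt : J (i + 1) ≤ J i' := hJm hii
  have hmemA : ∀ t < J i', ∀ x ∈ D, F (B t) x ∈ K ∪ (U (J i') ∪ Y (J i')) := by
    intro t ht x hx
    by_cases hxK : x ∈ K
    · rw [(hF (B t)).2 x hxK]; exact Finset.mem_union_left _ hxK
    · apply Finset.mem_union_right
      apply Finset.mem_union_left
      exact Finset.mem_biUnion.2 ⟨t, Finset.mem_range.2 ht,
        Finset.mem_image_of_mem _ (Finset.mem_sdiff.2 ⟨hx, hxK⟩)⟩
  have hz : ∀ t : ℕ, ∃ z, t < J i' → z ∈ C t ∧ h z ∈ U (J i) := by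
    intro t
    rcases Classical.em (t < J i') with ht | ht
    swap
    · exact ⟨Classical.arbitrary α, fun h => absurd h ht⟩
    have hemb : Emb ar rel D (fun x => h (F (B t) x)) :=
      ((hF (B t)).1.mono Finset.subset_union_left).comp hh (hmemA t ht)
    obtain ⟨hKK, f, hf, hfD, hfK⟩ := hD _ hemb
    have hke : KEmb ar rel K S (fun x => h (F (B t) (f x))) := ⟨hf.comp hemb hfD, hfK⟩
    have hx := hXS _ hke
    push Not at hx
    obtain ⟨x, hxS, hxX⟩ := hx
    have hxK : h (F (B t) (f x)) ∉ K := hke.notMem hxS (Finset.disjoint_left.1 hSK hxS)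
    have hfx := hfD x (Finset.mem_union_left _ hxS)
    refine ⟨F (B t) (f x), fun _ => ⟨?_, ?_⟩⟩
    · apply Finset.mem_image_of_mem
      refine Finset.mem_sdiff.2 ⟨hfx, fun hc => hxK ?_⟩
      rw [← hKK]
      exact Finset.mem_image.2 ⟨f x, hc, rfl⟩
    · have := Finset.mem_image_of_mem h (hmemA t ht _ hfx)
      rw [him] at this
      rcases Finset.mem_union.1 this with h3 | h3
      · exact absurd h3 hxK
      · rcases Finset.mem_union.1 h3 with h3 | h3
        · exact h3
        · exact absurd (hYX _ h3) hxX
  choose z hz using hz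
  have hcard : (Finset.range (J i')).card ≤ (U (J i)).card := by
    apply Finset.card_le_card_of_injOn (fun t => h (z t))
    · intro t ht
      exact (hz t (Finset.mem_range.1 ht)).2
    · intro t ht t' ht' e
      have ht := Finset.mem_range.1 (Finset.mem_coe.1 ht)
      have ht' := Finset.mem_range.1 (Finset.mem_coe.1 ht')
      have hCA : ∀ t < J i', C t ⊆ K ∪ (U (J i') ∪ Y (J i')) := fun t ht =>
        (Finset.subset_biUnion_of_mem C (Finset.mem_range.2 ht)).trans
          (Finset.subset_union_left.trans Finset.subset_union_right)
      have hzz := hh.1 (hCA t ht (hz t ht).1) (hCA t' ht' (hz t' ht').1) e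
      by_contra hne
      exact Finset.disjoint_left.1 (hCC t t' hne) (hz t ht).1 (hzz ▸ (hz t' ht').1)
  rw [Finset.card_range, hUc, mul_comm] at hcard
  rw [hJ] at hJlt
  omega

theorem exists_sublist (L : List α) (T : Finset α) (hT : T ⊆ L.toFinset) (hL : L.Nodup) :
    ∃ l : List α, l.Sublist L ∧ l.Nodup ∧ l.toFinset = T ∧ l.length = T.card := by
  have h2 : (L.filter (fun x => decide (x ∈ T))).toFinset = T := by
    ext x
    simp only [List.mem_toFinset, List.mem_filter, decide_eq_true_eq]
    exact ⟨fun h => h.2, fun h => ⟨by simpa using hT h, h⟩⟩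
  refine ⟨L.filter (fun x => decide (x ∈ T)), List.filter_sublist, hL.filter _, h2, ?_⟩
  rw [← List.toFinset_card_of_nodup (hL.filter _), h2]

theorem kmono [Infinite α] {m : ℕ} (hm : ∀ n, profile ar rel n ≤ (m : Cardinal))
    {K : Finset α} (hK : ∀ x, x ∈ K ↔ x ∈ Ker ar rel) (A B : Finset α) (hA : Disjoint A K)
    (hB : Disjoint B K) (hc : A.card = B.card) :
    ∃ f, KEmb ar rel K A f ∧ A.image f = B := by
  by_contra hcon
  let χ : Unit → List α → Prop := fun _ l => ∃ f, KEmb ar rel K A f ∧ A.image f = l.toFinset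
  have hR : ∀ N, ∃ L : List α, L.Nodup ∧ L.length = N ∧ (∀ x ∈ L, x ∉ K) ∧
      ∀ l, l.Sublist L → (χ () l ↔ lim (χ ()) l.length []) := by
    intro N
    obtain ⟨L, h1, h2, h3, h4⟩ := ramsey K {()} χ 0 N
    refine ⟨L, h1, h2, h3, fun l hl => ?_⟩
    have := h4 l hl () (by simp) 0 le_rfl
    rw [zero_add] at this
    exact this
  by_cases hl : lim (χ ()) A.card []
  · apply pack hm hK B hB
    intro N
    obtain ⟨L, h1, h2, h3, h4⟩ := hR N
    refine ⟨L.toFinset, by rw [List.toFinset_card_of_nodup h1, h2],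
      Finset.disjoint_left.2 (fun x hx => h3 x (by simpa using hx)), fun f hf hfX => ?_⟩
    obtain ⟨l, hl1, hl2, hl3, hl4⟩ := exists_sublist L (B.image f)
      (Finset.image_subset_iff.2 hfX) h1
    have hcB : (B.image f).card = B.card := Finset.card_image_of_injOn
      (hf.1.1.mono (by exact_mod_cast Finset.subset_union_left))
    rw [hcB, ← hc] at hl4
    obtain ⟨g, hg, hg'⟩ := (h4 l hl1).2 (by rw [hl4]; exact hl)
    obtain ⟨e, he, he'⟩ := hf.inv
    have hmem : ∀ x ∈ A, g x ∈ B.image f := fun x hx => by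
      rw [← hl3, ← hg']; exact Finset.mem_image_of_mem _ hx
    refine hcon ⟨_, hg.comp he (fun x hx => Finset.mem_union_left _ (hmem x hx)), ?_⟩
    have : A.image (fun x => e (g x)) = (A.image g).image e := by rw [Finset.image_image]; rfl
    rw [this, hg', hl3, Finset.image_image]
    ext y
    simp only [Finset.mem_image, Function.comp]
    constructor
    · rintro ⟨x, hx, rfl⟩; rwa [he' x hx]
    · intro hy; exact ⟨y, hy, he' y hy⟩
  · apply pack hm hK A hA
    intro N
    obtain ⟨L, h1, h2, h3, h4⟩ := hR N
    refine ⟨L.toFinset, by rw [List.toFinset_card_of_nodup h1, h2],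
      Finset.disjoint_left.2 (fun x hx => h3 x (by simpa using hx)), fun f hf hfX => ?_⟩
    obtain ⟨l, hl1, hl2, hl3, hl4⟩ := exists_sublist L (A.image f)
      (Finset.image_subset_iff.2 hfX) h1
    have hcA : (A.image f).card = A.card := Finset.card_image_of_injOn
      (hf.1.1.mono (by exact_mod_cast Finset.subset_union_left))
    rw [hcA] at hl4
    apply hl
    rw [← hl4]
    exact (h4 l hl1).1 ⟨f, hf, hl3.symm⟩


/-- every finite set can be enumerated in an indiscernible way. -/
theorem indisc [Infinite α] {K : Finset α}
    (hmono : ∀ A B : Finset α, Disjoint A K → Disjoint B K → A.card = B.card →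
      ∃ f, KEmb ar rel K A f ∧ A.image f = B) (A : Finset α) (hA : Disjoint A K) :
    ∃ L : List α, L.Nodup ∧ L.toFinset = A ∧ ∀ l l' : List α, l.Sublist L → l'.Sublist L →
      l.length = l'.length → ∃ g, KEmb ar rel K l.toFinset g ∧ l.map g = l' := by
  have href : ∀ n : ℕ, ∃ r : List α, r.Nodup ∧ r.length = n ∧ ∀ x ∈ r, x ∉ K := by
    intro n
    obtain ⟨L, h1, h2, h3, -⟩ := ramsey K (∅ : Finset Unit) (fun _ _ => True) 0 n
    exact ⟨L, h1, h2, h3⟩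
  choose r hr1 hr2 hr3 using href
  let χ : List α → List α → Prop := fun p l => ∃ f, KEmb ar rel K l.toFinset f ∧ l.map f = p
  obtain ⟨L, h1, h2, h3, h4⟩ := ramsey K
    ((Finset.range (A.card + 1)).biUnion (fun n => (r n).permutations.toFinset)) χ 0 A.card
  have hchi : ∀ l, l.Sublist L → ∀ p, p.Perm (r l.length) →
      (χ p l ↔ lim (χ p) l.length []) := by
    intro l hl p hp
    have := h4 l hl p (Finset.mem_biUnion.2 ⟨l.length, Finset.mem_range.2 (by
      have := hl.length_le; omega), by simpa using hp⟩) 0 le_rfl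
    rw [zero_add] at this
    exact this
  have hL : ∀ l l' : List α, l.Sublist L → l'.Sublist L →
      l.length = l'.length → ∃ g, KEmb ar rel K l.toFinset g ∧ l.map g = l' := by
    intro l l' hl hl' hlen
    have hdis : ∀ l : List α, l.Sublist L → Disjoint l.toFinset K := fun l hl =>
      Finset.disjoint_left.2 (fun x hx => h3 x (hl.subset (by simpa using hx)))
    obtain ⟨f, hf, hf'⟩ := hmono l.toFinset (r l.length).toFinset (hdis l hl)
      (Finset.disjoint_left.2 (fun x hx => hr3 _ x (by simpa using hx)))
      (by rw [List.toFinset_card_of_nodup (h1.sublist hl), List.toFinset_card_of_nodup (hr1 _),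
            hr2])
    have hnd : (l.map f).Nodup := (h1.sublist hl).map_on (by
      intro x hx y hy e
      exact hf.1.1 (by simp [hx]) (by simp [hy]) e)
    have hperm : (l.map f).Perm (r l.length) := by
      refine List.perm_of_nodup_nodup_toFinset_eq hnd (hr1 _) ?_
      rw [← hf']
      ext y
      simp
    have hc := (hchi l hl _ hperm).1 ⟨f, hf, rfl⟩
    rw [hlen] at hc hperm
    obtain ⟨g, hg, hg'⟩ := (hchi l' hl' _ hperm).2 hc
    obtain ⟨e, he, he'⟩ := hg.inv
    have him : ∀ x ∈ l, f x ∈ l'.toFinset.image g := by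
      intro x hx
      have : f x ∈ l.map f := List.mem_map_of_mem hx
      rw [← hg'] at this
      simpa using this
    refine ⟨_, hf.comp he (fun x hx => Finset.mem_union_left _ (him x (by simpa using hx))), ?_⟩
    have h5 : l.map (fun x => e (f x)) = (l.map f).map e := by rw [List.map_map]; rfl
    rw [h5, ← hg', List.map_map]
    conv_rhs => rw [← List.map_id l']
    exact List.map_congr_left (fun x hx => he' x (by simpa using hx))
  have hLK : Disjoint L.toFinset K :=
    Finset.disjoint_left.2 (fun x hx => h3 x (by simpa using hx))
  obtain ⟨e, he, he'⟩ := hmono L.toFinset A hLK hA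
    (by rw [List.toFinset_card_of_nodup h1, h2])
  obtain ⟨d, hd, hd'⟩ := he.inv
  have hde : ∀ x ∈ L, d (e x) = x := fun x hx => hd' x (by simpa using hx)
  refine ⟨L.map e, h1.map_on (fun x hx y hy h => by rw [← hde x hx, h, hde y hy]), ?_, ?_⟩
  · rw [← he']
    ext y
    simp
  · intro k k' hk hk' hlen
    obtain ⟨l, hl, rfl⟩ := List.sublist_map_iff.1 hk
    obtain ⟨l', hl', rfl⟩ := List.sublist_map_iff.1 hk'
    obtain ⟨g, hg, rfl⟩ := hL l l' hl hl' (by simpa using hlen)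
    have hd1 : KEmb ar rel K (l.map e).toFinset d := hd.mono (by
      intro y hy
      simp only [List.mem_toFinset, List.mem_map] at hy
      obtain ⟨x, hx, rfl⟩ := hy
      exact Finset.mem_image_of_mem _ (by simpa using hl.subset hx))
    refine ⟨_, (hd1.comp hg (B := l.toFinset) ?_).comp he (B := L.toFinset) ?_, ?_⟩
    · intro y hy
      simp only [List.mem_toFinset, List.mem_map] at hy
      obtain ⟨x, hx, rfl⟩ := hy
      rw [hde x (hl.subset hx)]
      simp [hx]
    · intro y hy
      simp only [List.mem_toFinset, List.mem_map] at hy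
      obtain ⟨x, hx, rfl⟩ := hy
      rw [hde x (hl.subset hx)]
      have := hl'.subset (List.mem_map_of_mem (f := g) hx)
      simp [this]
    · rw [List.map_map, List.map_map]
      refine List.map_congr_left (fun x hx => ?_)
      simp only [Function.comp]
      rw [hde x (hl.subset hx)]

theorem chain_finite [Infinite α] {K : Finset α}
    (hmono : ∀ A B : Finset α, Disjoint A K → Disjoint B K → A.card = B.card →
      ∃ f, KEmb ar rel K A f ∧ A.image f = B) (A : Finset α) :
    ∃ v : α → ℕ, Set.InjOn v (↑A : Set α) ∧ ∀ (S : Finset α) (f : α → α), S ⊆ A →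
      Disjoint S K → (∀ x ∈ S, f x ∈ A ∧ f x ∉ K) →
      (∀ x ∈ S, ∀ y ∈ S, v x < v y → v (f x) < v (f y)) → (∀ x ∈ K, f x = x) →
      KEmb ar rel K S f := by
  obtain ⟨L, h1, h2, h3⟩ := indisc hmono (A \ K) Finset.sdiff_disjoint
  let M := L ++ (A ∩ K).toList
  have hLm : ∀ x, x ∈ L ↔ x ∈ A ∧ x ∉ K := by
    intro x
    rw [← List.mem_toFinset, h2, Finset.mem_sdiff]
  have hMm : ∀ x, x ∈ M ↔ x ∈ A := by
    intro x
    simp only [M, List.mem_append, hLm, Finset.mem_toList, Finset.mem_inter]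
    tauto
  refine ⟨fun x => M.idxOf x, ?_, ?_⟩
  · intro x hx y hy e
    exact (List.idxOf_inj ((hMm x).2 hx)).1 e
  intro S f hSA hSK hfS hlt hfK
  have hlt : ∀ x ∈ S, ∀ y ∈ S, M.idxOf x < M.idxOf y → M.idxOf (f x) < M.idxOf (f y) := hlt
  have hidx : ∀ x ∈ L, M.idxOf x = L.idxOf x := fun x hx => List.idxOf_append_of_mem hx
  have hSL : ∀ x ∈ S, x ∈ L := fun x hx => (hLm x).2 ⟨hSA hx, Finset.disjoint_left.1 hSK hx⟩
  have hfL : ∀ x ∈ S, f x ∈ L := fun x hx => (hLm _).2 (hfS x hx)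
  obtain ⟨l, hl1, hl2, hl3, hl4⟩ := exists_sublist L S
    (fun x hx => by simpa using hSL x hx) h1
  have hlS : ∀ x, x ∈ l ↔ x ∈ S := fun x => by rw [← hl3, List.mem_toFinset]
  have hLp : L.Pairwise (fun a b => L.idxOf a < L.idxOf b) := by
    rw [List.pairwise_iff_getElem]
    intro i j hi hj hij
    rw [h1.idxOf_getElem, h1.idxOf_getElem]
    exact hij
  have hfp : (l.map f).Pairwise (fun a b => L.idxOf a < L.idxOf b) := by
    rw [List.pairwise_map]
    refine (hLp.sublist hl1).imp_of_mem ?_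
    intro a b ha hb hab
    rw [hlS] at ha hb
    have := hlt a ha b hb (by rw [hidx a (hSL a ha), hidx b (hSL b hb)]; exact hab)
    rwa [hidx _ (hfL a ha), hidx _ (hfL b hb)] at this
  have hfn : (l.map f).Nodup := hfp.imp (fun h e => by rw [e] at h; exact lt_irrefl _ h)
  have hanti : Std.Antisymm (fun a b : α => L.idxOf a < L.idxOf b) :=
    ⟨fun a b h h' => absurd (lt_trans h h') (lt_irrefl _)⟩
  have hsub : (l.map f).Sublist L := List.sublist_of_subperm_of_pairwise
    (List.subperm_of_subset hfn (by
      intro y hy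
      obtain ⟨x, hx, rfl⟩ := List.mem_map.1 hy
      exact hfL x ((hlS x).1 hx))) hfp hLp
  obtain ⟨g, hg, hg'⟩ := h3 l (l.map f) hl1 hsub (by simp)
  rw [hl3] at hg
  have heq := List.map_inj_left.1 hg'
  refine ⟨hg.1.congr ?_, hfK⟩
  intro x hx
  rcases Finset.mem_union.1 hx with hx | hx
  · exact heq x ((hlS x).2 hx)
  · rw [hg.2 x hx, hfK x hx]

theorem chainable [Infinite α] {K : Finset α}
    (hmono : ∀ A B : Finset α, Disjoint A K → Disjoint B K → A.card = B.card →
      ∃ f, KEmb ar rel K A f ∧ A.image f = B) : FChainable ar rel K := by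
  choose v hv1 hv2 using chain_finite (ar := ar) (rel := rel) hmono
  let U : Ultrafilter (Finset α) := Ultrafilter.of Filter.atTop
  have hU : ∀ S : Finset α, ∀ᶠ D in (U : Filter (Finset α)), S ⊆ D := fun S =>
    Ultrafilter.of_le _ (Filter.eventually_ge_atTop S)
  let le : α → α → Prop := fun a b => ∀ᶠ D in (U : Filter (Finset α)), v D a ≤ v D b
  have hle : ∀ a b, ∀ᶠ D in (U : Filter (Finset α)), (le a b ↔ v D a ≤ v D b) := by
    intro a b
    by_cases h : le a b
    · filter_upwards [(h : ∀ᶠ D in (U : Filter (Finset α)), v D a ≤ v D b)] with D hD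
      simp only [h, hD]
    · have h' : ¬ ∀ᶠ D in (U : Filter (Finset α)), v D a ≤ v D b := h
      rw [← Ultrafilter.eventually_not] at h'
      filter_upwards [h'] with D hD
      simp only [h, hD]
  refine ⟨le, { refl := ?_, trans := ?_, antisymm := ?_, total := ?_ }, ?_⟩
  · intro a
    exact Filter.Eventually.of_forall fun D => le_rfl
  · intro a b c h h'
    filter_upwards [h, h'] with D hD hD'
    exact hD.trans hD'
  · intro a b h h'
    obtain ⟨D, ⟨hD, hD'⟩, hD''⟩ := ((Filter.Eventually.and h h').and (hU {a, b})).exists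
    exact hv1 D (hD'' (by simp)) (hD'' (by simp)) (le_antisymm hD hD')
  · intro a b
    refine Ultrafilter.eventually_or.1 (Filter.Eventually.of_forall fun D => le_total _ _)
  intro A B f hA hB hf hord hfK
  refine ⟨?_, ?_⟩
  · refine hf.union ⟨fun x hx => by rw [hfK x hx]; exact hx, fun x hx y hy e => ?_,
      fun x hx => ⟨x, hx, hfK x hx⟩⟩ ?_
    · rwa [hfK x hx, hfK y hy] at e
    · intro x hx y hy e
      rcases hx with hx | hx <;> rcases hy with hy | hy
      · exact hf.injOn hx hy e
      · rw [hfK y hy] at e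
        exact absurd hy (e ▸ hB (hf.mapsTo hx))
      · rw [hfK x hx] at e
        exact absurd hx (e ▸ hB (hf.mapsTo hy))
      · rwa [hfK x hx, hfK y hy] at e
  · intro i x hx
    let S : Finset α := (Finset.univ.image x).filter (fun y => y ∉ K)
    have hSA : ∀ y ∈ S, y ∈ A := by
      intro y hy
      obtain ⟨hy, hyK⟩ := Finset.mem_filter.1 hy
      obtain ⟨j, -, rfl⟩ := Finset.mem_image.1 hy
      exact (hx j).elim (fun h => h) (fun h => absurd h hyK)
    have e1 : ∀ᶠ D in (U : Filter (Finset α)), ∀ a ∈ S, ∀ b ∈ S,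
        ((le a b ↔ v D a ≤ v D b) ∧ (le (f a) (f b) ↔ v D (f a) ≤ v D (f b))) := by
      rw [Filter.eventually_all_finset]
      intro a _
      rw [Filter.eventually_all_finset]
      intro b _
      exact (hle a b).and (hle (f a) (f b))
    obtain ⟨D, hD1, hD2⟩ := (e1.and (hU (S ∪ S.image f))).exists
    have hk := hv2 D S f (Finset.subset_union_left.trans hD2)
      (Finset.disjoint_left.2 fun y hy => (Finset.mem_filter.1 hy).2)
      (fun y hy => ⟨hD2 (Finset.mem_union_right _ (Finset.mem_image_of_mem _ hy)),
        fun h => hB (hf.mapsTo (hSA y hy)) h⟩)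
      (by
        intro a ha b hb hab
        rw [← not_le] at hab ⊢
        rw [← (hD1 b hb a ha).1] at hab
        rw [← (hD1 b hb a ha).2, ← hord b (hSA b hb) a (hSA a ha)]
        exact hab) hfK
    refine hk.1.2 i x (fun j => ?_)
    by_cases hj : x j ∈ K
    · exact Finset.mem_coe.2 (Finset.mem_union_right _ hj)
    · exact Finset.mem_coe.2 (Finset.mem_union_left _ (Finset.mem_filter.2
        ⟨Finset.mem_image_of_mem _ (Finset.mem_univ _), hj⟩))

theorem one_three [Infinite α] (h : ∃ m : ℕ, ∀ n, profile ar rel n ≤ (m : Cardinal)) :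
    ∃ F : Finset α, FChainable ar rel F := by
  obtain ⟨m, hm⟩ := h
  have hfin := ker_finite hm
  have hK : ∀ x, x ∈ hfin.toFinset ↔ x ∈ Ker ar rel := fun x => hfin.mem_toFinset
  exact ⟨hfin.toFinset, chainable (kmono hm hK)⟩


theorem three_four (F : Finset α) (h : FChainable ar rel F) : FMonomorphic ar rel F := by
  obtain ⟨le, hle, h⟩ := h
  intro A B hA hB hc
  letI : LinearOrder α :=
    { le := le
      le_refl := hle.refl
      le_trans := hle.trans
      le_antisymm := hle.antisymm
      le_total := hle.total
      toDecidableLE := fun _ _ => Classical.propDecidable _ }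
  let e : A ≃o B := (A.orderIsoOfFin rfl).symm.trans (B.orderIsoOfFin hc.symm)
  let f : α → α := fun x => if hx : x ∈ A then (e ⟨x, hx⟩ : B) else x
  have hfA : ∀ x (hx : x ∈ A), f x = (e ⟨x, hx⟩ : B) := fun x hx => dif_pos hx
  have hfF : ∀ y ∈ F, f y = y := fun y hy =>
    dif_neg (fun hyA => Set.disjoint_left.1 hA (Finset.mem_coe.2 hyA) (Finset.mem_coe.2 hy))
  have hbij : Set.BijOn f (↑A : Set α) (↑B : Set α) := by
    refine ⟨fun x hx => ?_, fun x hx y hy hxy => ?_, fun y hy => ?_⟩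
    · rw [hfA x hx]; exact (e ⟨x, hx⟩).2
    · rw [hfA x hx, hfA y hy] at hxy
      exact congrArg Subtype.val (e.injective (Subtype.ext hxy))
    · refine ⟨(e.symm ⟨y, hy⟩ : A), (e.symm ⟨y, hy⟩).2, ?_⟩
      rw [hfA _ (e.symm ⟨y, hy⟩).2]
      simp
  have hiso := h (↑A : Set α) (↑B : Set α) f
    (fun x hx hxF => Set.disjoint_left.1 hA hx hxF) (fun x hx hxF => Set.disjoint_left.1 hB hx hxF)
    hbij (by
      intro a ha b hb
      rw [hfA a ha, hfA b hb]
      exact (e.le_iff_le (x := ⟨a, ha⟩) (y := ⟨b, hb⟩)).symm) hfF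
  exact ⟨f, hfF, ⟨hbij, fun i x hx => hiso.2 i x (fun j => Or.inl (hx j))⟩, hiso⟩

theorem four_two [Infinite α] (F : Finset α) (h : FMonomorphic ar rel F) :
    ∃ Prt : Set (Set α), IsMonoDecomp ar rel Prt ∧ Prt.Finite ∧
      {B ∈ Prt | B.Infinite}.Subsingleton := by
  let Prt : Set (Set α) := insert ((↑F : Set α)ᶜ) ((fun y : α => ({y} : Set α)) '' (↑F : Set α))
  have hinf : ((↑F : Set α)ᶜ).Infinite := F.finite_toSet.infinite_compl
  refine ⟨Prt, ⟨⟨?_, ?_⟩, ?_⟩, ?_, ?_⟩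
  · rintro (h0 | ⟨y, -, h0⟩)
    · rw [← h0] at hinf
      exact hinf Set.finite_empty
    · exact (Set.singleton_ne_empty y) h0
  · intro a
    by_cases ha : a ∈ F
    · refine ⟨{a}, ⟨Or.inr ⟨a, ha, rfl⟩, rfl⟩, ?_⟩
      rintro B ⟨rfl | ⟨y, hy, rfl⟩, haB⟩
      · exact absurd ha haB
      · rw [Set.mem_singleton_iff.1 haB]
    · refine ⟨(↑F : Set α)ᶜ, ⟨Or.inl rfl, ha⟩, ?_⟩
      rintro B ⟨rfl | ⟨y, hy, rfl⟩, haB⟩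
      · rfl
      · rw [Set.mem_singleton_iff.1 haB] at ha
        exact absurd hy ha
  · intro A A' hc hB
    have hF : ∀ y ∈ F, (y ∈ A ↔ y ∈ A') := by
      intro y hy
      have h1 := hB {y} (Or.inr ⟨y, hy, rfl⟩)
      have key : ∀ A : Finset α, ((↑A : Set α) ∩ {y}).ncard = if y ∈ A then 1 else 0 := by
        intro A
        split_ifs with hyA
        · rw [Set.inter_eq_right.2 (by simpa using hyA), Set.ncard_singleton]
        · have : (↑A : Set α) ∩ {y} = ∅ := by
            ext z
            simp only [Set.mem_inter_iff, Finset.mem_coe, Set.mem_singleton_iff,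
              Set.mem_empty_iff_false, iff_false, not_and]
            rintro hz rfl
            exact hyA hz
          rw [this, Set.ncard_empty]
      rw [key, key] at h1
      by_cases h2 : y ∈ A <;> by_cases h3 : y ∈ A' <;> simp_all
    have key : ∀ A : Finset α, ((↑A : Set α) ∩ (↑F : Set α)ᶜ).ncard = (A \ F).card := by
      intro A
      rw [← Set.sdiff_eq, ← Finset.coe_sdiff, Set.ncard_coe_finset]
    have h1 := hB _ (Or.inl rfl)
    rw [key, key] at h1
    have hdis : ∀ A : Finset α, Disjoint (↑(A \ F) : Set α) (↑F : Set α) := fun A => by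
      exact_mod_cast (Finset.sdiff_disjoint : Disjoint (A \ F) F)
    obtain ⟨f, hfF, hf1, hf2⟩ := h (A \ F) (A' \ F) (hdis A) (hdis A') h1
    have hsub : ∀ x ∈ A, x ∈ (↑(A \ F) : Set α) ∪ ↑F := by
      intro x hx
      by_cases hxF : x ∈ F
      · exact Or.inr hxF
      · exact Or.inl (by simp [hx, hxF])
    refine ⟨f, ⟨?_, ?_, ?_⟩, fun i x hx => hf2.2 i x (fun j => hsub _ (hx j))⟩
    · intro x hx
      by_cases hxF : x ∈ F
      · rw [hfF x hxF]; exact (hF x hxF).1 hx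
      · have := hf1.1.mapsTo (show x ∈ (↑(A \ F) : Set α) by simp [hxF, Finset.mem_coe.1 hx])
        exact Finset.mem_coe.2 (Finset.mem_sdiff.1 (Finset.mem_coe.1 this)).1
    · exact hf2.1.injOn.mono hsub
    · intro y hy
      by_cases hyF : y ∈ F
      · exact ⟨y, (hF y hyF).2 hy, hfF y hyF⟩
      · obtain ⟨x, hx, hxy⟩ := hf1.1.surjOn (show y ∈ (↑(A' \ F) : Set α) by
          simp [hyF, Finset.mem_coe.1 hy])
        exact ⟨x, Finset.mem_coe.2 (Finset.mem_sdiff.1 (Finset.mem_coe.1 hx)).1, hxy⟩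
  · exact (F.finite_toSet.image _).insert _
  · rintro B ⟨rfl | ⟨y, -, rfl⟩, hB⟩ B' ⟨rfl | ⟨y', -, rfl⟩, hB'⟩
    · rfl
    · exact absurd (Set.finite_singleton _) hB'
    · exact absurd (Set.finite_singleton _) hB
    · exact absurd (Set.finite_singleton _) hB

theorem two_one (h : ∃ Prt : Set (Set α), IsMonoDecomp ar rel Prt ∧ Prt.Finite ∧
      {B ∈ Prt | B.Infinite}.Subsingleton) :
    ∃ m : ℕ, ∀ n, profile ar rel n ≤ (m : Cardinal) := by
  obtain ⟨Prt, ⟨hpart, hiso⟩, hfin, hsub⟩ := h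
  have hVf : (⋃ B ∈ {B ∈ Prt | B.Finite}, B).Finite :=
    (hfin.subset (Set.sep_subset _ _)).biUnion (fun B hB => hB.2)
  let V := hVf.toFinset
  have hV : ∀ x, x ∈ V ↔ ∃ B ∈ Prt, B.Finite ∧ x ∈ B := by
    intro x
    simp only [V, Set.Finite.mem_toFinset, Set.mem_iUnion]
    constructor
    · rintro ⟨B, hB, hx⟩; exact ⟨B, hB.1, hB.2, hx⟩
    · rintro ⟨B, hB, hB', hx⟩; exact ⟨B, ⟨hB, hB'⟩, hx⟩
  have key : ∀ A A' : Finset α, A.card = A'.card → A ∩ V = A' ∩ V →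
      IsoOn ar rel (↑A : Set α) (↑A' : Set α) := by
    intro A A' hc hAA
    refine hiso A A' hc (fun B hB => ?_)
    by_cases hBf : B.Finite
    · have h1 : ∀ A : Finset α, (↑A : Set α) ∩ B = (↑(A ∩ V) : Set α) ∩ B := by
        intro A
        ext x
        simp only [Set.mem_inter_iff, Finset.mem_coe, Finset.mem_inter]
        constructor
        · rintro ⟨hx, hxB⟩; exact ⟨⟨hx, (hV x).2 ⟨B, hB, hBf, hxB⟩⟩, hxB⟩
        · rintro ⟨⟨hx, _⟩, hxB⟩; exact ⟨hx, hxB⟩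
      rw [h1 A, h1 A', hAA]
    · have hBV : ∀ x, x ∈ B ↔ x ∉ V := by
        intro x
        obtain ⟨C, ⟨hC, hxC⟩, hu⟩ := hpart.2 x
        constructor
        · intro hxB hxV
          obtain ⟨B', hB', hf', hx'⟩ := (hV x).1 hxV
          have e1 := hu B ⟨hB, hxB⟩
          have e2 := hu B' ⟨hB', hx'⟩
          rw [e1, ← e2] at hBf
          exact hBf hf'
        · intro hxV
          by_cases hCf : C.Finite
          · exact absurd ((hV x).2 ⟨C, hC, hCf, hxC⟩) hxV
          · rw [hsub ⟨hB, hBf⟩ ⟨hC, hCf⟩]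
            exact hxC
      have h1 : ∀ A : Finset α, ((↑A : Set α) ∩ B).ncard = (A \ V).card := by
        intro A
        rw [← Set.ncard_coe_finset]
        congr 1
        ext x
        simp [hBV]
      rw [h1 A, h1 A']
      have e1 := Finset.card_sdiff_add_card_inter A V
      have e2 := Finset.card_sdiff_add_card_inter A' V
      rw [hAA] at e1
      omega
  refine ⟨V.powerset.card, fun n => ?_⟩
  have hinj : Function.Injective (fun q : Quot (fun A B : {s : Finset α // s.card = n} =>
      IsoOn ar rel (↑A.1 : Set α) (↑B.1 : Set α)) =>
      (⟨q.out.1 ∩ V, Finset.mem_powerset.2 Finset.inter_subset_right⟩ : V.powerset)) := by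
    intro q q' hqq
    have h1 : q.out.1 ∩ V = q'.out.1 ∩ V := congrArg Subtype.val hqq
    have h2 := key q.out.1 q'.out.1 (by rw [q.out.2, q'.out.2]) h1
    rw [← Quot.out_eq q, ← Quot.out_eq q']
    exact Quot.sound h2
  have h1 := Cardinal.mk_le_of_injective hinj
  rwa [Cardinal.mk_coe_finset] at h1

end

end BP


/-- **Theorem.** For an infinite relational structure `R` the following are equivalent:
(i) the profile of `R` is bounded by some integer; (ii) `R` has a monomorphic decomposition into
finitely many blocks, at most one being infinite; (iii) `R` is almost chainable; (iv) `R` is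
almost monomorphic. -/
theorem bounded_profile_tfae [Infinite α]
    (ar : I → ℕ) (rel : ∀ i, Set (Fin (ar i) → α)) :
    ((∃ m : ℕ, ∀ n : ℕ, profile ar rel n ≤ (m : Cardinal)) ↔
        (∃ Prt : Set (Set α), IsMonoDecomp ar rel Prt ∧ Prt.Finite ∧
          {B ∈ Prt | B.Infinite}.Subsingleton)) ∧
      ((∃ m : ℕ, ∀ n : ℕ, profile ar rel n ≤ (m : Cardinal)) ↔
        (∃ F : Finset α, FChainable ar rel F)) ∧
      ((∃ m : ℕ, ∀ n : ℕ, profile ar rel n ≤ (m : Cardinal)) ↔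
        (∃ F : Finset α, FMonomorphic ar rel F)) := by

  have h13 := BP.one_three (ar := ar) (rel := rel)
  have h34 : (∃ F : Finset α, FChainable ar rel F) → ∃ F : Finset α, FMonomorphic ar rel F :=
    fun ⟨F, h⟩ => ⟨F, BP.three_four F h⟩
  have h42 : (∃ F : Finset α, FMonomorphic ar rel F) → _ := fun ⟨F, h⟩ => BP.four_two F h
  have h21 := BP.two_one (ar := ar) (rel := rel)
  exact ⟨⟨fun h => h42 (h34 (h13 h)), h21⟩, ⟨h13, fun h => h21 (h42 (h34 h))⟩,
    ⟨fun h => h34 (h13 h), fun h => h21 (h42 h)⟩⟩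
end
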